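/- arXiv:1710.00647 — 4 statements merged into one kernel-verified Lean document; each statement's English description precedes it below -/
import Mathlib

section
/- Let k ≥ 6 with k ≡ 2 (mod 4). Then for every integer t ≥ 1, there exists an almost resolvable k-cycle system of order 2kt+1, except possibly when t = 2 and k ≥ 14. -/
/-- The set of edges of the closed walk `c 0, c 1, …, c (k-1), c 0`.
When `c` is injective, this is a cycle of length `k`. -/
def cycleEdgeSet {V : Type*} {k : ℕ} (c : ZMod k → V) : Set (Sym2 V) :=
  {e | ∃ i : ZMod k, e = s(c i, c (i + 1))}

/-- `HasARCS k v` asserts the existence of an almost resolvable `k`-cycle system of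
order `v`: a collection of `k`-cycles whose edge sets partition the edge set of the
complete graph on `v` vertices, partitioned into `(v-1)/2` almost parallel classes
(each consisting of `(v-1)/k` pairwise vertex-disjoint `k`-cycles) together with one
half-parallel class (consisting of `(v-1)/(2k)` pairwise vertex-disjoint `k`-cycles). -/
def HasARCS (k v : ℕ) : Prop :=
  ∃ (apc : Fin ((v - 1) / 2) → Fin ((v - 1) / k) → ZMod k → Fin v)
    (hpc : Fin ((v - 1) / (2 * k)) → ZMod k → Fin v),
    (∀ i j, Function.Injective (apc i j)) ∧
    (∀ j, Function.Injective (hpc j)) ∧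
    (∀ i, ∀ j₁ j₂, j₁ ≠ j₂ →
      Disjoint (Set.range (apc i j₁)) (Set.range (apc i j₂))) ∧
    (∀ j₁ j₂, j₁ ≠ j₂ → Disjoint (Set.range (hpc j₁)) (Set.range (hpc j₂))) ∧
    (∀ e : Sym2 (Fin v), ¬ e.IsDiag →
      ∃! p : (Fin ((v - 1) / 2) × Fin ((v - 1) / k)) ⊕ Fin ((v - 1) / (2 * k)),
        e ∈ Sum.elim (fun q => cycleEdgeSet (apc q.1 q.2))
              (fun j => cycleEdgeSet (hpc j)) p)


/-- An edge `{a,b}` lies on the cyclic sequence `c`. -/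
def OnCyc {V : Type*} {k : ℕ} (c : ZMod k → V) (a b : V) : Prop :=
  ∃ n, s(c n, c (n + 1)) = s(a, b)

/-- Covering version of an almost resolvable cycle system on abstract index types. -/
structure Sys (k : ℕ) (V I J H : Type) where
  apc : I → J → ZMod k → V
  hpc : H → ZMod k → V
  hinj : ∀ h h' n n', hpc h n = hpc h' n' → h = h' ∧ n = n'
  cover : ∀ i, ∃ w, ∀ x, x ≠ w → ∃ j n, apc i j n = x
  edges : ∀ a b, a ≠ b → (∃ i j, OnCyc (apc i j) a b) ∨ ∃ h, OnCyc (hpc h) a b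

theorem inj_of_cover {S V : Type*} [Fintype S] [DecidableEq V] (f : S → V)
    (F : Finset V) (hF : Fintype.card S = F.card) (h : ∀ x ∈ F, ∃ s, f s = x) :
    Function.Injective f := by
  have h1 : F ⊆ Finset.univ.image f := by
    intro x hx
    obtain ⟨s, hs⟩ := h x hx
    exact Finset.mem_image.2 ⟨s, Finset.mem_univ _, hs⟩
  have h2 := Finset.card_le_card h1
  have h3 : (Finset.univ.image f).card ≤ (Finset.univ : Finset S).card := Finset.card_image_le
  have h4 : (Finset.univ.image f).card = (Finset.univ : Finset S).card := by
    rw [Finset.card_univ] at *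
    omega
  have := Finset.card_image_iff.1 h4
  exact fun a b hab => this (by simp) (by simp) hab

theorem hasARCS_of_sys (k t : ℕ) (hk : 0 < k) {V I J H : Type}
    [Fintype V] [Fintype I] [Fintype J] [Fintype H]
    (hV : Fintype.card V = 2 * k * t + 1) (hI : Fintype.card I = k * t)
    (hJ : Fintype.card J = 2 * t) (hH : Fintype.card H = t)
    (S : Sys k V I J H) : HasARCS k (2 * k * t + 1) := by
  classical
  have : NeZero k := ⟨hk.ne'⟩
  have e1 : (2 * k * t + 1 - 1) / 2 = k * t := by
    rw [Nat.add_sub_cancel, mul_assoc]; exact Nat.mul_div_cancel_left _ (by norm_num)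
  have e2 : (2 * k * t + 1 - 1) / k = 2 * t := by
    rw [Nat.add_sub_cancel, show 2 * k * t = k * (2 * t) by ring]
    exact Nat.mul_div_cancel_left _ hk
  have e3 : (2 * k * t + 1 - 1) / (2 * k) = t := by
    rw [Nat.add_sub_cancel]
    exact Nat.mul_div_cancel_left _ (by omega)
  let eV : V ≃ Fin (2 * k * t + 1) := Fintype.equivFinOfCardEq hV
  let eI : Fin ((2 * k * t + 1 - 1) / 2) ≃ I := (Fintype.equivFinOfCardEq (hI.trans e1.symm)).symm
  let eJ : Fin ((2 * k * t + 1 - 1) / k) ≃ J := (Fintype.equivFinOfCardEq (hJ.trans e2.symm)).symm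
  let eH : Fin ((2 * k * t + 1 - 1) / (2 * k)) ≃ H :=
    (Fintype.equivFinOfCardEq (hH.trans e3.symm)).symm
  -- injectivity within a class
  have A1 : ∀ i, Function.Injective (fun p : J × ZMod k => S.apc i p.1 p.2) := by
    intro i
    obtain ⟨w, hw⟩ := S.cover i
    refine inj_of_cover _ (Finset.univ.erase w) ?_ ?_
    · rw [Finset.card_erase_of_mem (Finset.mem_univ _), Finset.card_univ, hV, Fintype.card_prod, hJ,
        ZMod.card]
      rw [Nat.add_sub_cancel]; ring
    · intro x hx
      obtain ⟨j, n, h⟩ := hw x (Finset.ne_of_mem_erase hx)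
      exact ⟨(j, n), h⟩
  -- injectivity of edge slots
  let slot : (I × J × ZMod k) ⊕ (H × ZMod k) → Sym2 V := Sum.elim
    (fun p => s(S.apc p.1 p.2.1 p.2.2, S.apc p.1 p.2.1 (p.2.2 + 1)))
    (fun p => s(S.hpc p.1 p.2, S.hpc p.1 (p.2 + 1)))
  have A2 : Function.Injective slot := by
    refine inj_of_cover slot (Finset.univ.filter (fun e : Sym2 V => ¬ e.IsDiag)) ?_ ?_
    · have := Sym2.card_subtype_not_diag (α := V)
      rw [Fintype.card_subtype] at this
      rw [this, hV]
      simp only [Fintype.card_sum, Fintype.card_prod, ZMod.card, hI, hJ, hH]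
      rw [Nat.choose_two_right, Nat.add_sub_cancel]
      symm
      apply Nat.div_eq_of_eq_mul_left (by norm_num)
      ring
    · intro e he
      induction e using Sym2.ind with
      | _ a b =>
        have hab : a ≠ b := by simpa using he
        rcases S.edges a b hab with ⟨i, j, n, h⟩ | ⟨h', n, h⟩
        · exact ⟨Sum.inl (i, j, n), h⟩
        · exact ⟨Sum.inr (h', n), h⟩
  refine ⟨fun i j n => eV (S.apc (eI i) (eJ j) n), fun h n => eV (S.hpc (eH h) n), ?_, ?_, ?_, ?_, ?_⟩
  · intro i j n n' h
    have := A1 (eI i) (a₁ := (eJ j, n)) (a₂ := (eJ j, n')) (eV.injective h)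
    simpa using this
  · intro h n n' hh
    exact (S.hinj _ _ _ _ (eV.injective hh)).2
  · intro i j j' hj
    rw [Set.disjoint_left]
    rintro x ⟨n, rfl⟩ ⟨n', h⟩
    have := A1 (eI i) (a₁ := (eJ j', n')) (a₂ := (eJ j, n)) (eV.injective h)
    simp only [Prod.mk.injEq, EmbeddingLike.apply_eq_iff_eq] at this
    exact hj this.1.symm
  · intro j j' hj
    rw [Set.disjoint_left]
    rintro x ⟨n, rfl⟩ ⟨n', h⟩
    have := (S.hinj _ _ _ _ (eV.injective h)).1
    exact hj (eH.injective this).symm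
  · intro e he
    induction e using Sym2.ind with
    | _ a b =>
      have hab : a ≠ b := by simpa using he
      have key : ∀ p : (Fin ((2 * k * t + 1 - 1) / 2) × Fin ((2 * k * t + 1 - 1) / k)) ⊕
          Fin ((2 * k * t + 1 - 1) / (2 * k)),
          s(a, b) ∈ Sum.elim (fun q => cycleEdgeSet (fun n => eV (S.apc (eI q.1) (eJ q.2) n)))
              (fun j => cycleEdgeSet (fun n => eV (S.hpc (eH j) n))) p ↔
            ∃ n : ZMod k, slot (Sum.elim (fun q => Sum.inl (eI q.1, eJ q.2, n))
              (fun j => Sum.inr (eH j, n)) p) = s(eV.symm a, eV.symm b) := by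
        have tr : ∀ u v : V, s(a, b) = s(eV u, eV v) ↔ s(u, v) = s(eV.symm a, eV.symm b) := by
          intro u v
          simp only [Sym2.eq_iff, Equiv.eq_symm_apply]
          constructor <;> (rintro (⟨h1, h2⟩ | ⟨h1, h2⟩) <;> simp [h1, h2])
        rintro (q | j)
        · simp only [Sum.elim_inl, cycleEdgeSet, Set.mem_ofPred_eq, tr, slot]
        · simp only [Sum.elim_inr, cycleEdgeSet, Set.mem_ofPred_eq, tr, slot]
      have ex : ∃ p, s(a, b) ∈ Sum.elim
          (fun q : Fin ((2 * k * t + 1 - 1) / 2) × Fin ((2 * k * t + 1 - 1) / k) =>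
            cycleEdgeSet (fun n => eV (S.apc (eI q.1) (eJ q.2) n)))
              (fun j => cycleEdgeSet (fun n => eV (S.hpc (eH j) n))) p := by
        rcases S.edges (eV.symm a) (eV.symm b) (by simpa using hab) with ⟨i, j, n, h⟩ | ⟨h', n, h⟩
        · refine ⟨Sum.inl (eI.symm i, eJ.symm j), (key _).2 ⟨n, ?_⟩⟩
          simpa [slot] using h
        · refine ⟨Sum.inr (eH.symm h'), (key _).2 ⟨n, ?_⟩⟩
          simpa [slot] using h
      obtain ⟨p, hp⟩ := ex
      refine ⟨p, hp, ?_⟩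
      intro p' hp'
      obtain ⟨n, hn⟩ := (key p).1 hp
      obtain ⟨n', hn'⟩ := (key p').1 hp'
      have := A2 (hn'.trans hn.symm)
      rcases p with ⟨q1, q2⟩ | j <;> rcases p' with ⟨q1', q2'⟩ | j' <;>
        simp at this ⊢
      · exact ⟨this.1, this.2.1⟩
      · exact this.1

/-- A `k`-ARCS(2k+1) on the points `∞ ∪ Bool × ZMod k`, half cycle avoiding `∞`. -/
structure Base (k : ℕ) where
  apc : ZMod k → Bool → ZMod k → Option (Bool × ZMod k)
  hpc : ZMod k → Bool × ZMod k
  hinj : Function.Injective hpc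
  cover : ∀ i, ∃ w, ∀ x, x ≠ w → ∃ j n, apc i j n = x
  edges : ∀ a b, a ≠ b → (∃ i j, OnCyc (apc i j) a b) ∨ OnCyc (fun n => some (hpc n)) a b

/-- The base factor used to fill pairs of cells. -/
structure Tmpl (k : ℕ) where
  lab : Bool → ZMod k → Option Bool
  val : Bool → ZMod k → ZMod k
  covE : ∀ x, ∃ c n, lab c n = none ∧ val c n = x
  covO : ∀ y, ∃ c n b, lab c n = some b ∧ val c n = y
  edges : ∀ x y b, ∃ s c, OnCyc (fun n => (lab c n, val c n + s)) (none, x) (some b, y)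

/-- Design on the cells `T × Bool`; `d none` is the cell `e`, `d (some true)` is `r`,
`d (some false)` is `l`. -/
structure Dsgn (T Q : Type) where
  d : T → Q → Option Bool → T × Bool
  cov : ∀ z (w : T × Bool) b, w.1 ≠ z → (∃ q, d z q none = w) ∨ ∃ q, d z q (some b) = w
  edges : ∀ w w' : T × Bool, w.1 ≠ w'.1 → ∃ z q b,
    (d z q none = w ∧ d z q (some b) = w') ∨ (d z q none = w' ∧ d z q (some b) = w)

def Base.sys {k : ℕ} (B : Base k) : Sys k (Option (Bool × ZMod k)) (ZMod k) Bool Unit where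
  apc := B.apc
  hpc := fun _ n => some (B.hpc n)
  hinj := by
    intro _ _ n n' h
    exact ⟨rfl, B.hinj (Option.some.inj h)⟩
  cover := B.cover
  edges := by
    intro a b hab
    rcases B.edges a b hab with h | h
    · exact Or.inl h
    · exact Or.inr ⟨(), h⟩

theorem OnCyc.map {V W : Type*} {k : ℕ} {c : ZMod k → V} {a b : V} (f : V → W)
    (h : OnCyc c a b) : OnCyc (fun n => f (c n)) (f a) (f b) := by
  obtain ⟨n, hn⟩ := h
  refine ⟨n, ?_⟩
  simpa using congrArg (Sym2.map f) hn

theorem OnCyc.symm {V : Type*} {k : ℕ} {c : ZMod k → V} {a b : V}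
    (h : OnCyc c a b) : OnCyc c b a := by
  obtain ⟨n, hn⟩ := h
  exact ⟨n, hn.trans Sym2.eq_swap⟩

def recSys {k : ℕ} {T Q : Type} (B : Base k) (F : Tmpl k) (D : Dsgn T Q) :
    Sys k (Option (T × Bool × ZMod k)) (T × ZMod k) (Bool ⊕ (Q × Bool)) T where
  apc := fun i j n => Sum.elim
    (fun j => (B.apc i.2 j n).map (fun p => (i.1, p)))
    (fun qc => some ((D.d i.1 qc.1 (F.lab qc.2 n)).1, (D.d i.1 qc.1 (F.lab qc.2 n)).2,
      F.val qc.2 n + i.2)) j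
  hpc := fun z n => some (z, B.hpc n)
  hinj := by
    intro z z' n n' h
    simp only [Option.some.injEq, Prod.mk.injEq] at h
    exact ⟨h.1, B.hinj h.2⟩
  cover := by
    rintro ⟨z, s⟩
    obtain ⟨w, hw⟩ := B.cover s
    refine ⟨w.map (fun p => (z, p)), ?_⟩
    have inG : ∀ u : Option (Bool × ZMod k), u.map (fun p => (z, p)) ≠ w.map (fun p => (z, p)) →
        ∃ j n, (B.apc s j n).map (fun p => (z, p)) = u.map (fun p => (z, p)) := by
      intro u hu
      obtain ⟨j, n, h⟩ := hw u (fun h => hu (by rw [h]))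
      exact ⟨j, n, by rw [h]⟩
    rintro (_ | ⟨z', b, x⟩) hx
    · obtain ⟨j, n, h⟩ := inG none hx
      exact ⟨Sum.inl j, n, h⟩
    · by_cases hz : z' = z
      · subst hz
        obtain ⟨j, n, h⟩ := inG (some (b, x)) hx
        exact ⟨Sum.inl j, n, h⟩
      · obtain ⟨c, n, l, h1, h2⟩ := F.covO (x - s)
        rcases D.cov z (z', b) l hz with ⟨q, hq⟩ | ⟨q, hq⟩
        · obtain ⟨c', n', h1', h2'⟩ := F.covE (x - s)
          refine ⟨Sum.inr (q, c'), n', ?_⟩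
          simp [h1', h2', hq]
        · refine ⟨Sum.inr (q, c), n, ?_⟩
          simp [h1, h2, hq]
  edges := by
    have inG : ∀ (z : T) (u v : Option (Bool × ZMod k)), u ≠ v →
        (∃ (i : T × ZMod k) (j : Bool ⊕ (Q × Bool)), OnCyc (fun n => Sum.elim
          (fun j => (B.apc i.2 j n).map (fun p => (i.1, p)))
          (fun qc => some ((D.d i.1 qc.1 (F.lab qc.2 n)).1, (D.d i.1 qc.1 (F.lab qc.2 n)).2,
          F.val qc.2 n + i.2)) j) (u.map (fun p => (z, p))) (v.map (fun p => (z, p)))) ∨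
        ∃ h : T, OnCyc (fun n => some (h, B.hpc n)) (u.map (fun p => (z, p)))
          (v.map (fun p => (z, p))) := by
      intro z u v huv
      rcases B.edges u v huv with ⟨i, j, h⟩ | h
      · exact Or.inl ⟨(z, i), Sum.inl j, h.map (Option.map (fun p => (z, p)))⟩
      · exact Or.inr ⟨z, h.map (Option.map (fun p => (z, p)))⟩
    rintro (_ | ⟨z, b, x⟩) (_ | ⟨z', b', x'⟩) hab
    · exact absurd rfl hab
    · exact inG z' none (some (b', x')) (by simp)
    · exact inG z (some (b, x)) none (by simp)
    · by_cases hz : z = z'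
      · subst hz
        exact inG z (some (b, x)) (some (b', x')) (by rintro h; apply hab; simp at h; simp [h])
      · left
        obtain ⟨u, q, l, h⟩ := D.edges (z, b) (z', b') hz
        have main : ∀ (w w' : T × Bool) (y y' : ZMod k),
            D.d u q none = w ∧ D.d u q (some l) = w' →
            ∃ (i : T × ZMod k) (j : Bool ⊕ (Q × Bool)), OnCyc (fun n => Sum.elim
          (fun j => (B.apc i.2 j n).map (fun p => (i.1, p)))
          (fun qc => some ((D.d i.1 qc.1 (F.lab qc.2 n)).1, (D.d i.1 qc.1 (F.lab qc.2 n)).2,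
          F.val qc.2 n + i.2)) j) (some (w.1, w.2, y)) (some (w'.1, w'.2, y')) := by
          rintro w w' y y' ⟨rfl, rfl⟩
          obtain ⟨s, c, h⟩ := F.edges y y' l
          exact ⟨(u, s), Sum.inr (q, c), h.map (fun p : Option Bool × ZMod k =>
            some ((D.d u q p.1).1, (D.d u q p.1).2, p.2))⟩
        rcases h with h | h
        · exact main _ _ x x' h
        · obtain ⟨i, j, h⟩ := main _ _ x' x h
          exact ⟨i, j, h.symm⟩

theorem arcs_one {k : ℕ} (hk : 0 < k) (B : Base k) : HasARCS k (2 * k * 1 + 1) := by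
  have : NeZero k := ⟨hk.ne'⟩
  refine hasARCS_of_sys k 1 hk ?_ ?_ ?_ ?_ B.sys <;> simp [ZMod.card]

theorem arcs_rec {k t : ℕ} (hk : 0 < k) {T Q : Type} [Fintype T] [Fintype Q]
    (hT : Fintype.card T = t) (hQ : Fintype.card Q + 1 = t)
    (B : Base k) (F : Tmpl k) (D : Dsgn T Q) : HasARCS k (2 * k * t + 1) := by
  have : NeZero k := ⟨hk.ne'⟩
  refine hasARCS_of_sys k t hk ?_ ?_ ?_ ?_ (recSys B F D)
  · simp [ZMod.card, hT]; ring
  · simp [ZMod.card, hT]; ring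
  · simp; omega
  · exact hT

theorem zmod_pm (n : ℕ) (δ : ZMod (2 * n + 1)) (h : δ ≠ 0) :
    ∃ a : Fin n, δ = ((a + 1 : ℕ) : ZMod (2 * n + 1)) ∨ δ = -((a + 1 : ℕ) : ZMod (2 * n + 1)) := by
  have h1 := ZMod.val_lt δ
  have h2 : δ.val ≠ 0 := by rwa [Ne, ZMod.val_eq_zero]
  by_cases h3 : δ.val ≤ n
  · refine ⟨⟨δ.val - 1, by omega⟩, Or.inl ?_⟩
    simp only
    rw [Nat.sub_add_cancel (by omega), ZMod.natCast_zmod_val]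
  · refine ⟨⟨2 * n - δ.val, by omega⟩, Or.inr ?_⟩
    simp only
    rw [eq_neg_iff_add_eq_zero]
    have e : δ.val + (2 * n - δ.val + 1) = 2 * n + 1 := by omega
    have e' := congrArg (Nat.cast : ℕ → ZMod (2 * n + 1)) e
    rwa [Nat.cast_add, ZMod.natCast_zmod_val, ZMod.natCast_self] at e'

theorem zmod_half (n : ℕ) (δ : ZMod (2 * n + 1)) : ∃ c, c + c = δ := by
  refine ⟨(n + 1) * δ, ?_⟩
  have : ((2 * n + 1 : ℕ) : ZMod (2 * n + 1)) = 0 := ZMod.natCast_self _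
  push_cast at this
  linear_combination δ * this

/-- The design for an odd number of groups. -/
def oddDsgn (n : ℕ) : Dsgn (ZMod (2 * n + 1)) (Fin n × Bool) where
  d := fun z q l => match l with
    | none => (z + ((q.1 + 1 : ℕ) : ZMod (2 * n + 1)), q.2)
    | some true => (z - ((q.1 + 1 : ℕ) : ZMod (2 * n + 1)), q.2)
    | some false => (z - ((q.1 + 1 : ℕ) : ZMod (2 * n + 1)), !q.2)
  cov := by
    rintro z ⟨w, s⟩ b hw
    obtain ⟨a, ha | ha⟩ := zmod_pm n (w - z) (sub_ne_zero.2 hw)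
    · exact Or.inl ⟨(a, s), by simp only [Prod.mk.injEq, and_true]; rw [← ha]; ring⟩
    · right
      rw [sub_eq_iff_eq_add] at ha
      cases b
      · exact ⟨(a, !s), by simp only [Prod.mk.injEq, Bool.not_not, and_true]; rw [ha]; ring⟩
      · exact ⟨(a, s), by simp only [Prod.mk.injEq, and_true]; rw [ha]; ring⟩
  edges := by
    have main : ∀ (u v : ZMod (2 * n + 1)) (s s' : Bool) (a : Fin n) (c : ZMod (2 * n + 1)),
        c + c = u - v → c = ((a + 1 : ℕ) : ZMod (2 * n + 1)) →
        ∃ (q b : Bool), ((u - c + ((a + 1 : ℕ) : ZMod (2 * n + 1)), q) = (u, s)) ∧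
          ((u - c - ((a + 1 : ℕ) : ZMod (2 * n + 1)), bif b then q else !q) = (v, s')) := by
      intro u v s s' a c hc ha
      refine ⟨s, decide (s = s'), ?_, ?_⟩
      · rw [← ha]; simp
      · rw [← ha]
        simp only [Prod.mk.injEq]
        refine ⟨by linear_combination -hc, ?_⟩
        cases s <;> cases s' <;> rfl
    rintro ⟨u, s⟩ ⟨v, s'⟩ huv
    obtain ⟨c, hc⟩ := zmod_half n (u - v)
    have hc0 : c ≠ 0 := by
      rintro rfl
      apply huv
      simp only [add_zero] at hc
      exact (sub_eq_zero.1 hc.symm)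
    obtain ⟨a, ha | ha⟩ := zmod_pm n c hc0
    · obtain ⟨q, b, h1, h2⟩ := main u v s s' a c hc ha
      refine ⟨u - c, (a, q), b, Or.inl ⟨h1, ?_⟩⟩
      cases b <;> simpa using h2
    · obtain ⟨q, b, h1, h2⟩ := main v u s' s a (-c) (by linear_combination -hc) (by rw [ha]; ring)
      refine ⟨v - -c, (a, q), b, Or.inr ⟨h1, ?_⟩⟩
      cases b <;> simpa using h2

/-- The holes at ordinary groups in the design for an even number of groups. -/
def evenAux (n : ℕ) (z : ZMod (2 * n + 1)) :
    (Fin (n - 1) × Bool) ⊕ Fin 3 → Option Bool → Option (ZMod (2 * n + 1)) × Bool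
  | Sum.inl q, none => (some (z + ((q.1 + 1 : ℕ) : ZMod (2 * n + 1))), q.2)
  | Sum.inl q, some true => (some (z - ((q.1 + 1 : ℕ) : ZMod (2 * n + 1))), q.2)
  | Sum.inl q, some false => (some (z - ((q.1 + 1 : ℕ) : ZMod (2 * n + 1))), !q.2)
  | Sum.inr 0, none => (none, false)
  | Sum.inr 0, some true => (some (z - n), false)
  | Sum.inr 0, some false => (some (z + n), true)
  | Sum.inr 1, none => (some (z + n), false)
  | Sum.inr 1, some true => (none, true)
  | Sum.inr 1, some false => (some (z - n), false)
  | Sum.inr 2, none => (some (z - n), true)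
  | Sum.inr 2, some true => (some (z + n), true)
  | Sum.inr 2, some false => (none, true)

theorem evenAux_cov (n : ℕ) (hn : 1 ≤ n) (z : ZMod (2 * n + 1)) (w : Option (ZMod (2 * n + 1)) × Bool)
    (b : Bool) (hw : w.1 ≠ some z) :
    (∃ q, evenAux n z q none = w) ∨ ∃ q, evenAux n z q (some b) = w := by
  obtain ⟨w, s⟩ := w
  cases w with
  | none =>
    cases s
    · exact Or.inl ⟨Sum.inr 0, rfl⟩
    · right
      cases b
      · exact ⟨Sum.inr 2, rfl⟩
      · exact ⟨Sum.inr 1, rfl⟩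
  | some w =>
    have hw' : w - z ≠ 0 := by
      intro h; apply hw; simp [sub_eq_zero.1 h]
    obtain ⟨a, ha⟩ := zmod_pm n (w - z) hw'
    by_cases han : a.val < n - 1
    · rcases ha with ha | ha
      · exact Or.inl ⟨Sum.inl (⟨a, han⟩, s), by simp only [evenAux]; rw [← ha]; simp⟩
      · right
        rw [sub_eq_iff_eq_add] at ha
        cases b
        · exact ⟨Sum.inl (⟨a, han⟩, !s), by
            simp only [evenAux, Prod.mk.injEq, Bool.not_not, and_true]; rw [ha]; congr 1; ring⟩
        · exact ⟨Sum.inl (⟨a, han⟩, s), by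
            simp only [evenAux, Prod.mk.injEq, and_true]; rw [ha]; congr 1; ring⟩
    · have : a.val + 1 = n := by have := a.2; omega
      rw [this] at ha
      rcases ha with ha | ha <;> rw [sub_eq_iff_eq_add'] at ha <;> subst ha
      · cases s
        · exact Or.inl ⟨Sum.inr 1, rfl⟩
        · right
          cases b
          · exact ⟨Sum.inr 0, rfl⟩
          · exact ⟨Sum.inr 2, rfl⟩
      · rw [← sub_eq_add_neg]
        cases s
        · right
          cases b
          · exact ⟨Sum.inr 1, rfl⟩
          · exact ⟨Sum.inr 0, rfl⟩
        · exact Or.inl ⟨Sum.inr 2, rfl⟩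

def evenD (n : ℕ) (φ : ZMod (2 * n + 1) ≃ (Fin (n - 1) × Bool) ⊕ Fin 3) :
    Option (ZMod (2 * n + 1)) → ZMod (2 * n + 1) → Option Bool → Option (ZMod (2 * n + 1)) × Bool
  | some z, q, l => evenAux n z (φ q) l
  | none, q, none => (some q, false)
  | none, q, some true => (some (q + 1), true)
  | none, q, some false => (some (q - 1), true)

/-- The design for an even number of groups. -/
def evenDsgn (n : ℕ) (hn : 1 ≤ n) (φ : ZMod (2 * n + 1) ≃ (Fin (n - 1) × Bool) ⊕ Fin 3) :
    Dsgn (Option (ZMod (2 * n + 1))) (ZMod (2 * n + 1)) where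
  d := evenD n φ
  cov := by
    rintro (_ | z) w b hw
    · rcases w with ⟨_ | w, s⟩
      · exact absurd rfl hw
      · cases s
        · exact Or.inl ⟨w, rfl⟩
        · right
          cases b
          · exact ⟨w + 1, by simp [evenD]⟩
          · exact ⟨w - 1, by simp [evenD]⟩
    · rcases evenAux_cov n hn z w b hw with ⟨q, h⟩ | ⟨q, h⟩
      · exact Or.inl ⟨φ.symm q, by simpa [evenD] using h⟩
      · exact Or.inr ⟨φ.symm q, by simpa [evenD] using h⟩
  edges := by
    -- it suffices to find an unordered pair in the auxiliary form
    have aux : ∀ w w', (∃ z q b, (evenAux n z q none = w ∧ evenAux n z q (some b) = w') ∨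
        (evenAux n z q none = w' ∧ evenAux n z q (some b) = w)) → ∃ z q b,
        (evenD n φ z q none = w ∧
        evenD n φ z q (some b) = w') ∨
        (evenD n φ z q none = w' ∧
        evenD n φ z q (some b) = w) := by
      rintro w w' ⟨z, q, b, h⟩
      exact ⟨some z, φ.symm q, b, by simpa [evenD] using h⟩
    have h2 : (2 * n + 1 : ZMod (2 * n + 1)) = 0 := by
      have : ((2 * n + 1 : ℕ) : ZMod (2 * n + 1)) = 0 := ZMod.natCast_self _
      push_cast at this
      exact this
    have infc : ∀ (s : Bool) (w' : ZMod (2 * n + 1)) (s' : Bool), ∃ z q b,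
        (evenAux n z q none = (none, s) ∧ evenAux n z q (some b) = (some w', s')) ∨
        (evenAux n z q none = (some w', s') ∧ evenAux n z q (some b) = (none, s)) := by
      intro s w' s'
      cases s <;> cases s'
      · exact ⟨w' + n, Sum.inr 0, true, Or.inl ⟨rfl, by simp [evenAux]⟩⟩
      · exact ⟨w' - n, Sum.inr 0, false, Or.inl ⟨rfl, by simp [evenAux]⟩⟩
      · exact ⟨w' - n, Sum.inr 1, true, Or.inr ⟨by simp [evenAux], rfl⟩⟩
      · exact ⟨w' + n, Sum.inr 2, false, Or.inr ⟨by simp [evenAux], rfl⟩⟩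
    have consec : ∀ (u : ZMod (2 * n + 1)) (s : Bool), ∃ z q b,
        (evenAux n z q none = (some u, s) ∧ evenAux n z q (some b) = (some (u + 1), s)) ∨
        (evenAux n z q none = (some (u + 1), s) ∧ evenAux n z q (some b) = (some u, s)) := by
      intro u s
      have e : u - n - n = u + 1 := by linear_combination -h2
      cases s
      · exact ⟨u - n, Sum.inr 1, false, Or.inl ⟨by simp [evenAux], by simp [evenAux, e]⟩⟩
      · exact ⟨u - n, Sum.inr 2, true, Or.inr ⟨by simp [evenAux, e], by simp [evenAux]⟩⟩
    have main : ∀ (u v : ZMod (2 * n + 1)) (s s' : Bool) (a : Fin (n - 1)) (c : ZMod (2 * n + 1)),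
        c + c = u - v → c = ((a + 1 : ℕ) : ZMod (2 * n + 1)) →
        ∃ z q b, (evenAux n z q none = (some u, s)) ∧ evenAux n z q (some b) = (some v, s') := by
      intro u v s s' a c hc ha
      refine ⟨u - c, Sum.inl (a, s), decide (s = s'), ?_, ?_⟩
      · simp only [evenAux]; rw [← ha]; simp
      · have e : u - c - c = v := by linear_combination -hc
        cases s <;> cases s' <;> simp only [evenAux, decide_true, decide_false, reduceCtorEq] <;>
          rw [← ha, e] <;> rfl
    have fin : ∀ (u v : ZMod (2 * n + 1)) (s s' : Bool), u = v + 1 → ∃ z q b,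
        (evenD n φ z q none = (some u, s) ∧
        evenD n φ z q (some b) = (some v, s')) ∨
        (evenD n φ z q none = (some v, s') ∧
        evenD n φ z q (some b) = (some u, s)) := by
      rintro u v s s' rfl
      by_cases hs : s = s'
      · subst hs
        obtain ⟨z, q, b, h⟩ := consec v s
        exact aux _ _ ⟨z, q, b, h.symm⟩
      · cases s <;> cases s'
        · exact absurd rfl hs
        · exact ⟨none, v + 1, false, Or.inl ⟨rfl, by simp [evenD]⟩⟩
        · exact ⟨none, v, true, Or.inr ⟨rfl, by simp [evenD]⟩⟩
        · exact absurd rfl hs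
    rintro ⟨_ | u, s⟩ ⟨_ | v, s'⟩ huv
    · exact absurd rfl huv
    · exact aux _ _ (infc s v s')
    · obtain ⟨z, q, b, h⟩ := infc s' u s
      exact aux _ _ ⟨z, q, b, h.symm⟩
    · have huv' : u ≠ v := fun h => huv (by simp [h])
      obtain ⟨c, hc⟩ := zmod_half n (u - v)
      have hc0 : c ≠ 0 := by
        rintro rfl
        apply huv'
        simp only [add_zero] at hc
        exact (sub_eq_zero.1 hc.symm)
      obtain ⟨a, ha⟩ := zmod_pm n c hc0
      by_cases han : a.val < n - 1
      · rcases ha with ha | ha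
        · obtain ⟨z, q, b, h⟩ := main u v s s' ⟨a, han⟩ c hc ha
          exact aux _ _ ⟨z, q, b, Or.inl h⟩
        · obtain ⟨z, q, b, h⟩ := main v u s' s ⟨a, han⟩ (-c) (by linear_combination -hc)
            (by rw [ha]; simp)
          exact aux _ _ ⟨z, q, b, Or.inr h⟩
      · have : a.val + 1 = n := by have := a.2; omega
        rw [this] at ha
        rcases ha with ha | ha
        · obtain ⟨z, q, b, h⟩ := fin v u s' s (by linear_combination hc - 2 * ha - h2)
          exact ⟨z, q, b, h.symm⟩
        · exact fin u v s s' (by linear_combination -hc + 2 * ha - h2)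

theorem arcs_ge_three {k t : ℕ} (hk : 0 < k) (ht : 3 ≤ t) (B : Base k) (F : Tmpl k) :
    HasARCS k (2 * k * t + 1) := by
  rcases Nat.even_or_odd' t with ⟨n, hn | hn⟩
  · obtain ⟨m, rfl⟩ : ∃ m, n = m + 1 := ⟨n - 1, by omega⟩
    have hc : Fintype.card (ZMod (2 * m + 1)) =
        Fintype.card ((Fin (m - 1) × Bool) ⊕ Fin 3) := by
      simp [ZMod.card]; omega
    exact arcs_rec hk (by simp [ZMod.card]; omega) (by simp [ZMod.card]; omega) B F
      (evenDsgn m (by omega) (Fintype.equivOfCardEq hc))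
  · exact arcs_rec hk (by simp [ZMod.card]; omega) (by simp; omega) B F (oddDsgn n)

theorem onCyc_succ {V : Type*} {k : ℕ} (c : ℕ → V) (i : ℕ) (hi : i + 1 < k) :
    OnCyc (fun n : ZMod k => c n.val) (c i) (c (i + 1)) := by
  refine ⟨(i : ZMod k), ?_⟩
  have e : ((i : ZMod k) + 1) = ((i + 1 : ℕ) : ZMod k) := by push_cast; rfl
  simp only [e]
  rw [ZMod.val_cast_of_lt hi, ZMod.val_cast_of_lt (by omega)]

theorem onCyc_last {V : Type*} {k : ℕ} (c : ℕ → V) (i : ℕ) (hi : i + 1 = k) :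
    OnCyc (fun n : ZMod k => c n.val) (c i) (c 0) := by
  refine ⟨(i : ZMod k), ?_⟩
  have e : ((i : ZMod k) + 1) = ((0 : ℕ) : ZMod k) := by
    rw [Nat.cast_zero, ← ZMod.natCast_self k, ← hi]; push_cast; rfl
  simp only [e]
  rw [ZMod.val_cast_of_lt (by omega), ZMod.val_cast_of_lt (by omega)]

/-- Solve for a shift from a difference identity in `ℕ`. -/
theorem shift_of {k : ℕ} [NeZero k] (x y : ZMod k) (a b : ℕ)
    (h : b = a + (y - x).val ∨ b + k = a + (y - x).val) :
    (b : ZMod k) + (x - a) = y := by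
  have h' : (b : ZMod k) = a + (y - x) := by
    rcases h with h | h
    · have := congrArg (Nat.cast : ℕ → ZMod k) h
      rwa [Nat.cast_add, ZMod.natCast_zmod_val] at this
    · have := congrArg (Nat.cast : ℕ → ZMod k) h
      rwa [Nat.cast_add, Nat.cast_add, ZMod.natCast_zmod_val, ZMod.natCast_self, add_zero] at this
  rw [h']; ring

def tx (m : ℕ) (c : Bool) (i : ℕ) : ℕ :=
  bif c then (if i = m + 1 then m + 1 else 2 * m + 1 + i)
  else (if i = m + 1 then 3 * m + 2 else i)

def ty (m : ℕ) (c : Bool) (i : ℕ) : ℕ :=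
  bif c then (if i = 0 then 1 else if i = m then m + 3 else if i = 2 * m then 2 else
    if i = m - 1 then 3 * m + 2 else 4 * m + 2 - i)
  else (if i = 0 then 0 else if i = m then 3 * m + 3 else 2 * m + 3 - i)

def tl (m : ℕ) (c : Bool) (i : ℕ) : Bool :=
  bif c then decide (i = m) else decide (i ≠ 0)

theorem t_covE (m : ℕ) (hm : 2 ≤ m) (x : ℕ) (hx : x < 4 * m + 2) :
    ∃ c i, i < 2 * m + 1 ∧ tx m c i = x := by
  by_cases h1 : x = m + 1
  · exact ⟨true, m + 1, by omega, by simp [tx, h1]⟩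
  by_cases h2 : x = 3 * m + 2
  · exact ⟨false, m + 1, by omega, by simp [tx, h2]⟩
  by_cases h3 : x < 2 * m + 1
  · exact ⟨false, x, by omega, by simp [tx, h1]⟩
  · exact ⟨true, x - (2 * m + 1), by omega, by simp [tx]; split_ifs <;> omega⟩

theorem t_covO (m : ℕ) (hm : 2 ≤ m) (y : ℕ) (hy : y < 4 * m + 2) :
    ∃ c i, i < 2 * m + 1 ∧ ty m c i = y := by
  have key : ∃ (c : Bool) (i : ℕ), i < 2 * m + 1 ∧
      ((c = true ∧ ((i = 0 ∧ y = 1) ∨ (i = m ∧ y = m + 3) ∨ (i = 2 * m ∧ y = 2) ∨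
        (i = m - 1 ∧ y = 3 * m + 2) ∨
        (i ≠ 0 ∧ i ≠ m ∧ i ≠ 2 * m ∧ i ≠ m - 1 ∧ y = 4 * m + 2 - i))) ∨
      (c = false ∧ ((i = 0 ∧ y = 0) ∨ (i = m ∧ y = 3 * m + 3) ∨
        (i ≠ 0 ∧ i ≠ m ∧ y = 2 * m + 3 - i)))) := by
    by_cases h0 : y = 0
    · exact ⟨false, 0, by omega, by simp; omega⟩
    by_cases h1 : y = 1
    · exact ⟨true, 0, by omega, by simp; omega⟩
    by_cases h2 : y = 2
    · exact ⟨true, 2 * m, by omega, by simp; omega⟩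
    by_cases h3 : y = m + 3
    · exact ⟨true, m, by omega, by simp; omega⟩
    by_cases h4 : y = 3 * m + 3
    · exact ⟨false, m, by omega, by simp; omega⟩
    by_cases h5 : y = 3 * m + 2
    · exact ⟨true, m - 1, by omega, by simp; omega⟩
    by_cases h6 : y < 2 * m + 3
    · exact ⟨false, 2 * m + 3 - y, by omega, by simp; omega⟩
    · exact ⟨true, 4 * m + 2 - y, by omega, by simp; omega⟩
  obtain ⟨c, i, hi, ⟨rfl, h⟩ | ⟨rfl, h⟩⟩ := key
  · exact ⟨true, i, hi, by simp only [ty, cond_true]; split_ifs <;> omega⟩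
  · exact ⟨false, i, hi, by simp only [ty, cond_false]; split_ifs <;> omega⟩

/-- index of the other neighbour -/
def tn (m : ℕ) (e : Bool) (i : ℕ) : ℕ := bif e then (if i = 2 * m then 0 else i + 1) else i

def tgood (m : ℕ) (l : Bool) (d : ℕ) (c : Bool) (i : ℕ) (e : Bool) : Prop :=
  i < 2 * m + 1 ∧ tl m c i = l ∧ (ty m c i = tx m c (tn m e i) + d ∨
      ty m c i + (4 * m + 2) = tx m c (tn m e i) + d)


theorem t_diffR (m : ℕ) (hm : 2 ≤ m) (d : ℕ) (hd : d < 4 * m + 2) :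
    ∃ c i e, tgood m true d c i e := by
  have fin : ∀ c i e, i < 2 * m + 1 → tl m c i = true →
      (ty m c i = tx m c (tn m e i) + d ∨
      ty m c i + (4 * m + 2) = tx m c (tn m e i) + d) → ∃ c i e, tgood m true d c i e :=
    fun c i e h1 h2 h3 => ⟨c, i, e, h1, h2, h3⟩
  by_cases h0 : d = 0
  · apply fin false (m + 1) true <;> simp [tl, ty, tx, tn] <;> (try split_ifs) <;> (try split_ifs) <;> omega
  by_cases h1 : d = 1
  · apply fin false (m) true <;> simp [tl, ty, tx, tn] <;> (try split_ifs) <;> (try split_ifs) <;> omega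
  by_cases h2 : d = 2
  · apply fin true (m) true <;> simp [tl, ty, tx, tn] <;> (try split_ifs) <;> (try split_ifs) <;> omega
  by_cases h3 : d = 3
  · apply fin false (2 * m) true <;> simp [tl, ty, tx, tn] <;> (try split_ifs) <;> (try split_ifs) <;> omega
  by_cases h4 : d = 2 * m + 2
  · apply fin false (m + 1) false <;> simp [tl, ty, tx, tn] <;> (try split_ifs) <;> (try split_ifs) <;> omega
  by_cases h5 : d = 2 * m + 3
  · apply fin false (m) false <;> simp [tl, ty, tx, tn] <;> (try split_ifs) <;> (try split_ifs) <;> omega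
  by_cases h6 : d = 2 * m + 4
  · apply fin true (m) false <;> simp [tl, ty, tx, tn] <;> (try split_ifs) <;> (try split_ifs) <;> omega
  obtain ⟨j, hj | hj⟩ : ∃ j, d = 2 * j ∨ d = 2 * j + 1 := ⟨d / 2, by omega⟩
  · by_cases hh : d ≤ 2 * m + 1
    · apply fin false (m + 1 - j) true <;> simp [tl, ty, tx, tn] <;> (try split_ifs) <;> (try split_ifs) <;> omega
    · apply fin false (3 * m + 2 - j) true <;> simp [tl, ty, tx, tn] <;> (try split_ifs) <;> (try split_ifs) <;> omega
  · by_cases hh : d ≤ 2 * m + 1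
    · have h' : m + 1 - j ≠ m + 1 := by omega
      apply fin false (m + 1 - j) false
      · omega
      · simp [tl] <;> omega
      · rw [show tn m false (m + 1 - j) = m + 1 - j from rfl]
        simp only [ty, tx, cond_false, if_neg h']
        split_ifs <;> omega
    · have h' : 3 * m + 2 - j ≠ m + 1 := by omega
      apply fin false (3 * m + 2 - j) false
      · omega
      · simp [tl] <;> omega
      · rw [show tn m false (3 * m + 2 - j) = 3 * m + 2 - j from rfl]
        simp only [ty, tx, cond_false, if_neg h']
        split_ifs <;> omega

theorem t_diffL (m : ℕ) (hm : 2 ≤ m) (d : ℕ) (hd : d < 4 * m + 2) :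
    ∃ c i e, tgood m false d c i e := by
  have fin : ∀ c i e, i < 2 * m + 1 → tl m c i = false →
      (ty m c i = tx m c (tn m e i) + d ∨
      ty m c i + (4 * m + 2) = tx m c (tn m e i) + d) → ∃ c i e, tgood m false d c i e :=
    fun c i e h1 h2 h3 => ⟨c, i, e, h1, h2, h3⟩
  by_cases h0 : d = 0
  · apply fin false (0) false <;> simp [tl, ty, tx, tn] <;> (try split_ifs) <;> (try split_ifs) <;> omega
  by_cases h1 : d = 4 * m + 1
  · apply fin false (0) true <;> simp [tl, ty, tx, tn] <;> (try split_ifs) <;> (try split_ifs) <;> omega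
  by_cases h2 : d = 2 * m + 2
  · apply fin true (0) false <;> simp [tl, ty, tx, tn] <;> (try split_ifs) <;> (try split_ifs) <;> omega
  by_cases h3 : d = 2 * m + 1
  · apply fin true (0) true <;> simp [tl, ty, tx, tn] <;> (try split_ifs) <;> (try split_ifs) <;> omega
  by_cases h4 : d = 2
  · apply fin true (m - 1) false <;> simp [tl, ty, tx, tn] <;> (try split_ifs) <;> (try split_ifs) <;> omega
  by_cases h5 : d = 1
  · apply fin true (m - 1) true <;> simp [tl, ty, tx, tn] <;> (try split_ifs) <;> (try split_ifs) <;> omega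
  by_cases h6 : d = 2 * m
  · apply fin true (m + 1) false <;> simp [tl, ty, tx, tn] <;> (try split_ifs) <;> (try split_ifs) <;> omega
  by_cases h7 : d = 4 * m
  · apply fin true (m + 1) true <;> simp [tl, ty, tx, tn] <;> (try split_ifs) <;> (try split_ifs) <;> omega
  by_cases h8 : d = 3
  · apply fin true (2 * m) false <;> simp [tl, ty, tx, tn] <;> (try split_ifs) <;> (try split_ifs) <;> omega
  by_cases h9 : d = 2 * m + 3
  · apply fin true (2 * m) true <;> simp [tl, ty, tx, tn] <;> (try split_ifs) <;> (try split_ifs) <;> omega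
  obtain ⟨j, hj | hj⟩ : ∃ j, d = 2 * j ∨ d = 2 * j + 1 := ⟨d / 2, by omega⟩
  · by_cases hh : d ≤ 2 * m + 1
    · apply fin true (m - j) true <;> simp [tl, ty, tx, tn] <;> (try split_ifs) <;> (try split_ifs) <;> omega
    · apply fin true (3 * m + 1 - j) true <;> simp [tl, ty, tx, tn] <;> (try split_ifs) <;> (try split_ifs) <;> omega
  · by_cases hh : d ≤ 2 * m + 1
    · have h' : m - j ≠ m + 1 := by omega
      apply fin true (m - j) false
      · omega
      · simp [tl] <;> omega
      · rw [show tn m false (m - j) = m - j from rfl]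
        simp only [ty, tx, cond_true, if_neg h']
        split_ifs <;> omega
    · have h' : 3 * m + 1 - j ≠ m + 1 := by omega
      apply fin true (3 * m + 1 - j) false
      · omega
      · simp [tl] <;> omega
      · rw [show tn m false (3 * m + 1 - j) = 3 * m + 1 - j from rfl]
        simp only [ty, tx, cond_true, if_neg h']
        split_ifs <;> omega

/-- the template as a function of the position -/
def tf (m : ℕ) (c : Bool) (p : ℕ) : Option Bool × ℕ :=
  if p % 2 = 0 then (none, tx m c (p / 2)) else (some (tl m c (p / 2)), ty m c (p / 2))

theorem tf_even (m : ℕ) (c : Bool) (i : ℕ) : tf m c (2 * i) = (none, tx m c i) := by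
  simp [tf]

theorem tf_odd (m : ℕ) (c : Bool) (i : ℕ) :
    tf m c (2 * i + 1) = (some (tl m c i), ty m c i) := by
  have h1 : (2 * i + 1) % 2 ≠ 0 := by omega
  have h2 : (2 * i + 1) / 2 = i := by omega
  simp only [tf, if_neg h1, h2]

def tmplGen (m : ℕ) (hm : 2 ≤ m) : Tmpl (4 * m + 2) where
  lab := fun c n => (tf m c n.val).1
  val := fun c n => ((tf m c n.val).2 : ℕ)
  covE := by
    intro x
    obtain ⟨c, i, hi, h⟩ := t_covE m hm x.val (ZMod.val_lt x)
    refine ⟨c, ((2 * i : ℕ) : ZMod (4 * m + 2)), ?_⟩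
    rw [ZMod.val_cast_of_lt (by omega), tf_even, h]
    exact ⟨rfl, ZMod.natCast_zmod_val x⟩
  covO := by
    intro y
    obtain ⟨c, i, hi, h⟩ := t_covO m hm y.val (ZMod.val_lt y)
    refine ⟨c, ((2 * i + 1 : ℕ) : ZMod (4 * m + 2)), tl m c i, ?_⟩
    rw [ZMod.val_cast_of_lt (by omega), tf_odd, h]
    exact ⟨rfl, ZMod.natCast_zmod_val y⟩
  edges := by
    intro x y b
    have key : ∃ c i e, tgood m b (y - x).val c i e := by
      cases b
      · exact t_diffL m hm _ (ZMod.val_lt _)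
      · exact t_diffR m hm _ (ZMod.val_lt _)
    obtain ⟨c, i, e, hi, hl, hd⟩ := key
    refine ⟨x - (tx m c (tn m e i) : ℕ), c, ?_⟩
    have hy := shift_of x y _ _ hd
    have hx : ((tx m c (tn m e i) : ℕ) : ZMod (4 * m + 2)) + (x - (tx m c (tn m e i) : ℕ)) = x := by
      ring
    set s := x - ((tx m c (tn m e i) : ℕ) : ZMod (4 * m + 2)) with hs
    let g : ℕ → Option Bool × ZMod (4 * m + 2) := fun p => ((tf m c p).1, ((tf m c p).2 : ℕ) + s)
    have g1 : g (2 * i + 1) = (some b, y) := by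
      simp only [g, tf_odd, hl, hy]
    have g0 : g (2 * tn m e i) = (none, x) := by
      simp only [g, tf_even, hx]
    change OnCyc (fun n : ZMod (4 * m + 2) => g n.val) _ _
    cases e
    · have := onCyc_succ (k := 4 * m + 2) g (2 * i) (by omega)
      rw [g1] at this
      simp only [tn, cond_false] at g0
      rwa [g0] at this
    · apply OnCyc.symm
      by_cases h : i = 2 * m
      · have := onCyc_last (k := 4 * m + 2) g (2 * i + 1) (by omega)
        rw [g1] at this
        simp only [tn, cond_true, if_pos h, mul_zero] at g0
        rwa [g0] at this
      · have := onCyc_succ (k := 4 * m + 2) g (2 * i + 1) (by omega)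
        rw [g1] at this
        simp only [tn, cond_true, if_neg h] at g0
        rwa [show 2 * i + 1 + 1 = 2 * (i + 1) by ring, g0] at this

/-! ### The base system for `k = 4m+2`, `m ≥ 3` -/

def ga (m i : ℕ) : ℕ :=
  if i = 0 then 0 else if i = 1 then 2 * m + 1 else if i ≤ m then i - 1 else
    if i = m + 1 then 3 * m else i - 2

def gb (m i : ℕ) : ℕ :=
  if i = 0 then 0 else if i = 1 then 2 * m + 1 else if i ≤ m then 2 * m + 2 - i else
    if i = m + 1 then 3 * m + 2 else 2 * m + 1 - i

def pA (m n : ℕ) : ℕ :=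
  if n = 0 then 3 * m + 2 else if n = 1 then 3 * m + 1 else if n = 2 * m - 2 then 2 * m - 1 else
    if n = 2 * m - 1 then 4 * m + 1 else if n % 2 = 0 then 3 * m + 2 + n / 2 else 3 * m - n / 2

def pB (m n : ℕ) : ℕ :=
  if n = 0 then m else if n = 1 then m + 1 else if n = 2 then 3 * m + 1 else
    if n % 2 = 0 then 3 * m + 2 - n / 2 else 3 * m + 2 + n / 2

theorem ga_spec (m i : ℕ) : (i = 0 ∧ ga m i = 0) ∨ (i = 1 ∧ ga m i = 2 * m + 1) ∨
    (2 ≤ i ∧ i ≤ m ∧ ga m i = i - 1) ∨ (2 ≤ i ∧ i = m + 1 ∧ ga m i = 3 * m) ∨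
    (2 ≤ i ∧ m + 2 ≤ i ∧ ga m i = i - 2) := by
  unfold ga; split_ifs <;> omega

theorem gb_spec (m i : ℕ) : (i = 0 ∧ gb m i = 0) ∨ (i = 1 ∧ gb m i = 2 * m + 1) ∨
    (2 ≤ i ∧ i ≤ m ∧ gb m i = 2 * m + 2 - i) ∨ (2 ≤ i ∧ i = m + 1 ∧ gb m i = 3 * m + 2) ∨
    (2 ≤ i ∧ m + 2 ≤ i ∧ gb m i = 2 * m + 1 - i) := by
  unfold gb; split_ifs <;> omega

theorem pA_spec (m n : ℕ) (hm : 3 ≤ m) : (n = 0 ∧ pA m n = 3 * m + 2) ∨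
    (n = 1 ∧ pA m n = 3 * m + 1) ∨ (n = 2 * m - 2 ∧ pA m n = 2 * m - 1) ∨
    (n = 2 * m - 1 ∧ pA m n = 4 * m + 1) ∨
    (2 ≤ n ∧ n ≠ 2 * m - 2 ∧ n ≠ 2 * m - 1 ∧
      ((n % 2 = 0 ∧ pA m n = 3 * m + 2 + n / 2) ∨ (n % 2 = 1 ∧ pA m n = 3 * m - n / 2))) := by
  unfold pA; split_ifs <;> omega

theorem pB_spec (m n : ℕ) : (n = 0 ∧ pB m n = m) ∨
    (n = 1 ∧ pB m n = m + 1) ∨ (n = 2 ∧ pB m n = 3 * m + 1) ∨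
    (3 ≤ n ∧ ((n % 2 = 1 ∧ pB m n = 3 * m + 2 + n / 2) ∨
      (n % 2 = 0 ∧ pB m n = 3 * m + 2 - n / 2))) := by
  unfold pB; split_ifs <;> omega

def c1 (m p : ℕ) : Bool × ℕ :=
  if p % 2 = 0 then (false, ga m (p / 2)) else (true, gb m (p / 2))

def c1' (m p : ℕ) : Bool × ℕ :=
  if p = 0 then (false, 0) else if p = 1 then (false, 2 * m + 1) else
  if p = 2 then (true, 0) else if p = 3 then (true, 2 * m + 1) else c1 m p

def c2 (m p : ℕ) : Option (Bool × ℕ) :=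
  if p = 0 then none else if p ≤ 2 * m then some (false, pA m (p - 1))
  else some (true, pB m (4 * m + 1 - p))

def raw (m : ℕ) (o j : Bool) (p : ℕ) : Option (Bool × ℕ) :=
  bif j then c2 m p else some (bif o then c1' m p else c1 m p)

theorem raw_even (m : ℕ) (o : Bool) (i : ℕ) (hi : 2 ≤ i) :
    raw m o false (2 * i) = some (false, ga m i) := by
  have h1 : (2 * i) % 2 = 0 := by omega
  have h2 : (2 * i) / 2 = i := by omega
  cases o
  · simp only [raw, cond_false, c1, if_pos h1, h2]
  · simp only [raw, cond_false, cond_true, c1', c1, if_pos h1, h2]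
    rw [if_neg (by omega), if_neg (by omega), if_neg (by omega), if_neg (by omega)]

theorem raw_odd (m : ℕ) (o : Bool) (i : ℕ) (hi : 2 ≤ i) :
    raw m o false (2 * i + 1) = some (true, gb m i) := by
  have h1 : ¬ (2 * i + 1) % 2 = 0 := by omega
  have h2 : (2 * i + 1) / 2 = i := by omega
  cases o
  · simp only [raw, cond_false, c1, if_neg h1, h2]
  · simp only [raw, cond_false, cond_true, c1', c1, if_neg h1, h2]
    rw [if_neg (by omega), if_neg (by omega), if_neg (by omega), if_neg (by omega)]

theorem raw_A (m : ℕ) (o : Bool) (n : ℕ) (hn : n < 2 * m) :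
    raw m o true (n + 1) = some (false, pA m n) := by
  simp only [raw, cond_true, c2]
  rw [if_neg (by omega), if_pos (by omega), Nat.add_sub_cancel]

theorem raw_B (m : ℕ) (o : Bool) (n : ℕ) (hn : n ≤ 2 * m) :
    raw m o true (4 * m + 1 - n) = some (true, pB m n) := by
  simp only [raw, cond_true, c2]
  rw [if_neg (by omega), if_neg (by omega), show 4 * m + 1 - (4 * m + 1 - n) = n by omega]

theorem raw_inf (m : ℕ) (o : Bool) : raw m o true 0 = none := by simp [raw, c2]

def gnext (m p : ℕ) : ℕ := if p = 4 * m + 1 then 0 else p + 1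

def GE (m : ℕ) (o j : Bool) (X Y : Option (Bool × ℕ)) : Prop :=
  ∃ p q, p < 4 * m + 2 ∧ q < 4 * m + 2 ∧ (q = gnext m p ∨ p = gnext m q) ∧
    raw m o j p = X ∧ raw m o j q = Y

theorem GE.symm {m : ℕ} {o j : Bool} {X Y : Option (Bool × ℕ)} (h : GE m o j X Y) :
    GE m o j Y X := by
  obtain ⟨p, q, hp, hq, h, hX, hY⟩ := h
  exact ⟨q, p, hq, hp, h.symm, hY, hX⟩

theorem GE_ab (m : ℕ) (o : Bool) (i : ℕ) (h1 : 2 ≤ i) (h2 : i ≤ 2 * m) :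
    GE m o false (some (false, ga m i)) (some (true, gb m i)) :=
  ⟨2 * i, 2 * i + 1, by omega, by omega, by unfold gnext; left; split_ifs <;> omega,
    raw_even m o i h1, raw_odd m o i h1⟩

theorem GE_ba (m : ℕ) (o : Bool) (i : ℕ) (h1 : 2 ≤ i) (h2 : i + 1 ≤ 2 * m) :
    GE m o false (some (false, ga m (i + 1))) (some (true, gb m i)) :=
  ⟨2 * (i + 1), 2 * i + 1, by omega, by omega, by unfold gnext; right; split_ifs <;> omega,
    raw_even m o (i + 1) (by omega), raw_odd m o i h1⟩

theorem GE_A (m : ℕ) (o : Bool) (n : ℕ) (h2 : n + 1 < 2 * m) :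
    GE m o true (some (false, pA m n)) (some (false, pA m (n + 1))) :=
  ⟨n + 1, n + 1 + 1, by omega, by omega, by unfold gnext; left; split_ifs <;> omega,
    raw_A m o n (by omega), raw_A m o (n + 1) h2⟩

theorem GE_B (m : ℕ) (o : Bool) (n : ℕ) (h2 : n + 1 ≤ 2 * m) :
    GE m o true (some (true, pB m n)) (some (true, pB m (n + 1))) :=
  ⟨4 * m + 1 - n, 4 * m + 1 - (n + 1), by omega, by omega,
    by unfold gnext; right; split_ifs <;> omega,
    raw_B m o n (by omega), raw_B m o (n + 1) h2⟩

theorem GE_conn (m : ℕ) (hm : 3 ≤ m) (o : Bool) :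
    GE m o true (some (false, pA m (2 * m - 1))) (some (true, pB m (2 * m))) :=
  ⟨2 * m - 1 + 1, 4 * m + 1 - 2 * m, by omega, by omega,
    by unfold gnext; left; split_ifs <;> omega,
    raw_A m o _ (by omega), raw_B m o _ (by omega)⟩

theorem GE_infA (m : ℕ) (hm : 3 ≤ m) (o : Bool) : GE m o true none (some (false, pA m 0)) :=
  ⟨0, 0 + 1, by omega, by omega, by unfold gnext; left; split_ifs <;> omega,
    raw_inf m o, raw_A m o 0 (by omega)⟩

theorem GE_infB (m : ℕ) (hm : 3 ≤ m) (o : Bool) : GE m o true none (some (true, pB m 0)) :=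
  ⟨0, 4 * m + 1 - 0, by omega, by omega, by unfold gnext; right; split_ifs <;> omega,
    raw_inf m o, raw_B m o 0 (by omega)⟩

/-- closing edge -/
theorem GE_close (m : ℕ) (hm : 3 ≤ m) (o : Bool) :
    GE m o false (some (false, 0)) (some (true, gb m (2 * m))) :=
  ⟨0, 2 * (2 * m) + 1, by omega, by omega, by unfold gnext; right; split_ifs <;> omega,
    by cases o <;> simp [raw, c1, c1', ga], raw_odd m o _ (by omega)⟩

theorem GE_h (m : ℕ) (hm : 3 ≤ m) (o : Bool) :
    GE m o false (some (false, 2 * m + 1)) (some (true, 0)) := by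
  cases o
  · exact ⟨2, 1, by omega, by omega, by unfold gnext; right; split_ifs <;> omega,
      by simp [raw, c1, ga], by simp [raw, c1, gb]⟩
  · exact ⟨1, 2, by omega, by omega, by unfold gnext; left; split_ifs <;> omega,
      by simp [raw, c1'], by simp [raw, c1']⟩

theorem GE_h1 (m : ℕ) (hm : 3 ≤ m) (o : Bool) :
    GE m o false (some (false, ga m 2)) (some (true, 2 * m + 1)) :=
  ⟨2 * 2, 3, by omega, by omega, by unfold gnext; right; split_ifs <;> omega,
      raw_even m o 2 (by omega), by cases o <;> simp [raw, c1, c1', gb]⟩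

theorem GE_z (m : ℕ) (hm : 3 ≤ m) : GE m false false (some (false, 0)) (some (true, 0)) :=
  ⟨0, 1, by omega, by omega, by unfold gnext; left; split_ifs <;> omega,
      by simp [raw, c1, ga], by simp [raw, c1, gb]⟩

theorem GE_z' (m : ℕ) (hm : 3 ≤ m) :
    GE m false false (some (false, 2 * m + 1)) (some (true, 2 * m + 1)) :=
  ⟨2, 3, by omega, by omega, by unfold gnext; left; split_ifs <;> omega,
      by simp [raw, c1, ga], by simp [raw, c1, gb]⟩

theorem GE_anti (m : ℕ) (hm : 3 ≤ m) (b : Bool) :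
    GE m true false (some (b, 0)) (some (b, 2 * m + 1)) := by
  cases b
  · exact ⟨0, 1, by omega, by omega, by unfold gnext; left; split_ifs <;> omega,
      by simp [raw, c1'], by simp [raw, c1']⟩
  · exact ⟨2, 3, by omega, by omega, by unfold gnext; left; split_ifs <;> omega,
      by simp [raw, c1'], by simp [raw, c1']⟩

/-- all nonzero mixed differences -/
theorem g_mixed (m : ℕ) (hm : 3 ≤ m) (d : ℕ) (h0 : 1 ≤ d) (hd : d < 4 * m + 2) :
    ∃ j u v, (v = u + d ∨ v + (4 * m + 2) = u + d) ∧
      ∀ o, GE m o j (some (false, u)) (some (true, v)) := by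
  have fab : ∀ i, 2 ≤ i → i ≤ 2 * m →
      (gb m i = ga m i + d ∨ gb m i + (4 * m + 2) = ga m i + d) →
      ∃ j u v, (v = u + d ∨ v + (4 * m + 2) = u + d) ∧
      ∀ o, GE m o j (some (false, u)) (some (true, v)) :=
    fun i h1 h2 h3 => ⟨false, _, _, h3, fun o => GE_ab m o i h1 h2⟩
  have fba : ∀ i, 2 ≤ i → i + 1 ≤ 2 * m →
      (gb m i = ga m (i + 1) + d ∨ gb m i + (4 * m + 2) = ga m (i + 1) + d) →
      ∃ j u v, (v = u + d ∨ v + (4 * m + 2) = u + d) ∧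
      ∀ o, GE m o j (some (false, u)) (some (true, v)) :=
    fun i h1 h2 h3 => ⟨false, _, _, h3, fun o => GE_ba m o i h1 h2⟩
  by_cases e1 : d = 1
  · refine ⟨false, _, _, ?_, GE_close m hm⟩
    have s0 := gb_spec m (2 * m)
    omega
  by_cases e2 : d = 2
  · apply fab (m + 1) (by omega) (by omega)
    have s0 := ga_spec m (m + 1)
    have s1 := gb_spec m (m + 1)
    omega
  by_cases e3 : d = 2 * m
  · refine ⟨false, _, _, ?_, GE_h1 m hm⟩
    have s0 := ga_spec m 2
    omega
  by_cases e4 : d = 2 * m + 1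
  · exact ⟨false, _, _, by omega, GE_h m hm⟩
  by_cases e5 : d = 2 * m + 2
  · apply fba (m + 1) (by omega) (by omega)
    have s0 := ga_spec m ((m + 1) + 1)
    have s1 := gb_spec m (m + 1)
    omega
  by_cases e6 : d = 2 * m + 3
  · refine ⟨true, _, _, ?_, GE_conn m hm⟩
    have s0 := pA_spec m (2 * m - 1) hm
    have s1 := pB_spec m (2 * m)
    omega
  by_cases e7 : d = 2 * m + 4
  · apply fba m (by omega) (by omega)
    have s0 := ga_spec m (m + 1)
    have s1 := gb_spec m m
    omega
  obtain ⟨j, hj | hj⟩ : ∃ j, d = 2 * j ∨ d = 2 * j + 1 := ⟨d / 2, by omega⟩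
  · by_cases hh : d ≤ 2 * m
    · apply fba (m + 1 - j) (by omega) (by omega)
      have s0 := ga_spec m ((m + 1 - j) + 1)
      have s1 := gb_spec m (m + 1 - j)
      omega
    · apply fba (3 * m + 2 - j) (by omega) (by omega)
      have s0 := ga_spec m ((3 * m + 2 - j) + 1)
      have s1 := gb_spec m (3 * m + 2 - j)
      omega
  · by_cases hh : d ≤ 2 * m
    · apply fab (m + 1 - j) (by omega) (by omega)
      have s0 := ga_spec m (m + 1 - j)
      have s1 := gb_spec m (m + 1 - j)
      omega
    · apply fab (3 * m + 2 - j) (by omega) (by omega)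
      have s0 := ga_spec m (3 * m + 2 - j)
      have s1 := gb_spec m (3 * m + 2 - j)
      omega

def gdiff (m d u v : ℕ) : Prop := v = u + d ∨ v + (4 * m + 2) = u + d

theorem g_pure_aux (m : ℕ) (hm : 3 ≤ m) (b : Bool) (d : ℕ) (h0 : 1 ≤ d) (hd : d ≤ 2 * m)
    (hb : b = false → d ≠ 2 * m - 1) :
    ∃ u v, gdiff m d u v ∧ ∀ o, GE m o true (some (b, u)) (some (b, v)) := by
  cases b
  · have hb := hb rfl
    have f : ∀ n, n + 1 < 2 * m → (gdiff m d (pA m n) (pA m (n + 1)) ∨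
        gdiff m d (pA m (n + 1)) (pA m n)) →
        ∃ u v, gdiff m d u v ∧ ∀ o, GE m o true (some (false, u)) (some (false, v)) := by
      rintro n hn (h | h)
      · exact ⟨_, _, h, fun o => GE_A m o n hn⟩
      · exact ⟨_, _, h, fun o => (GE_A m o n hn).symm⟩
    unfold gdiff at f ⊢
    by_cases e1 : d = 1
    · apply f 0 (by omega)
      have s0 := pA_spec m 0 hm
      have s1 := pA_spec m (0 + 1) hm
      omega
    by_cases e2 : d = 2
    · apply f 1 (by omega)
      have s0 := pA_spec m 1 hm
      have s1 := pA_spec m (1 + 1) hm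
      omega
    by_cases e3 : d = 3
    · apply f (2 * m - 3) (by omega)
      have s0 := pA_spec m (2 * m - 3) hm
      have s1 := pA_spec m ((2 * m - 3) + 1) hm
      omega
    by_cases e4 : d = 2 * m
    · apply f (2 * m - 2) (by omega)
      have s0 := pA_spec m (2 * m - 2) hm
      have s1 := pA_spec m ((2 * m - 2) + 1) hm
      omega
    apply f (d - 2) (by omega)
    have s0 := pA_spec m (d - 2) hm
    have s1 := pA_spec m ((d - 2) + 1) hm
    omega
  · have f : ∀ n, n + 1 ≤ 2 * m → (gdiff m d (pB m n) (pB m (n + 1)) ∨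
        gdiff m d (pB m (n + 1)) (pB m n)) →
        ∃ u v, gdiff m d u v ∧ ∀ o, GE m o true (some (true, u)) (some (true, v)) := by
      rintro n hn (h | h)
      · exact ⟨_, _, h, fun o => GE_B m o n hn⟩
      · exact ⟨_, _, h, fun o => (GE_B m o n hn).symm⟩
    unfold gdiff at f ⊢
    by_cases e1 : d = 1
    · apply f 0 (by omega)
      have s0 := pB_spec m 0
      have s1 := pB_spec m (0 + 1)
      omega
    by_cases e2 : d = 2
    · apply f 2 (by omega)
      have s0 := pB_spec m 2
      have s1 := pB_spec m (2 + 1)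
      omega
    by_cases e4 : d = 2 * m
    · apply f 1 (by omega)
      have s0 := pB_spec m 1
      have s1 := pB_spec m (1 + 1)
      omega
    apply f d (by omega)
    have s0 := pB_spec m d
    have s1 := pB_spec m (d + 1)
    omega

theorem g_pure (m : ℕ) (hm : 3 ≤ m) (b : Bool) (d : ℕ) (h0 : 1 ≤ d) (hd : d < 4 * m + 2)
    (hh : d ≠ 2 * m + 1) (hb : b = false → d ≠ 2 * m - 1 ∧ d ≠ 2 * m + 3) :
    ∃ u v, (v = u + d ∨ v + (4 * m + 2) = u + d) ∧
      ∀ o, GE m o true (some (b, u)) (some (b, v)) := by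
  by_cases h : d ≤ 2 * m
  · exact g_pure_aux m hm b d h0 h (fun h => (hb h).1)
  · obtain ⟨u, v, h1, h2⟩ := g_pure_aux m hm b (4 * m + 2 - d) (by omega) (by omega)
      (fun h => by have := (hb h).2; omega)
    unfold gdiff at h1
    exact ⟨v, u, by omega, fun o => (h2 o).symm⟩

theorem g_cov (m : ℕ) (hm : 3 ≤ m) (o b : Bool) (u : ℕ) (hu : u < 4 * m + 2)
    (h : b = false → u ≠ 2 * m) : ∃ j p, p < 4 * m + 2 ∧ raw m o j p = some (b, u) := by
  have ofGE : ∀ j Y, GE m o j (some (b, u)) Y →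
      ∃ j p, p < 4 * m + 2 ∧ raw m o j p = some (b, u) := by
    rintro j Y ⟨p, q, hp, -, -, hX, -⟩
    exact ⟨j, p, hp, hX⟩
  cases b
  · have h := h rfl
    by_cases e0 : u = 0
    · subst e0; exact ofGE _ _ (GE_close m hm o)
    by_cases e1 : u = 2 * m + 1
    · subst e1; exact ofGE _ _ (GE_h m hm o)
    have f1 : ∀ i, 2 ≤ i → i ≤ 2 * m → ga m i = u →
        ∃ j p, p < 4 * m + 2 ∧ raw m o j p = some (false, u) :=
      fun i h1 h2 h3 => ⟨false, 2 * i, by omega, by rw [raw_even m o i h1, h3]⟩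
    have f2 : ∀ n, n < 2 * m → pA m n = u →
        ∃ j p, p < 4 * m + 2 ∧ raw m o j p = some (false, u) :=
      fun n h1 h3 => ⟨true, n + 1, by omega, by rw [raw_A m o n h1, h3]⟩
    by_cases e2 : u ≤ m - 1
    · exact f1 (u + 1) (by omega) (by omega) (by have := ga_spec m (u + 1); omega)
    by_cases e3 : u ≤ 2 * m - 2
    · exact f1 (u + 2) (by omega) (by omega) (by have := ga_spec m (u + 2); omega)
    by_cases e4 : u = 3 * m
    · exact f1 (m + 1) (by omega) (by omega) (by have := ga_spec m (m + 1); omega)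
    by_cases e5 : u = 2 * m - 1
    · exact f2 (2 * m - 2) (by omega) (by have := pA_spec m (2 * m - 2) hm; omega)
    by_cases e6 : u = 4 * m + 1
    · exact f2 (2 * m - 1) (by omega) (by have := pA_spec m (2 * m - 1) hm; omega)
    by_cases e7 : u = 3 * m + 2
    · exact f2 0 (by omega) (by have := pA_spec m 0 hm; omega)
    by_cases e8 : u = 3 * m + 1
    · exact f2 1 (by omega) (by have := pA_spec m 1 hm; omega)
    by_cases e9 : u < 3 * m
    · exact f2 (2 * (3 * m - u) + 1) (by omega) (by have := pA_spec m (2 * (3 * m - u) + 1) hm; omega)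
    · exact f2 (2 * (u - 3 * m - 2)) (by omega) (by have := pA_spec m (2 * (u - 3 * m - 2)) hm; omega)
  · by_cases e0 : u = 0
    · subst e0; exact ofGE _ _ (GE_h m hm o).symm
    by_cases e1 : u = 2 * m + 1
    · subst e1; exact ofGE _ _ (GE_h1 m hm o).symm
    have f1 : ∀ i, 2 ≤ i → i ≤ 2 * m → gb m i = u →
        ∃ j p, p < 4 * m + 2 ∧ raw m o j p = some (true, u) :=
      fun i h1 h2 h3 => ⟨false, 2 * i + 1, by omega, by rw [raw_odd m o i h1, h3]⟩
    have f2 : ∀ n, n ≤ 2 * m → pB m n = u →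
        ∃ j p, p < 4 * m + 2 ∧ raw m o j p = some (true, u) :=
      fun n h1 h3 => ⟨true, 4 * m + 1 - n, by omega, by rw [raw_B m o n h1, h3]⟩
    by_cases e2 : u ≤ m - 1
    · exact f1 (2 * m + 1 - u) (by omega) (by omega) (by have := gb_spec m (2 * m + 1 - u); omega)
    by_cases e3 : u = m
    · exact f2 0 (by omega) (by have := pB_spec m 0; omega)
    by_cases e4 : u = m + 1
    · exact f2 1 (by omega) (by have := pB_spec m 1; omega)
    by_cases e5 : u ≤ 2 * m
    · exact f1 (2 * m + 2 - u) (by omega) (by omega) (by have := gb_spec m (2 * m + 2 - u); omega)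
    by_cases e6 : u = 3 * m + 2
    · exact f1 (m + 1) (by omega) (by omega) (by have := gb_spec m (m + 1); omega)
    by_cases e7 : u = 3 * m + 1
    · exact f2 2 (by omega) (by have := pB_spec m 2; omega)
    by_cases e9 : u ≤ 3 * m
    · exact f2 (2 * (3 * m + 2 - u)) (by omega) (by have := pB_spec m (2 * (3 * m + 2 - u)); omega)
    · exact f2 (2 * (u - 3 * m - 2) + 1) (by omega) (by have := pB_spec m (2 * (u - 3 * m - 2) + 1); omega)

theorem onCyc_of_next {m : ℕ} {V : Type*} (c : ℕ → V) (p : ℕ) (hp : p < 4 * m + 2) :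
    OnCyc (fun n : ZMod (4 * m + 2) => c n.val) (c p) (c (gnext m p)) := by
  unfold gnext
  split_ifs with h
  · exact onCyc_last c p (by omega)
  · exact onCyc_succ c p (by omega)

theorem onCyc_of_GE {m : ℕ} {o j : Bool} {X Y : Option (Bool × ℕ)} {V : Type*}
    (f : Option (Bool × ℕ) → V) (h : GE m o j X Y) :
    OnCyc (fun n : ZMod (4 * m + 2) => f (raw m o j n.val)) (f X) (f Y) := by
  obtain ⟨p, q, hp, hq, h, rfl, rfl⟩ := h
  rcases h with rfl | rfl
  · exact onCyc_of_next (fun p => f (raw m o j p)) p hp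
  · exact (onCyc_of_next (fun p => f (raw m o j p)) q hq).symm

def gsh (m : ℕ) (s : ZMod (4 * m + 2)) (q : Option (Bool × ℕ)) :
    Option (Bool × ZMod (4 * m + 2)) :=
  q.map (fun q => (q.1, (q.2 : ZMod (4 * m + 2)) + s))

def gpar (m : ℕ) (s : ZMod (4 * m + 2)) : Bool := decide (s.val % 2 = 1)

def gapc (m : ℕ) (s : ZMod (4 * m + 2)) (j : Bool) (n : ZMod (4 * m + 2)) :
    Option (Bool × ZMod (4 * m + 2)) := gsh m s (raw m (gpar m s) j n.val)

theorem gedge {m : ℕ} (s : ZMod (4 * m + 2)) {o j b1 b2 : Bool} {u v : ℕ}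
    {x y : ZMod (4 * m + 2)} (ho : gpar m s = o)
    (h : GE m o j (some (b1, u)) (some (b2, v))) (hx : (u : ZMod (4 * m + 2)) + s = x)
    (hy : (v : ZMod (4 * m + 2)) + s = y) :
    ∃ i j, OnCyc (gapc m i j) (some (b1, x)) (some (b2, y)) := by
  refine ⟨s, j, ?_⟩
  have := onCyc_of_GE (gsh m s) h
  subst ho hx hy
  exact this

theorem gedge' {m : ℕ} {j b1 b2 : Bool} {u v : ℕ}
    {x y : ZMod (4 * m + 2)} (hd : v = u + (y - x).val ∨ v + (4 * m + 2) = u + (y - x).val)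
    (h : ∀ o, GE m o j (some (b1, u)) (some (b2, v)))  :
    ∃ i j, OnCyc (gapc m i j) (some (b1, x)) (some (b2, y)) :=
  gedge (x - (u : ZMod (4 * m + 2))) rfl (h _) (by ring) (shift_of x y u v hd)

theorem gpar_add (m a : ℕ) (ha : a < 4 * m + 2) :
    (a + (2 * m + 1)) % (4 * m + 2) % 2 = (a + 1) % 2 := by
  by_cases h : a + (2 * m + 1) < 4 * m + 2
  · have : (a + (2 * m + 1)) % (4 * m + 2) = a + (2 * m + 1) := Nat.mod_eq_of_lt h
    omega
  · have : (a + (2 * m + 1)) % (4 * m + 2) = a + (2 * m + 1) - (4 * m + 2) := by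
      rw [Nat.mod_eq_sub_mod (by omega), Nat.mod_eq_of_lt (by omega)]
    omega

theorem gmixed (m : ℕ) (hm : 3 ≤ m) (x y : ZMod (4 * m + 2)) :
    ∃ i j, OnCyc (gapc m i j) (some (false, x)) (some (true, y)) := by
  by_cases hxy : x = y
  · subst hxy
    by_cases hp : x.val % 2 = 1
    · have hl := ZMod.val_lt x
      have e : (((x.val + (2 * m + 1) : ℕ) : ZMod (4 * m + 2))).val % 2 = 0 := by
        rw [ZMod.val_natCast, gpar_add m _ hl]; omega
      have e2 : ((2 * m + 1 : ℕ) : ZMod (4 * m + 2)) +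
          ((x.val + (2 * m + 1) : ℕ) : ZMod (4 * m + 2)) = x := by
        rw [← Nat.cast_add, show 2 * m + 1 + (x.val + (2 * m + 1)) = x.val + (4 * m + 2) by ring,
          Nat.cast_add, ZMod.natCast_self, add_zero, ZMod.natCast_zmod_val]
      refine gedge _ (o := false) ?_ (GE_z' m hm) e2 e2
      simp only [gpar, decide_eq_false_iff_not]; omega
    · refine gedge x (o := false) ?_ (GE_z m hm) (by simp) (by simp)
      simp only [gpar, decide_eq_false_iff_not]; exact hp
  · obtain ⟨j, u, v, h1, h2⟩ := g_mixed m hm (y - x).val (by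
      rw [Nat.one_le_iff_ne_zero, Ne, ZMod.val_eq_zero, sub_eq_zero]; exact Ne.symm hxy)
      (ZMod.val_lt _)
    exact gedge' h1 h2

theorem ganti (m : ℕ) (hm : 3 ≤ m) (b : Bool) (x y : ZMod (4 * m + 2))
    (h : (y - x).val = 2 * m + 1) :
    ∃ i j, OnCyc (gapc m i j) (some (b, x)) (some (b, y)) := by
  have hy : ((2 * m + 1 : ℕ) : ZMod (4 * m + 2)) + x = y := by
    rw [← h, ZMod.natCast_zmod_val]; ring
  by_cases hp : x.val % 2 = 1
  · refine gedge x (o := true) ?_ (GE_anti m hm b) (by simp) hy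
    simp only [gpar, decide_eq_true_eq]; exact hp
  · have hl := ZMod.val_lt x
    have hx : ((2 * m + 1 : ℕ) : ZMod (4 * m + 2)) + y = x := by
      rw [← hy, ← add_assoc, ← Nat.cast_add, show 2 * m + 1 + (2 * m + 1) = 4 * m + 2 by ring,
        ZMod.natCast_self, zero_add]
    have e : y.val % 2 = 1 := by
      have : y = ((x.val + (2 * m + 1) : ℕ) : ZMod (4 * m + 2)) := by
        rw [Nat.cast_add, ZMod.natCast_zmod_val, ← hy]; ring
      rw [this, ZMod.val_natCast, gpar_add m _ hl]; omega
    refine gedge y (o := true) ?_ (GE_anti m hm b).symm hx (by simp)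
    simp only [gpar, decide_eq_true_eq]; exact e

theorem g_unit (m : ℕ) (hm : 3 ≤ m) : ∃ u : ZMod (4 * m + 2),
    u * ((2 * m - 1 : ℕ) : ZMod (4 * m + 2)) = 1 := by
  have h : Nat.Coprime (2 * m - 1) (4 * m + 2) := by
    have h1 : 4 * m + 2 = 4 + (2 * m - 1) * 2 := by omega
    rw [h1, Nat.coprime_add_mul_left_right]
    have : Nat.Coprime (2 * m - 1) 2 := by
      rw [Nat.coprime_two_right, Nat.odd_iff]; omega
    exact Nat.Coprime.mul_right this this
  refine ⟨((2 * m - 1 : ℕ) : ZMod (4 * m + 2))⁻¹, ?_⟩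
  exact (mul_comm _ _).trans (ZMod.coe_mul_inv_eq_one _ h)

def baseGen (m : ℕ) (hm : 3 ≤ m) : Base (4 * m + 2) where
  apc := gapc m
  hpc := fun n => (false, n * ((2 * m - 1 : ℕ) : ZMod (4 * m + 2)))
  hinj := by
    intro a b h
    obtain ⟨u, hu⟩ := g_unit m hm
    have h := congrArg (fun z => z.2 * u) h
    simp only [mul_assoc] at h
    rwa [mul_comm _ u, hu, mul_one, mul_one] at h
  cover := by
    intro s
    refine ⟨some (false, ((2 * m : ℕ) : ZMod (4 * m + 2)) + s), ?_⟩
    rintro (_ | ⟨b, v⟩) hx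
    · refine ⟨true, 0, ?_⟩
      simp only [gapc, ZMod.val_zero, raw_inf]; rfl
    · obtain ⟨j, p, hp, hr⟩ := g_cov m hm (gpar m s) b (v - s).val (ZMod.val_lt _) (by
        rintro rfl h
        apply hx
        rw [← h, ZMod.natCast_zmod_val]; simp)
      refine ⟨j, (p : ℕ), ?_⟩
      simp only [gapc]
      rw [ZMod.val_cast_of_lt hp, hr]
      simp [gsh]
  edges := by
    have hinf : ∀ b x, ∃ i j, OnCyc (gapc m i j) none (some (b, x)) := by
      intro b x
      cases b
      · refine ⟨x - (pA m 0 : ℕ), true, ?_⟩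
        have := onCyc_of_GE (gsh m (x - (pA m 0 : ℕ))) (GE_infA m hm (gpar m (x - (pA m 0 : ℕ))))
        simp only [gsh, Option.map_none, Option.map_some, add_sub_cancel] at this
        exact this
      · refine ⟨x - (pB m 0 : ℕ), true, ?_⟩
        have := onCyc_of_GE (gsh m (x - (pB m 0 : ℕ))) (GE_infB m hm (gpar m (x - (pB m 0 : ℕ))))
        simp only [gsh, Option.map_none, Option.map_some, add_sub_cancel] at this
        exact this
    have hhalf : ∀ x y : ZMod (4 * m + 2), (y - x).val = 2 * m - 1 →
        OnCyc (fun n : ZMod (4 * m + 2) =>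
          some (false, n * ((2 * m - 1 : ℕ) : ZMod (4 * m + 2)))) (some (false, x))
          (some (false, y)) := by
      intro x y h
      obtain ⟨u, hu⟩ := g_unit m hm
      refine ⟨x * u, ?_⟩
      have e1 : x * u * ((2 * m - 1 : ℕ) : ZMod (4 * m + 2)) = x := by
        rw [mul_assoc, hu, mul_one]
      have e2 : (x * u + 1) * ((2 * m - 1 : ℕ) : ZMod (4 * m + 2)) = y := by
        rw [add_mul, e1, one_mul, ← h, ZMod.natCast_zmod_val]; ring
      simp only [e1, e2]
    rintro (_ | ⟨b, x⟩) (_ | ⟨b', y⟩) hab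
    · exact absurd rfl hab
    · exact Or.inl (hinf b' y)
    · obtain ⟨i, j, h⟩ := hinf b x
      exact Or.inl ⟨i, j, h.symm⟩
    · by_cases hb : b = b'
      · subst hb
        have hxy : x ≠ y := fun h => hab (by rw [h])
        have hpos : 1 ≤ (y - x).val := by
          rw [Nat.one_le_iff_ne_zero, Ne, ZMod.val_eq_zero, sub_eq_zero]; exact Ne.symm hxy
        by_cases h1 : (y - x).val = 2 * m + 1
        · exact Or.inl (ganti m hm b x y h1)
        by_cases h2 : b = false ∧ (y - x).val = 2 * m - 1
        · obtain ⟨rfl, h2⟩ := h2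
          exact Or.inr (hhalf x y h2)
        by_cases h3 : b = false ∧ (y - x).val = 2 * m + 3
        · obtain ⟨rfl, h3⟩ := h3
          right
          refine (hhalf y x ?_).symm
          have : NeZero (y - x) := ⟨by rw [sub_ne_zero]; exact Ne.symm hxy⟩
          rw [← neg_sub, ZMod.val_neg_of_ne_zero, h3]; omega
        · left
          obtain ⟨u, v, h4, h5⟩ := g_pure m hm b _ hpos (ZMod.val_lt (y - x)) h1
            (fun hb => ⟨fun h => h2 ⟨hb, h⟩, fun h => h3 ⟨hb, h⟩⟩)
          exact gedge' h4 h5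
      · left
        cases b <;> cases b'
        · exact absurd rfl hb
        · exact gmixed m hm x y
        · obtain ⟨i, j, h⟩ := gmixed m hm y x
          exact ⟨i, j, h.symm⟩
        · exact absurd rfl hb

/-! ### Small explicit systems -/

/-- shift a point inside its row -/
def esh (q N s v : ℕ) : ℕ := if v = N then v else v / q * q + (v % q + s) % q

def ept (k t : ℕ) (L : List (List ℕ)) (i j p : ℕ) : ℕ :=
  esh (k / 2) (2 * k * t) (i % (k / 2)) ((L.getD (i / (k / 2)) []).getD (j * k + p) 0)

def ehp (k h p : ℕ) : ℕ := (2 * h + p % 2) * (k / 2) + p / 2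

def emask (f : ℕ → ℕ) : ℕ → ℕ
  | 0 => 0
  | n + 1 => emask f n ||| 2 ^ f n

theorem emask_spec (f : ℕ → ℕ) (n b : ℕ) (h : (emask f n).testBit b = true) :
    ∃ i, i < n ∧ f i = b := by
  induction n with
  | zero => simp [emask] at h
  | succ n ih =>
    rw [emask, Nat.testBit_or, Bool.or_eq_true] at h
    rcases h with h | h
    · obtain ⟨i, hi, e⟩ := ih h
      exact ⟨i, by omega, e⟩
    · rw [Nat.testBit_two_pow] at h
      exact ⟨n, by omega, by simpa using h⟩

/-- check the classes -/
def ecov (k t : ℕ) (L : List (List ℕ)) : Prop :=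
  ∀ i, i < k * t → ∀ x, x < 2 * k * t + 1 → x ≠ esh (k / 2) (2 * k * t) (i % (k / 2)) (i / (k / 2) * (k / 2)) →
    (emask (fun e => ept k t L i (e / k) (e % k)) (2 * t * k)).testBit x = true

instance (k t : ℕ) (L : List (List ℕ)) : Decidable (ecov k t L) := by
  unfold ecov; infer_instance

/-- code of an (ordered) edge in the almost parallel classes -/
def ecode (k t : ℕ) (L : List (List ℕ)) (e : ℕ) : ℕ :=
  ept k t L (e / (2 * t * k)) (e / k % (2 * t)) (e % k) * (2 * k * t + 1) +
    ept k t L (e / (2 * t * k)) (e / k % (2 * t)) ((e + 1) % k)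

def hcode (k t : ℕ) (e : ℕ) : ℕ :=
  ehp k (e / k) (e % k) * (2 * k * t + 1) + ehp k (e / k) ((e + 1) % k)

def eedge (k t : ℕ) (L : List (List ℕ)) : Prop :=
  ∀ a, a < 2 * k * t + 1 → ∀ b, b < a →
    (emask (ecode k t L) (k * t * (2 * t * k)) ||| emask (hcode k t) (t * k)).testBit
      (a * (2 * k * t + 1) + b) = true ∨
    (emask (ecode k t L) (k * t * (2 * t * k)) ||| emask (hcode k t) (t * k)).testBit
      (b * (2 * k * t + 1) + a) = true

instance (k t : ℕ) (L : List (List ℕ)) : Decidable (eedge k t L) := by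
  unfold eedge; infer_instance
def data61 : List (List ℕ) :=
  [[12, 9, 6, 5, 3, 8, 11, 1, 10, 2, 7, 4],
   [12, 2, 0, 7, 1, 5, 8, 9, 4, 10, 11, 6]]

def data101 : List (List ℕ) :=
  [[20, 12, 3, 14, 4, 5, 18, 9, 16, 6, 7, 10, 11, 17, 1, 2, 15, 19, 8, 13],
   [20, 19, 10, 12, 8, 7, 14, 2, 17, 0, 6, 4, 18, 15, 13, 16, 11, 3, 1, 9]]

def data62 : List (List ℕ) :=
  [[15, 6, 24, 14, 2, 1, 10, 23, 22, 19, 21, 3, 7, 17, 11, 20, 18, 5, 4, 16, 12, 8, 13, 9],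
   [9, 12, 14, 20, 17, 21, 23, 24, 15, 19, 7, 6, 16, 5, 22, 11, 0, 18, 4, 13, 2, 8, 1, 10],
   [22, 13, 5, 4, 24, 2, 12, 23, 17, 1, 14, 19, 11, 18, 3, 7, 15, 10, 20, 0, 8, 21, 16, 9],
   [14, 4, 7, 11, 13, 16, 20, 3, 22, 12, 6, 21, 5, 15, 17, 2, 23, 1, 24, 10, 0, 19, 8, 18]]

def data102 : List (List ℕ) :=
  [[15, 34, 37, 14, 36, 39, 40, 13, 31, 12, 16, 33, 6, 8, 32, 23, 35, 2, 30, 27, 3, 21, 19, 18, 4,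
    25, 7, 1, 22, 11, 17, 10, 26, 38, 9, 28, 29, 20, 24, 5],
   [3, 1, 33, 13, 22, 2, 14, 10, 25, 35, 39, 23, 17, 38, 12, 8, 0, 34, 40, 16, 15, 18, 37, 36, 27,
    4, 30, 19, 29, 7, 24, 21, 6, 31, 20, 28, 26, 32, 9, 11],
   [33, 39, 0, 25, 20, 27, 13, 30, 37, 12, 35, 5, 31, 34, 29, 2, 18, 21, 36, 9, 24, 8, 7, 40, 3,
    15, 28, 22, 32, 19, 26, 6, 11, 23, 1, 16, 38, 14, 4, 17],
   [8, 20, 38, 3, 5, 16, 31, 24, 6, 14, 34, 21, 35, 7, 17, 29, 11, 2, 26, 33, 30, 0, 4, 23, 40,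
    27, 10, 13, 19, 39, 22, 18, 9, 25, 36, 28, 32, 37, 1, 12]]

def ebd (k t : ℕ) (L : List (List ℕ)) : Prop :=
  (∀ i, i < k * t → ∀ j, j < 2 * t → ∀ p, p < k → ept k t L i j p < 2 * k * t + 1) ∧
  (∀ h, h < t → ∀ p, p < k → ehp k h p < 2 * k * t + 1) ∧
  (∀ h, h < t → ∀ h', h' < t → ∀ p, p < k → ∀ p', p' < k → ehp k h p = ehp k h' p' →
    h = h' ∧ p = p')

set_option synthInstance.maxSize 4096 in
set_option synthInstance.maxHeartbeats 400000 in
instance (k t : ℕ) (L : List (List ℕ)) : Decidable (ebd k t L) := by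
  unfold ebd; infer_instance

theorem ecov_spec {k t : ℕ} {L : List (List ℕ)} (hk : 0 < k) (H : ecov k t L) (i : ℕ)
    (hi : i < k * t) : ∃ w, ∀ x, x < 2 * k * t + 1 → x ≠ w →
      ∃ j, j < 2 * t ∧ ∃ p, p < k ∧ ept k t L i j p = x := by
  refine ⟨esh (k / 2) (2 * k * t) (i % (k / 2)) (i / (k / 2) * (k / 2)), fun x hx hne => ?_⟩
  obtain ⟨e, he, h⟩ := emask_spec _ _ _ (H i hi x hx hne)
  exact ⟨e / k, Nat.div_lt_of_lt_mul (by rw [mul_comm]; exact he), e % k, Nat.mod_lt _ hk, h⟩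

theorem ecode_inj {M u v a b : ℕ} (hv : v < M) (hb : b < M) (h : u * M + v = a * M + b) :
    u = a ∧ v = b := by
  have h1 : (u * M + v) / M = u := by
    rw [mul_comm, Nat.mul_add_div (by omega), Nat.div_eq_of_lt hv, add_zero]
  have h2 : (a * M + b) / M = a := by
    rw [mul_comm, Nat.mul_add_div (by omega), Nat.div_eq_of_lt hb, add_zero]
  have : u = a := by rw [← h1, h, h2]
  subst this
  exact ⟨rfl, by omega⟩

theorem eedge_aux {k t : ℕ} {L : List (List ℕ)} (hk : 0 < k) (ht : 0 < t) (B : ebd k t L)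
    (a b : ℕ) (hb : b < 2 * k * t + 1)
    (H : (emask (ecode k t L) (k * t * (2 * t * k)) ||| emask (hcode k t) (t * k)).testBit
      (a * (2 * k * t + 1) + b) = true) :
    (∃ i, i < k * t ∧ ∃ j, j < 2 * t ∧ ∃ p, p < k ∧ ept k t L i j p = a ∧
      ept k t L i j ((p + 1) % k) = b) ∨
    (∃ h, h < t ∧ ∃ p, p < k ∧ ehp k h p = a ∧ ehp k h ((p + 1) % k) = b) := by
  have hm : ∀ e, (e + 1) % k = (e % k + 1) % k := fun e => by simp
  rw [Nat.testBit_or, Bool.or_eq_true] at H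
  rcases H with H | H
  · left
    obtain ⟨e, he, h⟩ := emask_spec _ _ _ H
    have hi : e / (2 * t * k) < k * t := Nat.div_lt_of_lt_mul (by rw [mul_comm]; exact he)
    have hj : e / k % (2 * t) < 2 * t := Nat.mod_lt _ (by omega)
    refine ⟨_, hi, _, hj, e % k, Nat.mod_lt _ hk, ?_⟩
    rw [← hm]
    exact ecode_inj (B.1 _ hi _ hj _ (Nat.mod_lt _ hk)) hb h
  · right
    obtain ⟨e, he, h⟩ := emask_spec _ _ _ H
    have hi : e / k < t := Nat.div_lt_of_lt_mul (by rw [mul_comm]; exact he)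
    refine ⟨_, hi, e % k, Nat.mod_lt _ hk, ?_⟩
    rw [← hm]
    exact ecode_inj (B.2.1 _ hi _ (Nat.mod_lt _ hk)) hb h

theorem onCyc_mod {V : Type*} {k : ℕ} (c : ℕ → V) (p : ℕ) (hp : p < k) :
    OnCyc (fun n : ZMod k => c n.val) (c p) (c ((p + 1) % k)) := by
  by_cases h : p + 1 = k
  · rw [h, Nat.mod_self]; exact onCyc_last c p h
  · rw [Nat.mod_eq_of_lt (by omega)]; exact onCyc_succ c p (by omega)

theorem eedge_spec {k t : ℕ} {L : List (List ℕ)} (hk : 0 < k) (ht : 0 < t) (B : ebd k t L)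
    (H : eedge k t L) {V : Type*} (f : ℕ → V) (a b : ℕ) (ha : a < 2 * k * t + 1)
    (hb : b < 2 * k * t + 1) (hab : a ≠ b) :
    (∃ i, i < k * t ∧ ∃ j, j < 2 * t ∧
      OnCyc (fun n : ZMod k => f (ept k t L i j n.val)) (f a) (f b)) ∨
    (∃ h, h < t ∧ OnCyc (fun n : ZMod k => f (ehp k h n.val)) (f a) (f b)) := by
  have key : ∀ a b, b < 2 * k * t + 1 →
    (emask (ecode k t L) (k * t * (2 * t * k)) ||| emask (hcode k t) (t * k)).testBit
      (a * (2 * k * t + 1) + b) = true →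
    (∃ i, i < k * t ∧ ∃ j, j < 2 * t ∧
      OnCyc (fun n : ZMod k => f (ept k t L i j n.val)) (f a) (f b)) ∨
    (∃ h, h < t ∧ OnCyc (fun n : ZMod k => f (ehp k h n.val)) (f a) (f b)) := by
    intro a b hb H
    rcases eedge_aux hk ht B a b hb H with ⟨i, hi, j, hj, p, hp, rfl, rfl⟩ | ⟨h, hh, p, hp, rfl, rfl⟩
    · exact Or.inl ⟨i, hi, j, hj, onCyc_mod (fun p => f (ept k t L i j p)) p hp⟩
    · exact Or.inr ⟨h, hh, onCyc_mod (fun p => f (ehp k h p)) p hp⟩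
  have key' : ∀ a b, a < 2 * k * t + 1 →
    (emask (ecode k t L) (k * t * (2 * t * k)) ||| emask (hcode k t) (t * k)).testBit
      (b * (2 * k * t + 1) + a) = true →
    (∃ i, i < k * t ∧ ∃ j, j < 2 * t ∧
      OnCyc (fun n : ZMod k => f (ept k t L i j n.val)) (f a) (f b)) ∨
    (∃ h, h < t ∧ OnCyc (fun n : ZMod k => f (ehp k h n.val)) (f a) (f b)) := by
    intro a b ha H
    rcases key b a ha H with ⟨i, hi, j, hj, h⟩ | ⟨h, hh, h'⟩
    · exact Or.inl ⟨i, hi, j, hj, h.symm⟩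
    · exact Or.inr ⟨h, hh, h'.symm⟩
  rcases Nat.lt_or_gt_of_ne hab with h | h
  · rcases H b hb a h with h' | h'
    · exact key' a b ha h'
    · exact key a b hb h'
  · rcases H a ha b h with h' | h'
    · exact key a b hb h'
    · exact key' a b ha h'

theorem arcs_of_check (k t : ℕ) (L : List (List ℕ)) (hk : 0 < k) (ht : 0 < t) (B : ebd k t L)
    (C : ecov k t L) (H : eedge k t L) : HasARCS k (2 * k * t + 1) := by
  have : NeZero k := ⟨hk.ne'⟩
  let f : ℕ → Fin (2 * k * t + 1) := fun v => Fin.ofNat (2 * k * t + 1) v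
  have hf : ∀ x : Fin (2 * k * t + 1), f x.val = x := fun x => by
    ext; simp [f, Nat.mod_eq_of_lt x.2]
  have hfv : ∀ v, v < 2 * k * t + 1 → (f v).val = v := fun v hv => by
    simp [f, Nat.mod_eq_of_lt hv]
  let S : Sys k (Fin (2 * k * t + 1)) (Fin (k * t)) (Fin (2 * t)) (Fin t) :=
    { apc := fun i j n => f (ept k t L i.val j.val n.val)
      hpc := fun h n => f (ehp k h.val n.val)
      hinj := by
        intro h h' n n' e
        have e := congrArg Fin.val e
        rw [hfv _ (B.2.1 _ h.2 _ (ZMod.val_lt n)), hfv _ (B.2.1 _ h'.2 _ (ZMod.val_lt n'))] at e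
        obtain ⟨h1, h2⟩ := B.2.2 _ h.2 _ h'.2 _ (ZMod.val_lt n) _ (ZMod.val_lt n') e
        exact ⟨Fin.ext h1, ZMod.val_injective k h2⟩
      cover := by
        intro i
        obtain ⟨w, hw⟩ := ecov_spec hk C i.val i.2
        refine ⟨f w, fun x hx => ?_⟩
        obtain ⟨j, hj, p, hp, h⟩ := hw x.val x.2 (fun h => hx (by rw [← h, hf]))
        refine ⟨⟨j, hj⟩, (p : ℕ), ?_⟩
        rw [ZMod.val_cast_of_lt hp, h, hf]
      edges := by
        intro a b hab
        have := eedge_spec hk ht B H f a.val b.val a.2 b.2 (fun h => hab (Fin.ext h))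
        rw [hf, hf] at this
        rcases this with ⟨i, hi, j, hj, h⟩ | ⟨h, hh, h'⟩
        · exact Or.inl ⟨⟨i, hi⟩, ⟨j, hj⟩, h⟩
        · exact Or.inr ⟨⟨h, hh⟩, h'⟩ }
  exact hasARCS_of_sys k t hk (by simp) (by simp) (by simp) (by simp) S

/-- decode a natural number into a point of a base system -/
def edec (k v : ℕ) : Option (Bool × ZMod k) :=
  if v = 2 * k then none else if v < k then some (false, (v : ZMod k))
  else some (true, ((v - k : ℕ) : ZMod k))

theorem edec_surj {k : ℕ} (hk : 0 < k) (x : Option (Bool × ZMod k)) :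
    ∃ v, v < 2 * k * 1 + 1 ∧ edec k v = x := by
  have : NeZero k := ⟨hk.ne'⟩
  rcases x with _ | ⟨b, x⟩
  · exact ⟨2 * k, by omega, by simp [edec]⟩
  · have := ZMod.val_lt x
    cases b
    · refine ⟨x.val, by omega, ?_⟩
      rw [edec, if_neg (by omega), if_pos (by omega), ZMod.natCast_zmod_val]
    · refine ⟨x.val + k, by omega, ?_⟩
      rw [edec, if_neg (by omega), if_neg (by omega), Nat.add_sub_cancel, ZMod.natCast_zmod_val]

def Base.ofCheck (k : ℕ) (L : List (List ℕ)) (hk : 0 < k) (B : ebd k 1 L)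
    (C : ecov k 1 L) (H : eedge k 1 L) (hpc : ZMod k → Bool × ZMod k)
    (hinj : Function.Injective hpc)
    (hh : ∀ n : ZMod k, some (hpc n) = edec k (ehp k 0 n.val)) : Base k where
  apc := fun i j n => edec k (ept k 1 L i.val j.toNat n.val)
  hpc := hpc
  hinj := hinj
  cover := by
    have : NeZero k := ⟨hk.ne'⟩
    intro i
    obtain ⟨w, hw⟩ := ecov_spec hk C i.val (by rw [mul_one]; exact ZMod.val_lt i)
    refine ⟨edec k w, fun x hx => ?_⟩
    obtain ⟨v, hv, rfl⟩ := edec_surj hk x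
    obtain ⟨j, hj, p, hp, h⟩ := hw v hv (fun h => hx (by rw [h]))
    refine ⟨decide (j = 1), (p : ℕ), ?_⟩
    have hj' : (decide (j = 1)).toNat = j := by
      have : j = 0 ∨ j = 1 := by omega
      rcases this with rfl | rfl <;> rfl
    rw [ZMod.val_cast_of_lt hp, hj', h]
  edges := by
    have : NeZero k := ⟨hk.ne'⟩
    intro x y hxy
    obtain ⟨a, ha, rfl⟩ := edec_surj hk x
    obtain ⟨b, hb, rfl⟩ := edec_surj hk y
    rcases eedge_spec hk one_pos B H (edec k) a b ha hb (fun h => hxy (by rw [h])) with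
      ⟨i, hi, j, hj, h⟩ | ⟨h, hlt, h'⟩
    · left
      refine ⟨(i : ℕ), decide (j = 1), ?_⟩
      have hj' : (decide (j = 1)).toNat = j := by
        have : j = 0 ∨ j = 1 := by omega
        rcases this with rfl | rfl <;> rfl
      rw [ZMod.val_cast_of_lt (by omega), hj']
      exact h
    · right
      have : h = 0 := by omega
      subst this
      simp only [hh]
      exact h'

def base6 : Base 6 := Base.ofCheck 6 data61 (by norm_num) (by decide +kernel)
  (by decide +kernel) (by decide +kernel) (fun n => (false, (ehp 6 0 n.val : ℕ)))
  (by decide +kernel) (by decide +kernel)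

def base10 : Base 10 := Base.ofCheck 10 data101 (by norm_num) (by decide +kernel)
  (by decide +kernel) (by decide +kernel) (fun n => (false, (ehp 10 0 n.val : ℕ)))
  (by decide +kernel) (by decide +kernel)

theorem arcs_six_two : HasARCS 6 (2 * 6 * 2 + 1) :=
  arcs_of_check 6 2 data62 (by norm_num) (by norm_num) (by decide +kernel)
    (by decide +kernel) (by decide +kernel)

theorem arcs_ten_two : HasARCS 10 (2 * 10 * 2 + 1) :=
  arcs_of_check 10 2 data102 (by norm_num) (by norm_num) (by decide +kernel)
    (by decide +kernel) (by decide +kernel)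

/-! ### The template for `k = 6` -/

def t6lab (c : Bool) (n : ZMod 6) : Option Bool :=
  (bif c then [none, some true, none, some false, none, some false]
   else [none, some true, none, some false, none, some true]).getD n.val none

def t6val (c : Bool) (n : ZMod 6) : ZMod 6 :=
  (bif c then [2, 0, 3, 5, 1, 2] else [5, 1, 0, 3, 4, 4]).getD n.val 0

def tmpl6 : Tmpl 6 where
  lab := t6lab
  val := t6val
  covE := by decide +kernel
  covO := by decide +kernel
  edges := by unfold OnCyc; decide +kernel

theorem exists_base (m : ℕ) (hm : 1 ≤ m) : Nonempty (Base (4 * m + 2)) := by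
  by_cases h1 : m = 1
  · subst h1; exact ⟨base6⟩
  by_cases h2 : m = 2
  · subst h2; exact ⟨base10⟩
  exact ⟨baseGen m (by omega)⟩

theorem exists_tmpl (m : ℕ) (hm : 1 ≤ m) : Nonempty (Tmpl (4 * m + 2)) := by
  by_cases h1 : m = 1
  · subst h1; exact ⟨tmpl6⟩
  exact ⟨tmplGen m (by omega)⟩

theorem arcs_of_two_mod_four (k t : ℕ) (hk6 : 6 ≤ k) (hk4 : k % 4 = 2)
    (ht : 1 ≤ t) (hexc : ¬(t = 2 ∧ 14 ≤ k)) :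
    HasARCS k (2 * k * t + 1) := by
  obtain ⟨m, rfl⟩ : ∃ m, k = 4 * m + 2 := ⟨k / 4, by omega⟩
  obtain ⟨B⟩ := exists_base m (by omega)
  obtain ⟨F⟩ := exists_tmpl m (by omega)
  by_cases h1 : t = 1
  · subst h1; exact arcs_one (by omega) B
  by_cases h2 : t = 2
  · subst h2
    have : m = 1 ∨ m = 2 := by omega
    rcases this with rfl | rfl
    · exact arcs_six_two
    · exact arcs_ten_two
  · exact arcs_ge_three (by omega) (by omega) B F
end

section
/- For every k ≥ 18 with k ≡ 2 (mod 4), there exists an almost resolvable k-cycle system of order 2k+1. -/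
/-- Counting: surjectivity from a set of the right size forces injectivity. -/
theorem inj_of_cover_s2 {α β : Type*} [Fintype α] [DecidableEq β] (f : α → β)
    (S : Finset β) (hS : Fintype.card α ≤ S.card) (h : ∀ b ∈ S, ∃ a, f a = b) :
    Function.Injective f := by
  have h1 : S ⊆ Finset.univ.image f := by
    intro b hb
    obtain ⟨a, rfl⟩ := h b hb
    simp
  have h2 := Finset.card_le_card h1
  have h3 : (Finset.univ.image f).card ≤ (Finset.univ : Finset α).card := Finset.card_image_le
  have h4 : (Finset.univ.image f).card = (Finset.univ : Finset α).card := by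
    rw [Finset.card_univ] at *
    omega
  have := Finset.card_image_iff.mp h4
  intro a b hab
  exact this (by simp) (by simp) hab

theorem arcs_of_cover_fin (k : ℕ) (hk : 3 ≤ k)
    (apc : Fin k → Fin 2 → ZMod k → Fin (2 * k + 1)) (hpc : Fin 1 → ZMod k → Fin (2 * k + 1))
    (S : Finset (Fin (2 * k + 1))) (hS : k ≤ S.card) (hSr : ∀ v ∈ S, ∃ z, hpc 0 z = v)
    (ha : ∀ i, ∃ m, ∀ v, v ≠ m → ∃ j z, apc i j z = v)
    (he : ∀ u v, u ≠ v → (∃ i j, s(u, v) ∈ cycleEdgeSet (apc i j)) ∨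
      s(u, v) ∈ cycleEdgeSet (hpc 0)) : HasARCS k (2 * k + 1) := by
  have : NeZero k := ⟨by omega⟩
  have h1 : (2 * k + 1 - 1) / 2 = k := by omega
  have h2 : (2 * k + 1 - 1) / k = 2 := by
    rw [Nat.add_sub_cancel]; exact Nat.mul_div_cancel _ (by omega)
  have h3 : (2 * k + 1 - 1) / (2 * k) = 1 := by
    rw [Nat.add_sub_cancel]; exact Nat.div_self (by omega)
  unfold HasARCS
  rw [h1, h2, h3]
  have key : ∀ i, Function.Injective (fun p : Fin 2 × ZMod k => apc i p.1 p.2) := by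
    intro i
    obtain ⟨m, hm⟩ := ha i
    refine inj_of_cover_s2 _ (Finset.univ.erase m) ?_ ?_
    · rw [Finset.card_erase_of_mem (Finset.mem_univ _)]
      simp [ZMod.card]
    · intro b hb
      obtain ⟨j, z, h⟩ := hm b (by simpa using hb)
      exact ⟨(j, z), h⟩
  refine ⟨apc, hpc, ?_, ?_, ?_, ?_, ?_⟩
  · intro i j a b hab
    have := @key i (j, a) (j, b) hab
    simpa using this
  · intro j
    rw [Subsingleton.elim j 0]
    exact inj_of_cover_s2 _ S (by simpa [ZMod.card] using hS) hSr
  · intro i j₁ j₂ hj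
    rw [Set.disjoint_left]
    rintro _ ⟨a, rfl⟩ ⟨b, hb⟩
    have := @key i (j₂, b) (j₁, a) hb
    simp only [Prod.mk.injEq] at this
    exact hj this.1.symm
  · intro j₁ j₂ hj
    exact absurd (Subsingleton.elim j₁ j₂) hj
  · let c : (Fin k × Fin 2) ⊕ Fin 1 → ZMod k → Fin (2 * k + 1) :=
      Sum.elim (fun q => apc q.1 q.2) hpc
    let Φ : ((Fin k × Fin 2) ⊕ Fin 1) × ZMod k → Sym2 (Fin (2 * k + 1)) :=
      fun q => s(c q.1 q.2, c q.1 (q.2 + 1))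
    have hΦ : Function.Injective Φ := by
      refine inj_of_cover_s2 Φ (Finset.univ.filter (fun e => ¬ e.IsDiag)) ?_ ?_
      · rw [← Fintype.card_subtype, Sym2.card_subtype_not_diag]
        simp only [Fintype.card_prod, Fintype.card_sum, Fintype.card_fin, ZMod.card]
        rw [Nat.choose_two_right, Nat.add_sub_cancel]
        have : (2 * k + 1) * (2 * k) / 2 = (2 * k + 1) * k := by
          rw [show (2 * k + 1) * (2 * k) = ((2 * k + 1) * k) * 2 by ring]
          exact Nat.mul_div_cancel _ (by omega)
        rw [this]
        exact le_of_eq (by ring)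
      · intro e
        induction e using Sym2.ind with
        | _ u v =>
          intro h
          have huv : u ≠ v := by simpa using h
          rcases he u v huv with ⟨i, j, z, hz⟩ | ⟨z, hz⟩
          · exact ⟨(Sum.inl (i, j), z), hz.symm⟩
          · exact ⟨(Sum.inr 0, z), hz.symm⟩
    have hcov : ∀ (p : (Fin k × Fin 2) ⊕ Fin 1) (e : Sym2 (Fin (2 * k + 1))),
        e ∈ Sum.elim (fun q : Fin k × Fin 2 => cycleEdgeSet (apc q.1 q.2))
          (fun j => cycleEdgeSet (hpc j)) p ↔ ∃ z, e = Φ (p, z) := by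
      intro p e
      rcases p with p | p <;> rfl
    intro e
    induction e using Sym2.ind with
    | _ u v =>
      intro h
      have huv : u ≠ v := by simpa using h
      have hex : ∃ p z, s(u, v) = Φ (p, z) := by
        rcases he u v huv with ⟨i, j, z, hz⟩ | ⟨z, hz⟩
        · exact ⟨Sum.inl (i, j), z, hz⟩
        · exact ⟨Sum.inr 0, z, hz⟩
      obtain ⟨p, z, hz⟩ := hex
      refine ⟨p, (hcov p _).2 ⟨z, hz⟩, ?_⟩
      intro q hq
      obtain ⟨z', hz'⟩ := (hcov q _).1 hq
      have := hΦ (hz'.symm.trans hz)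
      exact (Prod.mk.inj this).1

theorem arcs_of_cover (k : ℕ) (hk : 3 ≤ k) {V ι : Type} [Fintype V] [Fintype ι]
    (hV : Fintype.card V = 2 * k + 1) (hι : Fintype.card ι = k)
    (apc : ι → Fin 2 → ZMod k → V) (hpc : ZMod k → V)
    (S : Finset V) (hS : k ≤ S.card) (hSr : ∀ v ∈ S, ∃ z, hpc z = v)
    (ha : ∀ i, ∃ m, ∀ v, v ≠ m → ∃ j z, apc i j z = v)
    (he : ∀ u v, u ≠ v → (∃ i j, s(u, v) ∈ cycleEdgeSet (apc i j)) ∨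
      s(u, v) ∈ cycleEdgeSet hpc) : HasARCS k (2 * k + 1) := by
  let e : V ≃ Fin (2 * k + 1) := Fintype.equivFinOfCardEq hV
  let g : ι ≃ Fin k := Fintype.equivFinOfCardEq hι
  have tr : ∀ (c : ZMod k → V) (u v : Fin (2 * k + 1)),
      s(e.symm u, e.symm v) ∈ cycleEdgeSet c → s(u, v) ∈ cycleEdgeSet (fun z => e (c z)) := by
    rintro c u v ⟨z, hz⟩
    refine ⟨z, ?_⟩
    have := congrArg (Sym2.map e) hz
    simpa using this
  refine arcs_of_cover_fin k hk (fun i j z => e (apc (g.symm i) j z)) (fun _ z => e (hpc z))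
    (S.map e.toEmbedding) (by simpa using hS) ?_ ?_ ?_
  · intro v hv
    obtain ⟨w, hw, rfl⟩ := Finset.mem_map.1 hv
    obtain ⟨z, rfl⟩ := hSr w hw
    exact ⟨z, rfl⟩
  · intro i
    obtain ⟨m, hm⟩ := ha (g.symm i)
    refine ⟨e m, fun v hv => ?_⟩
    obtain ⟨j, z, h⟩ := hm (e.symm v) (by rintro rfl; simp at hv)
    exact ⟨j, z, by simp [h]⟩
  · intro u v huv
    rcases he (e.symm u) (e.symm v) (by simpa using huv) with ⟨i, j, h⟩ | h
    · exact Or.inl ⟨g i, j, by simpa using tr _ _ _ h⟩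
    · exact Or.inr (tr _ _ _ h)


/-- A zigzag `(a,x),(b,y),(a,x+1),(b,y-1),…` with `m+1` pairs. -/
def zigList (a b : ℕ) : ℤ → ℤ → ℕ → List (ℕ × ℤ)
  | x, y, 0 => [(a, x), (b, y)]
  | x, y, m + 1 => (a, x) :: (b, y) :: zigList a b (x + 1) (y - 1) m

/-- Pieces of cycles: single points and zigzags. Vertices are written `(copy, position)`, copy
number `4` standing for the point at infinity. -/
inductive Pc where
  | pt (c : ℕ) (x : ℤ) : Pc
  | zz (a : ℕ) (x : ℤ) (b : ℕ) (y : ℤ) (m : ℕ) : Pc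

namespace Pc

def list : Pc → List (ℕ × ℤ)
  | pt c x => [(c, x)]
  | zz a x b y m => zigList a b x y m

def size : Pc → ℕ
  | pt _ _ => 1
  | zz _ _ _ _ m => 2 * m + 2

def first : Pc → ℕ × ℤ
  | pt c x => (c, x)
  | zz a x _ _ _ => (a, x)

def last : Pc → ℕ × ℤ
  | pt c x => (c, x)
  | zz _ _ b y m => (b, y - m)

/-- The vertex `(c, v)` occurs in the piece. -/
def covV : Pc → ℕ → ℤ → Prop
  | pt c' x, c, v => c = c' ∧ v = x
  | zz a x b y m, c, v => (c = a ∧ x ≤ v ∧ v ≤ x + m) ∨ (c = b ∧ y - m ≤ v ∧ v ≤ y)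

/-- The mixed difference `d` from copy `a'` to copy `b'` occurs inside the piece. -/
def covE : Pc → ℕ → ℕ → ℤ → Prop
  | pt _ _, _, _, _ => False
  | zz a x b y m, a', b', d =>
      (a' = a ∧ b' = b ∧ y - x - 2 * m ≤ d ∧ d ≤ y - x) ∨
      (a' = b ∧ b' = a ∧ y - x - 2 * m ≤ -d ∧ -d ≤ y - x)

end Pc

/-- The edge `p q` has difference `d` from copy `a` to copy `b`. -/
def Dif (p q : ℕ × ℤ) (a b : ℕ) (d : ℤ) : Prop :=
  (a = p.1 ∧ b = q.1 ∧ d = q.2 - p.2) ∨ (a = q.1 ∧ b = p.1 ∧ d = p.2 - q.2)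

theorem zigList_length (a b : ℕ) (m : ℕ) : ∀ x y, (zigList a b x y m).length = 2 * m + 2 := by
  induction m with
  | zero => intro x y; rfl
  | succ m ih => intro x y; simp only [zigList, List.length_cons, ih]; ring

theorem zigList_head (a b : ℕ) (x y : ℤ) (m : ℕ) :
    ∃ B, zigList a b x y m = (a, x) :: B := by
  cases m <;> exact ⟨_, rfl⟩

theorem zigList_last (a b : ℕ) (m : ℕ) :
    ∀ x y : ℤ, ∃ A, zigList a b x y m = A ++ [(b, y - m)] := by
  induction m with
  | zero => intro x y; exact ⟨[(a, x)], by simp [zigList]⟩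
  | succ m ih =>
    intro x y
    obtain ⟨A, hA⟩ := ih (x + 1) (y - 1)
    refine ⟨(a, x) :: (b, y) :: A, ?_⟩
    rw [zigList, hA]
    have : y - 1 - (m : ℤ) = y - ((m + 1 : ℕ) : ℤ) := by push_cast; ring
    simp [this]

theorem zigList_memA (a b : ℕ) (m : ℕ) :
    ∀ x y v : ℤ, x ≤ v → v ≤ x + m → (a, v) ∈ zigList a b x y m := by
  induction m with
  | zero =>
    intro x y v h1 h2
    have : v = x := by push_cast at h2; omega
    simp [zigList, this]
  | succ m ih =>
    intro x y v h1 h2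
    by_cases h : v = x
    · simp [zigList, h]
    · have := ih (x + 1) (y - 1) v (by omega) (by push_cast at h2; omega)
      simp [zigList, this]

theorem zigList_memB (a b : ℕ) (m : ℕ) :
    ∀ x y v : ℤ, y - m ≤ v → v ≤ y → (b, v) ∈ zigList a b x y m := by
  induction m with
  | zero =>
    intro x y v h1 h2
    have : v = y := by push_cast at h1; omega
    simp [zigList, this]
  | succ m ih =>
    intro x y v h1 h2
    by_cases h : v = y
    · simp [zigList, h]
    · have := ih (x + 1) (y - 1) v (by push_cast at h1; omega) (by omega)
      simp [zigList, this]

theorem zigList_adj (a b : ℕ) (m : ℕ) :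
    ∀ x y d : ℤ, y - x - 2 * m ≤ d → d ≤ y - x →
      ∃ p q A B, zigList a b x y m = A ++ p :: q :: B ∧ Dif p q a b d := by
  induction m with
  | zero =>
    intro x y d h1 h2
    exact ⟨(a, x), (b, y), [], [], rfl, Or.inl ⟨rfl, rfl, by push_cast at h1; omega⟩⟩
  | succ m ih =>
    intro x y d h1 h2
    by_cases h : d = y - x
    · exact ⟨(a, x), (b, y), [], _, rfl, Or.inl ⟨rfl, rfl, h⟩⟩
    by_cases h' : d = y - x - 1
    · obtain ⟨B, hB⟩ := zigList_head a b (x + 1) (y - 1) m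
      refine ⟨(b, y), (a, x + 1), [(a, x)], B, ?_, Or.inr ⟨rfl, rfl, ?_⟩⟩
      · rw [zigList, hB]; rfl
      · simp only; omega
    · obtain ⟨p, q, A, B, hl, hd⟩ := ih (x + 1) (y - 1) d (by push_cast at h1; omega) (by omega)
      exact ⟨p, q, (a, x) :: (b, y) :: A, B, by rw [zigList, hl]; rfl, hd⟩

theorem Dif.swap {p q : ℕ × ℤ} {a b : ℕ} {d : ℤ} (h : Dif p q a b (-d)) : Dif p q b a d := by
  rcases h with ⟨h1, h2, h3⟩ | ⟨h1, h2, h3⟩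
  · exact Or.inr ⟨h2, h1, by omega⟩
  · exact Or.inl ⟨h2, h1, by omega⟩

namespace Pc

theorem list_length (P : Pc) : P.list.length = P.size := by
  cases P with
  | pt c x => rfl
  | zz a x b y m => exact zigList_length a b m x y

theorem list_first (P : Pc) : ∃ B, P.list = P.first :: B := by
  cases P with
  | pt c x => exact ⟨[], rfl⟩
  | zz a x b y m => exact zigList_head a b x y m

theorem list_last (P : Pc) : ∃ A, P.list = A ++ [P.last] := by
  cases P with
  | pt c x => exact ⟨[], rfl⟩
  | zz a x b y m => exact zigList_last a b m x y

theorem mem_of_covV (P : Pc) (c : ℕ) (v : ℤ) (h : P.covV c v) : (c, v) ∈ P.list := by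
  cases P with
  | pt c' x =>
    obtain ⟨rfl, rfl⟩ := h
    simp [list]
  | zz a x b y m =>
    rcases h with ⟨rfl, h1, h2⟩ | ⟨rfl, h1, h2⟩
    · exact zigList_memA _ _ m x y v h1 h2
    · exact zigList_memB _ _ m x y v h1 h2

theorem adj_of_covE (P : Pc) (a b : ℕ) (d : ℤ) (h : P.covE a b d) :
    ∃ p q A B, P.list = A ++ p :: q :: B ∧ Dif p q a b d := by
  cases P with
  | pt c' x => exact h.elim
  | zz a x b y m =>
    rcases h with ⟨rfl, rfl, h1, h2⟩ | ⟨rfl, rfl, h1, h2⟩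
    · exact zigList_adj _ _ m x y d h1 h2
    · obtain ⟨p, q, A, B, hl, hd⟩ := zigList_adj _ _ m x y (-d) h1 h2
      exact ⟨p, q, A, B, hl, hd.swap⟩

end Pc

/-- Vertices occurring in a list of pieces. -/
def covVs : List Pc → ℕ → ℤ → Prop
  | [], _, _ => False
  | P :: R, c, v => P.covV c v ∨ covVs R c v

/-- Differences occurring along the pieces `P :: R`, closed up by returning to `h`. -/
def covEs (h : Pc) : Pc → List Pc → ℕ → ℕ → ℤ → Prop
  | P, [], a, b, d => P.covE a b d ∨ Dif P.last h.first a b d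
  | P, Q :: R, a, b, d => P.covE a b d ∨ Dif P.last Q.first a b d ∨ covEs h Q R a b d

def pcList (C : List Pc) : List (ℕ × ℤ) := C.flatMap Pc.list

def pcSize : List Pc → ℕ
  | [] => 0
  | P :: R => P.size + pcSize R

theorem pcList_length (C : List Pc) : (pcList C).length = pcSize C := by
  induction C with
  | nil => rfl
  | cons P R ih =>
    have : pcList (P :: R) = P.list ++ pcList R := rfl
    rw [this, List.length_append, ih, Pc.list_length, pcSize]

theorem mem_of_covVs (C : List Pc) (c : ℕ) (v : ℤ) (h : covVs C c v) : (c, v) ∈ pcList C := by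
  induction C with
  | nil => exact h.elim
  | cons P R ih =>
    have e : pcList (P :: R) = P.list ++ pcList R := rfl
    rw [e, List.mem_append]
    exact h.imp (P.mem_of_covV c v) ih

theorem adj_of_covEs (h : Pc) (a b : ℕ) (d : ℤ) (R : List Pc) : ∀ P, covEs h P R a b d →
    ∃ p q A B, pcList (P :: R) ++ [h.first] = A ++ p :: q :: B ∧ Dif p q a b d := by
  induction R with
  | nil =>
    intro P hc
    have e : pcList [P] = P.list := by simp [pcList]
    rw [e]
    rcases hc with hc | hc
    · obtain ⟨p, q, A, B, hl, hd⟩ := P.adj_of_covE a b d hc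
      exact ⟨p, q, A, B ++ [h.first], by simp [hl], hd⟩
    · obtain ⟨A, hA⟩ := P.list_last
      exact ⟨P.last, h.first, A, [], by simp [hA], hc⟩
  | cons Q R ih =>
    intro P hc
    have e : pcList (P :: Q :: R) = P.list ++ pcList (Q :: R) := rfl
    have e' : pcList (Q :: R) = Q.list ++ pcList R := rfl
    rw [e]
    rcases hc with hc | hc | hc
    · obtain ⟨p, q, A, B, hl, hd⟩ := P.adj_of_covE a b d hc
      exact ⟨p, q, A, B ++ pcList (Q :: R) ++ [h.first], by simp [hl], hd⟩
    · obtain ⟨A, hA⟩ := P.list_last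
      obtain ⟨B, hB⟩ := Q.list_first
      exact ⟨P.last, Q.first, A, B ++ pcList R ++ [h.first], by simp [hA, e', hB], hc⟩
    · obtain ⟨p, q, A, B, hl, hd⟩ := ih Q hc
      exact ⟨p, q, P.list ++ A, B, by rw [List.append_assoc, hl, List.append_assoc], hd⟩

/-- The closed walk of a list. -/
def walk {V : Type} (k : ℕ) (f : ℕ × ℤ → V) (L : List (ℕ × ℤ)) : ZMod k → V :=
  fun z => f (L.getD z.val (0, 0))

theorem walk_mem {V : Type} (k : ℕ) [NeZero k] (f : ℕ × ℤ → V) (L : List (ℕ × ℤ))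
    (hL : L.length = k) (p : ℕ × ℤ) (hp : p ∈ L) : ∃ z, walk k f L z = f p := by
  obtain ⟨i, hi, rfl⟩ := List.mem_iff_getElem.1 hp
  refine ⟨(i : ZMod k), ?_⟩
  unfold walk
  rw [ZMod.val_cast_of_lt (by omega), List.getD_eq_getElem _ _ hi]

theorem walk_adj {V : Type} (k : ℕ) [NeZero k] (f : ℕ × ℤ → V) (L : List (ℕ × ℤ))
    (hL : L.length = k) (h p q : ℕ × ℤ) (T : List (ℕ × ℤ)) (hT : L = h :: T)
    (A B : List (ℕ × ℤ)) (hAB : L ++ [h] = A ++ p :: q :: B) :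
    s(f p, f q) ∈ cycleEdgeSet (walk k f L) := by
  have hlen := congrArg List.length hAB
  simp only [List.length_append, List.length_cons, List.length_nil] at hlen
  have hp : (L ++ [h])[A.length]? = some p := by rw [hAB]; simp
  have hq : (L ++ [h])[A.length + 1]? = some q := by
    rw [hAB, List.getElem?_append_right (by omega)]; simp
  have hi : A.length < L.length := by omega
  rw [List.getElem?_append_left hi] at hp
  refine ⟨(A.length : ZMod k), ?_⟩
  have e1 : walk k f L (A.length : ZMod k) = f p := by
    unfold walk
    rw [ZMod.val_cast_of_lt (by omega), List.getD_eq_getElem?_getD, hp]; rfl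
  have e2 : walk k f L ((A.length : ZMod k) + 1) = f q := by
    unfold walk
    have : ((A.length : ZMod k) + 1) = ((A.length + 1 : ℕ) : ZMod k) := by push_cast; rfl
    rw [this, ZMod.val_natCast]
    by_cases hlt : A.length + 1 < L.length
    · rw [List.getElem?_append_left hlt] at hq
      rw [Nat.mod_eq_of_lt (by omega), List.getD_eq_getElem?_getD, hq]; rfl
    · have he : A.length + 1 = L.length := by omega
      rw [he, List.getElem?_append_right (le_refl _)] at hq
      simp at hq
      rw [he, hL, Nat.mod_self, hT, hq]; rfl
  rw [e1, e2]


abbrev VV (n : ℕ) := Option (Fin 4 × ZMod n)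

/-- Interpretation of `(copy, position)`, translated by `g`. -/
def toV (n : ℕ) (g : ZMod n) (p : ℕ × ℤ) : VV n :=
  if h : p.1 < 4 then some (⟨p.1, h⟩, (p.2 : ZMod n) + g) else none

/-- The half-parallel class. -/
def halfWalk (n a b : ℕ) (z : ZMod (2 * n)) : VV n :=
  toV n 0 (if z.val % 2 = 0 then a else b, ((z.val / 2 : ℕ) : ℤ))

theorem halfWalk_even (n a b : ℕ) (hn : 0 < n) (x : ZMod n) :
    halfWalk n a b ((2 * x.val : ℕ) : ZMod (2 * n)) = toV n x (a, 0) := by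
  have : NeZero n := ⟨by omega⟩
  have hx := x.val_lt
  unfold halfWalk
  rw [ZMod.val_cast_of_lt (by omega), Nat.mul_mod_right, if_pos rfl,
    Nat.mul_div_cancel_left _ (by omega)]
  simp [toV]

theorem halfWalk_odd (n a b : ℕ) (hn : 0 < n) (x : ZMod n) :
    halfWalk n a b ((2 * x.val : ℕ) + 1 : ZMod (2 * n)) = toV n x (b, 0) := by
  have : NeZero n := ⟨by omega⟩
  have hx := x.val_lt
  unfold halfWalk
  have e : ((2 * x.val : ℕ) + 1 : ZMod (2 * n)) = ((2 * x.val + 1 : ℕ) : ZMod (2 * n)) := by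
    push_cast; rfl
  rw [e, ZMod.val_cast_of_lt (by omega), if_neg (by omega),
    show (2 * x.val + 1) / 2 = x.val by omega]
  simp [toV]

theorem halfWalk_next (n a b : ℕ) (hn : 1 < n) (x : ZMod n) :
    halfWalk n a b ((2 * x.val : ℕ) + 1 + 1 : ZMod (2 * n)) = toV n (x + 1) (a, 0) := by
  have : NeZero n := ⟨by omega⟩
  have : Fact (1 < n) := ⟨hn⟩
  rw [← halfWalk_even n a b (by omega)]
  congr 1
  have hx := x.val_lt
  rw [ZMod.val_add, ZMod.val_one]
  by_cases h : x.val + 1 < n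
  · rw [Nat.mod_eq_of_lt h]; push_cast; ring
  · have h' : x.val + 1 = n := by omega
    rw [h', Nat.mod_self]
    have : ((2 * x.val : ℕ) + 1 + 1 : ZMod (2 * n)) = ((2 * (x.val + 1) : ℕ) : ZMod (2 * n)) := by
      push_cast; ring
    rw [this, h']
    simp

/-- Reduction of the existence problem to linear arithmetic. -/
theorem arcs_of_pieces (n : ℕ) (hn : 2 ≤ n) (hd : Fin 2 → Fin 2 → Pc)
    (tl : Fin 2 → Fin 2 → List Pc) (a₀ b₀ : ℕ) (ha₀ : a₀ < 4) (hb₀ : b₀ < 4) (hab : a₀ ≠ b₀)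
    (hlen : ∀ f j, pcSize (hd f j :: tl f j) = 2 * n)
    (mc : Fin 2 → ℕ) (mv : Fin 2 → ℤ)
    (hvi : ∀ f, ∃ j, covVs (hd f j :: tl f j) 4 0)
    (hv : ∀ f, ∀ c, c < 4 → ∀ v : ℤ, 0 ≤ v → v < n → (c = mc f ∧ v = mv f) ∨
      ∃ w : ℤ, (n : ℤ) ∣ w - v ∧ ∃ j, covVs (hd f j :: tl f j) c w)
    (hei : ∀ c, c < 4 → ∃ w f j, covEs (hd f j) (hd f j) (tl f j) 4 c w)
    (he : ∀ a b, a ≤ b → b < 4 → ∀ d : ℤ, 0 ≤ d → d < n → (a = b → d ≠ 0) →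
      ((a = a₀ ∧ b = b₀ ∧ (d = 0 ∨ d = n - 1)) ∨ (a = b₀ ∧ b = a₀ ∧ (d = 0 ∨ d = 1))) ∨
      ∃ w : ℤ, (n : ℤ) ∣ w - d ∧ ∃ f j, covEs (hd f j) (hd f j) (tl f j) a b w) :
    HasARCS (2 * n) (2 * (2 * n) + 1) := by
  have : NeZero n := ⟨by omega⟩
  have : NeZero (2 * n) := ⟨by omega⟩
  have hmod : ∀ w v : ℤ, (n : ℤ) ∣ w - v → (w : ZMod n) = (v : ZMod n) := by
    intro w v h
    have := (ZMod.intCast_zmod_eq_zero_iff_dvd (w - v) n).2 h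
    push_cast at this
    exact sub_eq_zero.1 this
  let L : Fin 2 → Fin 2 → List (ℕ × ℤ) := fun f j => pcList (hd f j :: tl f j)
  have hL : ∀ f j, (L f j).length = 2 * n := fun f j => by
    rw [← hlen f j]; exact pcList_length _
  have hLh : ∀ f j, ∃ T, L f j = (hd f j).first :: T := by
    intro f j
    obtain ⟨B, hB⟩ := (hd f j).list_first
    exact ⟨B ++ pcList (tl f j), by
      have : L f j = (hd f j).list ++ pcList (tl f j) := rfl
      rw [this, hB]; rfl⟩
  -- an edge of given difference in the walk with any translation
  have hwalk : ∀ f j a b w, covEs (hd f j) (hd f j) (tl f j) a b w → ∃ x : ℤ, ∀ g : ZMod n,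
      s(toV n g (a, x), toV n g (b, x + w)) ∈ cycleEdgeSet (walk (2 * n) (toV n g) (L f j)) := by
    intro f j a b w h
    obtain ⟨p, q, A, B, hl, hD⟩ := adj_of_covEs _ a b w _ _ h
    obtain ⟨T, hT⟩ := hLh f j
    rcases hD with ⟨h1, h2, h3⟩ | ⟨h1, h2, h3⟩
    · refine ⟨p.2, fun g => ?_⟩
      have := walk_adj (2 * n) (toV n g) (L f j) (hL f j) _ p q T hT A B hl
      rw [h1, h2, show p.2 + w = q.2 by omega]
      exact this
    · refine ⟨q.2, fun g => ?_⟩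
      have := walk_adj (2 * n) (toV n g) (L f j) (hL f j) _ p q T hT A B hl
      rw [h1, h2, show q.2 + w = p.2 by omega, Sym2.eq_swap]
      exact this
  have hhalf1 : ∀ x : ZMod n, s(toV n x (a₀, 0), toV n x (b₀, 0)) ∈
      cycleEdgeSet (halfWalk n a₀ b₀) := fun x =>
    ⟨((2 * x.val : ℕ) : ZMod (2 * n)), by
      rw [halfWalk_even n _ _ (by omega), halfWalk_odd n _ _ (by omega)]⟩
  have hhalf2 : ∀ x : ZMod n, s(toV n x (b₀, 0), toV n (x + 1) (a₀, 0)) ∈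
      cycleEdgeSet (halfWalk n a₀ b₀) := fun x =>
    ⟨((2 * x.val : ℕ) + 1 : ZMod (2 * n)), by
      rw [halfWalk_next n _ _ (by omega), halfWalk_odd n _ _ (by omega)]⟩
  let apc : Fin 2 × ZMod n → Fin 2 → ZMod (2 * n) → VV n :=
    fun i j => walk (2 * n) (toV n i.2) (L i.1 j)
  -- finite edges
  have hfin : ∀ (a b : Fin 4) (x y : ZMod n), a ≤ b → (a, x) ≠ (b, y) →
      (∃ i j, s((some (a, x) : VV n), some (b, y)) ∈ cycleEdgeSet (apc i j)) ∨
      s((some (a, x) : VV n), some (b, y)) ∈ cycleEdgeSet (halfWalk n a₀ b₀) := by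
    intro a b x y hle hne
    have hsome : ∀ (c : Fin 4) (z g : ZMod n) (v : ℤ), (v : ZMod n) + g = z →
        toV n g (c, v) = some (c, z) := by
      intro c z g v h
      simp [toV, c.2, h]
    have hdv : (((y - x).val : ℤ) : ZMod n) = y - x := by
      rw [Int.cast_natCast, ZMod.natCast_zmod_val]
    rcases he a b hle b.2 ((y - x).val : ℤ) (by omega)
      (by exact_mod_cast (y - x).val_lt) (by
        intro h h0
        have hab' : a = b := Fin.ext h
        rw [h0] at hdv
        push_cast at hdv
        exact hne (by rw [hab', sub_eq_zero.1 hdv.symm])) with h | ⟨w, hw, f, j, h⟩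
    · right
      rcases h with ⟨h1, h2, h3 | h3⟩ | ⟨h1, h2, h3 | h3⟩
      · rw [h3] at hdv
        have hyx : y = x := sub_eq_zero.1 (by rw [← hdv]; simp)
        have := hhalf1 x
        rw [← h1, ← h2, hsome a x x 0 (by simp), hsome b x x 0 (by simp)] at this
        rw [← h1, ← h2, hyx]; exact this
      · rw [h3] at hdv
        push_cast at hdv
        rw [ZMod.natCast_self] at hdv
        have hyx : y + 1 = x := by linear_combination -hdv
        have := hhalf2 y
        rw [← h1, ← h2, hsome a x (y + 1) 0 (by simp [hyx]), hsome b y y 0 (by simp)] at this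
        rw [← h1, ← h2, Sym2.eq_swap]; exact this
      · rw [h3] at hdv
        have hyx : y = x := sub_eq_zero.1 (by rw [← hdv]; simp)
        have := hhalf1 x
        rw [← h1, ← h2, hsome a x x 0 (by simp), hsome b x x 0 (by simp)] at this
        rw [← h1, ← h2, hyx, Sym2.eq_swap]; exact this
      · rw [h3] at hdv
        push_cast at hdv
        have hyx : x + 1 = y := by linear_combination hdv
        have := hhalf2 x
        rw [← h1, ← h2, hsome a x x 0 (by simp), hsome b y (x + 1) 0 (by simp [hyx])] at this
        rw [← h1, ← h2]
        exact this
    · left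
      obtain ⟨v, hvw⟩ := hwalk f j a b w h
      refine ⟨(f, x - (v : ZMod n)), j, ?_⟩
      have h1 := hvw (x - (v : ZMod n))
      rw [hsome a x _ _ (by ring), hsome b y _ _ (by
        push_cast
        rw [hmod _ _ hw, hdv]; ring)] at h1
      exact h1
  have hinf : ∀ (b : Fin 4) (y : ZMod n),
      ∃ i j, s((none : VV n), some (b, y)) ∈ cycleEdgeSet (apc i j) := by
    intro b y
    obtain ⟨w, f, j, h⟩ := hei b b.2
    obtain ⟨v, hvw⟩ := hwalk f j 4 b w h
    refine ⟨(f, y - ((v + w : ℤ) : ZMod n)), j, ?_⟩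
    have h1 := hvw (y - ((v + w : ℤ) : ZMod n))
    have e1 : toV n (y - ((v + w : ℤ) : ZMod n)) (4, v) = none := by simp [toV]
    have e2 : toV n (y - ((v + w : ℤ) : ZMod n)) ((b : ℕ), v + w) = some (b, y) := by
      simp [toV, b.2]
    rw [e1, e2] at h1
    exact h1
  refine arcs_of_cover (2 * n) (by omega) (V := VV n) (ι := Fin 2 × ZMod n) ?_ ?_ apc
    (halfWalk n a₀ b₀)
    ((({⟨a₀, ha₀⟩, ⟨b₀, hb₀⟩} : Finset (Fin 4)) ×ˢ (Finset.univ : Finset (ZMod n))).map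
      Function.Embedding.some) ?_ ?_ ?_ ?_
  · simp [VV, ZMod.card]; ring
  · simp [ZMod.card]
  · rw [Finset.card_map, Finset.card_product, Finset.card_pair (by simpa using hab)]
    simp [ZMod.card]
  · intro v hv'
    obtain ⟨⟨c, x⟩, hc, rfl⟩ := Finset.mem_map.1 hv'
    simp only [Finset.mem_product, Finset.mem_insert, Finset.mem_singleton, Finset.mem_univ,
      and_true] at hc
    rcases hc with rfl | rfl
    · exact ⟨_, (halfWalk_even n a₀ b₀ (by omega) x).trans (by simp [toV, ha₀])⟩
    · exact ⟨_, (halfWalk_odd n a₀ b₀ (by omega) x).trans (by simp [toV, hb₀])⟩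
  · rintro ⟨f, g⟩
    refine ⟨toV n g (mc f, mv f), ?_⟩
    intro v hne
    match v, hne with
    | none, _ =>
      obtain ⟨j, hj⟩ := hvi f
      obtain ⟨z, hz⟩ := walk_mem (2 * n) (toV n g) (L f j) (hL f j) _ (mem_of_covVs _ _ _ hj)
      exact ⟨j, z, hz.trans (by simp [toV])⟩
    | some (c, x), hne =>
      have hdv : (((x - g).val : ℤ) : ZMod n) = x - g := by
        rw [Int.cast_natCast, ZMod.natCast_zmod_val]
      rcases hv f c c.2 ((x - g).val : ℤ) (by omega) (by exact_mod_cast (x - g).val_lt) with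
        ⟨h1, h2⟩ | ⟨w, hw, j, hj⟩
      · exfalso
        apply hne
        rw [← h1, ← h2]
        have : toV n g ((c : ℕ), ((x - g).val : ℤ)) = some (c, x) := by
          unfold toV
          rw [dif_pos c.2]
          simp only [hdv]
          simp
        exact this.symm
      · obtain ⟨z, hz⟩ := walk_mem (2 * n) (toV n g) (L f j) (hL f j) _ (mem_of_covVs _ _ _ hj)
        refine ⟨j, z, hz.trans ?_⟩
        unfold toV
        rw [dif_pos c.2]
        simp only [hmod _ _ hw, hdv]
        simp
  · intro u v huv
    match u, v, huv with
    | none, none, h => exact absurd rfl h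
    | none, some (b, y), _ => exact Or.inl (hinf b y)
    | some (b, y), none, _ =>
      left
      rw [Sym2.eq_swap]; exact hinf b y
    | some (a, x), some (b, y), h =>
      have hne : (a, x) ≠ (b, y) := fun h' => h (by rw [h'])
      rcases le_total a b with hle | hle
      · exact hfin a b x y hle hne
      · rw [Sym2.eq_swap]
        exact hfin b a y x hle hne.symm


theorem shift_three {P : ℤ → Prop} (n v : ℤ) (h : P v ∨ P (v - n) ∨ P (v + n)) :
    ∃ w : ℤ, n ∣ w - v ∧ P w := by
  rcases h with h | h | h
  · exact ⟨v, by simp, h⟩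
  · exact ⟨v - n, ⟨-1, by ring⟩, h⟩
  · exact ⟨v + n, ⟨1, by ring⟩, h⟩

set_option maxHeartbeats 8000000 in
theorem family_one (u : ℕ) : HasARCS (2 * (4 * u + 9)) (2 * (2 * (4 * u + 9)) + 1) := by
  obtain ⟨t, ht⟩ : ∃ t : ℤ, t = u + 2 := ⟨_, rfl⟩
  have hN : ((4 * u + 9 : ℕ) : ℤ) = 4 * t + 1 := by push_cast; omega
  refine arcs_of_pieces (4 * u + 9) (by omega)
    ![![.zz 2 (2 * t + 1) 2 (2 * t) (u + 1), .pt 4 (0)], ![.zz 2 (2 * t + 1) 1 (2 * t - 1) (2 * u + 2), .pt 2 (2 * t)]]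
    ![
      ![
        [.zz 3 (t) 3 (3 * t - 1) (u + 1),
          .zz 3 (0) 2 (0) (u + 1),
          .pt 1 (3 * t + 1),
          .pt 0 (t),
          .zz 0 (t + 1) 0 (t - 1) (u + 1)],
        [.zz 3 (3 * t) 2 (t) (u + 1),
          .pt 3 (4 * t),
          .zz 0 (2 * t + 1) 1 (0) (u + 1),
          .zz 0 (3 * t + 1) 1 (3 * t) (u + 1),
          .zz 1 (1) 1 (2 * t) (u + 1)]],
      ![
        [.pt 2 (4 * t),
          .pt 0 (2 * t),
          .zz 1 (2 * t) 3 (2 * t - 1) (2 * u + 4)],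
        [.pt 4 (0),
          .zz 0 (2 * t + 1) 3 (4 * t - 1) (2 * u + 3),
          .zz 0 (0) 2 (2 * t - 1) (2 * u + 3)]]]
    1 2 (by norm_num) (by norm_num) (by norm_num) ?_
    ![2, 1] ![3 * t + 1, 0] ?_ ?_ ?_ ?_
  · intro f j
    fin_cases f <;> fin_cases j <;> simp [pcSize, Pc.size] <;> omega
  · intro f
    fin_cases f
    · exact ⟨1, by simp [covVs, Pc.covV]⟩
    · exact ⟨1, by simp [covVs, Pc.covV]⟩
  · intro f c hc v h0 h1
    rw [hN] at h1 ⊢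
    by_cases hm : c = ![2, 1] f ∧ v = (![3 * t + 1, 0] : Fin 2 → ℤ) f
    · exact Or.inl hm
    · refine Or.inr (shift_three _ _ ?_)
      fin_cases f <;> interval_cases c <;>
        simp [covVs, Pc.covV, Fin.exists_fin_two] at hm ⊢ <;> omega
  · intro c hc
    interval_cases c
    · exact ⟨2 * t + 1, 1, 1, by simp [covEs, Pc.covE, Dif, Pc.first, Pc.last] <;> omega⟩
    · exact ⟨t + 1, 0, 1, by simp [covEs, Pc.covE, Dif, Pc.first, Pc.last] <;> omega⟩
    · exact ⟨2 * t, 1, 1, by simp [covEs, Pc.covE, Dif, Pc.first, Pc.last] <;> omega⟩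
    · exact ⟨3 * t, 0, 1, by simp [covEs, Pc.covE, Dif, Pc.first, Pc.last] <;> omega⟩
  · intro a b hab hb d h0 h1 hne
    rw [hN] at h1 ⊢
    by_cases hh : ((a = 1 ∧ b = 2 ∧ (d = 0 ∨ d = 4 * t + 1 - 1)) ∨
        (a = 2 ∧ b = 1 ∧ (d = 0 ∨ d = 1)))
    · exact Or.inl hh
    · refine Or.inr (shift_three _ _ ?_)
      interval_cases b <;> interval_cases a <;>
        simp [covEs, Pc.covE, Dif, Pc.first, Pc.last, Fin.exists_fin_two] at hne hh ⊢ <;> omega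

set_option maxHeartbeats 8000000 in
theorem family_three (u : ℕ) : HasARCS (2 * (4 * u + 7)) (2 * (2 * (4 * u + 7)) + 1) := by
  obtain ⟨t, ht⟩ : ∃ t : ℤ, t = u + 2 := ⟨_, rfl⟩
  have hN : ((4 * u + 7 : ℕ) : ℤ) = 4 * t - 1 := by push_cast; omega
  refine arcs_of_pieces (4 * u + 7) (by omega)
    ![![.zz 3 (2) 2 (4 * t - 2) (u), .pt 2 (2 * t - 1)], ![.pt 3 (2 * t - 2), .pt 4 (0)]]
    ![
      ![
        [.pt 2 (3 * t - 1),
          .pt 4 (0),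
          .pt 0 (t),
          .zz 1 (3 * t - 1) 0 (3 * t - 1) (u + 1),
          .pt 0 (0),
          .zz 1 (2 * t) 0 (4 * t - 2) (u),
          .zz 2 (t) 2 (3 * t - 2) (u)],
        [.pt 3 (2 * t + 1),
          .zz 3 (2 * t + 2) 3 (2 * t) (u),
          .zz 3 (3 * t + 1) 2 (t - 1) (u + 1),
          .zz 1 (0) 1 (2 * t - 1) (u + 1),
          .zz 0 (t + 1) 0 (t - 1) (u)]],
      ![
        [.zz 0 (0) 2 (2 * t - 3) (2 * u + 2),
          .zz 2 (2 * t - 2) 1 (2 * t - 3) (2 * u + 2),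
          .pt 2 (4 * t - 3)],
        [.zz 3 (2 * t - 1) 0 (4 * t - 2) (2 * u + 2),
          .pt 0 (2 * t - 1),
          .zz 3 (4 * t - 2) 1 (4 * t - 4) (2 * u + 2)]]]
    3 1 (by norm_num) (by norm_num) (by norm_num) ?_
    ![3, 1] ![t + 1, 4 * t - 3] ?_ ?_ ?_ ?_
  · intro f j
    fin_cases f <;> fin_cases j <;> simp [pcSize, Pc.size] <;> omega
  · intro f
    fin_cases f
    · exact ⟨0, by simp [covVs, Pc.covV]⟩
    · exact ⟨1, by simp [covVs, Pc.covV]⟩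
  · intro f c hc v h0 h1
    rw [hN] at h1 ⊢
    by_cases hm : c = ![3, 1] f ∧ v = (![t + 1, 4 * t - 3] : Fin 2 → ℤ) f
    · exact Or.inl hm
    · refine Or.inr (shift_three _ _ ?_)
      fin_cases f <;> interval_cases c <;>
        simp [covVs, Pc.covV, Fin.exists_fin_two] at hm ⊢ <;> omega
  · intro c hc
    interval_cases c
    · exact ⟨t, 0, 0, by simp [covEs, Pc.covE, Dif, Pc.first, Pc.last] <;> omega⟩
    · exact ⟨2 * t - 2, 1, 1, by simp [covEs, Pc.covE, Dif, Pc.first, Pc.last] <;> omega⟩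
    · exact ⟨3 * t - 1, 0, 0, by simp [covEs, Pc.covE, Dif, Pc.first, Pc.last] <;> omega⟩
    · exact ⟨2 * t - 1, 1, 1, by simp [covEs, Pc.covE, Dif, Pc.first, Pc.last] <;> omega⟩
  · intro a b hab hb d h0 h1 hne
    rw [hN] at h1 ⊢
    by_cases hh : ((a = 3 ∧ b = 1 ∧ (d = 0 ∨ d = 4 * t - 1 - 1)) ∨
        (a = 1 ∧ b = 3 ∧ (d = 0 ∨ d = 1)))
    · exact Or.inl hh
    · refine Or.inr (shift_three _ _ ?_)
      interval_cases b <;> interval_cases a <;>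
        simp [covEs, Pc.covE, Dif, Pc.first, Pc.last, Fin.exists_fin_two] at hne hh ⊢ <;> omega


/-- For every `k ≥ 18` with `k ≡ 2 (mod 4)`, there exists an almost resolvable
`k`-cycle system of order `2k+1`. -/
theorem arcs_two_k_plus_one (k : ℕ) (hk : 18 ≤ k) (hk4 : k % 4 = 2) :
    HasARCS k (2 * k + 1) := by
  obtain ⟨n, rfl⟩ : ∃ n, k = 2 * n := ⟨k / 2, by omega⟩
  have h : n % 4 = 1 ∨ n % 4 = 3 := by omega
  rcases h with h | h
  · obtain ⟨u, rfl⟩ : ∃ u, n = 4 * u + 9 := ⟨(n - 9) / 4, by omega⟩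
    exact family_one u
  · obtain ⟨u, rfl⟩ : ∃ u, n = 4 * u + 7 := ⟨(n - 7) / 4, by omega⟩
    exact family_three u
end

section
/- Let k ≡ 0 (mod 2) with k ≥ 8. If there exists an almost resolvable k-cycle system of order 2k+1, then for every integer t ≥ 1 with t ≠ 2 there exists an almost resolvable k-cycle system of order 2kt+1. -/
open Function

/-- Type-flexible version of an almost resolvable cycle system, without uniqueness. -/
def FlexARC (k : ℕ) (V I J L : Type) : Prop :=
  ∃ (apc : I → J → ZMod k → V) (hpc : L → ZMod k → V),
    (∀ i, Injective (fun p : J × ZMod k => apc i p.1 p.2)) ∧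
    Injective (fun p : L × ZMod k => hpc p.1 p.2) ∧
    ∀ u v, u ≠ v → (∃ i j, s(u, v) ∈ cycleEdgeSet (apc i j)) ∨
      ∃ l, s(u, v) ∈ cycleEdgeSet (hpc l)

theorem cycleEdgeSet_comp {V W : Type} {k : ℕ} (c : ZMod k → V) (f : V → W) {u v : V}
    (h : s(u, v) ∈ cycleEdgeSet c) : s(f u, f v) ∈ cycleEdgeSet (fun i => f (c i)) := by
  obtain ⟨i, hi⟩ := h
  refine ⟨i, ?_⟩
  have := congrArg (Sym2.map f) hi
  simpa using this

theorem FlexARC.of_equiv {k : ℕ} {V I J L V' I' J' L' : Type} (eV : V ≃ V') (eI : I ≃ I')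
    (eJ : J ≃ J') (eL : L ≃ L') (h : FlexARC k V I J L) : FlexARC k V' I' J' L' := by
  obtain ⟨apc, hpc, h1, h2, h3⟩ := h
  refine ⟨fun i j x => eV (apc (eI.symm i) (eJ.symm j) x), fun l x => eV (hpc (eL.symm l) x),
    ?_, ?_, ?_⟩
  · rintro i ⟨j, x⟩ ⟨j', x'⟩ hh
    have := @h1 (eI.symm i) (eJ.symm j, x) (eJ.symm j', x') (eV.injective hh)
    simpa using this
  · rintro ⟨j, x⟩ ⟨j', x'⟩ hh
    have := @h2 (eL.symm j, x) (eL.symm j', x') (eV.injective hh)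
    simpa using this
  · intro u v huv
    rcases h3 (eV.symm u) (eV.symm v) (by simpa using huv) with ⟨i, j, h⟩ | ⟨l, h⟩
    · left
      refine ⟨eI i, eJ j, ?_⟩
      have := cycleEdgeSet_comp _ eV h
      simpa using this
    · right
      refine ⟨eL l, ?_⟩
      have := cycleEdgeSet_comp _ eV h
      simpa using this

theorem flexARC_of_hasARCS {k v : ℕ} (h : HasARCS k v) :
    FlexARC k (Fin v) (Fin ((v - 1) / 2)) (Fin ((v - 1) / k)) (Fin ((v - 1) / (2 * k))) := by
  obtain ⟨apc, hpc, h1, h2, h3, h4, h5⟩ := h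
  refine ⟨apc, hpc, ?_, ?_, ?_⟩
  · rintro i ⟨j, x⟩ ⟨j', x'⟩ hh
    by_cases hj : j = j'
    · subst hj
      have := h1 i j hh
      simp at this
      simp [this]
    · exact ((Set.disjoint_left.1 (h3 i j j' hj) ⟨x, rfl⟩) ⟨x', hh.symm⟩).elim
  · rintro ⟨j, x⟩ ⟨j', x'⟩ hh
    by_cases hj : j = j'
    · subst hj
      have := h2 j hh
      simp at this
      simp [this]
    · exact ((Set.disjoint_left.1 (h4 j j' hj) ⟨x, rfl⟩) ⟨x', hh.symm⟩).elim
  · intro u w huw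
    obtain ⟨p, hp, -⟩ := h5 s(u, w) (by simpa using huw)
    rcases p with p | p
    · exact Or.inl ⟨p.1, p.2, hp⟩
    · exact Or.inr ⟨p, hp⟩

theorem hasARCS_of_flexARC {k t v : ℕ} (hv : v = 2 * k * t + 1) (hk : 8 ≤ k)
    (h : FlexARC k (Fin v) (Fin ((v - 1) / 2))
      (Fin ((v - 1) / k)) (Fin ((v - 1) / (2 * k)))) :
    HasARCS k v := by
  have : NeZero k := ⟨by omega⟩
  have : Fact (1 < k) := ⟨by omega⟩
  obtain ⟨apc, hpc, h1, h2, h3⟩ := h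
  have i1 : ∀ i j, Injective (apc i j) := by
    intro i j x y hxy
    have := @h1 i (j, x) (j, y) hxy
    simpa using this
  have i2 : ∀ j, Injective (hpc j) := by
    intro j x y hxy
    have := @h2 (j, x) (j, y) hxy
    simpa using this
  refine ⟨apc, hpc, i1, i2, ?_, ?_, ?_⟩
  · intro i j₁ j₂ hj
    rw [Set.disjoint_left]
    rintro _ ⟨x, rfl⟩ ⟨y, hy⟩
    have := @h1 i (j₂, y) (j₁, x) hy
    simp at this
    exact hj this.1.symm
  · intro j₁ j₂ hj
    rw [Set.disjoint_left]
    rintro _ ⟨x, rfl⟩ ⟨y, hy⟩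
    have := @h2 (j₂, y) (j₁, x) hy
    simp at this
    exact hj this.1.symm
  · let cyc : (Fin ((v - 1) / 2) × Fin ((v - 1) / k)) ⊕ Fin ((v - 1) / (2 * k)) → ZMod k → Fin v :=
      Sum.elim (fun q => apc q.1 q.2) hpc
    have hcyc : ∀ p, Injective (cyc p) := by
      rintro (p | p)
      · exact i1 _ _
      · exact i2 _
    have hset : ∀ p, Sum.elim (fun q => cycleEdgeSet (apc q.1 q.2))
        (fun j => cycleEdgeSet (hpc j)) p = cycleEdgeSet (cyc p) := by
      rintro (p | p) <;> rfl
    simp only [hset]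
    let F : ((Fin ((v - 1) / 2) × Fin ((v - 1) / k)) ⊕ Fin ((v - 1) / (2 * k))) × ZMod k →
        {e : Sym2 (Fin v) // ¬ e.IsDiag} := fun p => ⟨s(cyc p.1 p.2, cyc p.1 (p.2 + 1)), by
          simp only [Sym2.mk_isDiag_iff]
          intro hh
          have := hcyc _ hh
          simp at this⟩
    have hsurj : Surjective F := by
      rintro ⟨e, he⟩
      induction e using Sym2.ind with
      | _ x y =>
        rcases h3 x y (by simpa using he) with ⟨i, j, a, ha⟩ | ⟨l, a, ha⟩
        · exact ⟨(Sum.inl (i, j), a), Subtype.ext ha.symm⟩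
        · exact ⟨(Sum.inr l, a), Subtype.ext ha.symm⟩
    have hcard : Fintype.card (((Fin ((v - 1) / 2) × Fin ((v - 1) / k)) ⊕
        Fin ((v - 1) / (2 * k))) × ZMod k) = Fintype.card {e : Sym2 (Fin v) // ¬ e.IsDiag} := by
      rw [Sym2.card_subtype_not_diag]
      simp only [Fintype.card_prod, Fintype.card_sum, Fintype.card_fin, ZMod.card]
      have e1 : (v - 1) / 2 = k * t := by
        rw [hv, Nat.add_sub_cancel, mul_assoc, Nat.mul_div_cancel_left _ (by omega)]
      have e2 : (v - 1) / k = 2 * t := by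
        rw [hv, Nat.add_sub_cancel, mul_comm 2 k, mul_assoc, Nat.mul_div_cancel_left _ (by omega)]
      have e3 : (v - 1) / (2 * k) = t := by
        rw [hv, Nat.add_sub_cancel, Nat.mul_div_cancel_left _ (by omega)]
      rw [e1, e2, e3, Nat.choose_two_right, hv, Nat.add_sub_cancel]
      symm
      apply Nat.div_eq_of_eq_mul_left (by omega)
      ring
    have hinj : Injective F := ((Fintype.bijective_iff_surjective_and_card F).2 ⟨hsurj, hcard⟩).1
    intro e he
    obtain ⟨⟨p, a⟩, hp⟩ := hsurj ⟨e, he⟩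
    refine ⟨p, ⟨a, (congrArg Subtype.val hp).symm⟩, ?_⟩
    rintro p' ⟨a', ha'⟩
    have : F (p', a') = F (p, a) := by
      rw [hp]; exact Subtype.ext ha'.symm
    exact congrArg Prod.fst (hinj this)

/-- An even-cycle frame of type `2^t`: for every group `j` a 2-factor of the remaining
half-parts, 2-coloured by `α` and `β`. -/
def EvenFrame (P : Type) : Prop :=
  ∃ (α β : P → P → P × ZMod 2) (τ : P → Equiv.Perm P),
    (∀ j, τ j j = j) ∧
    (∀ j a, a ≠ j → (α j a).1 ≠ j ∧ (β j a).1 ≠ j) ∧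
    (∀ j a b, a ≠ j → b ≠ j → α j a = α j b → a = b) ∧
    (∀ j a b, a ≠ j → b ≠ j → β j a = β j b → a = b) ∧
    (∀ j a b, a ≠ j → b ≠ j → α j a ≠ β j b) ∧
    ∀ u v : P × ZMod 2, u.1 ≠ v.1 → ∃ j a, a ≠ j ∧
      (s(u, v) = s(α j a, β j a) ∨ s(u, v) = s(α j a, β j (τ j a)))

theorem exists_parity (q : ℕ) (hq : 4 ≤ q) : ∃ p : ZMod q → ZMod 2, p 0 = 0 ∧
    ∀ i, i ≠ 0 → i ≠ 1 → p (i + 1) = p i + 1 := by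
  have : NeZero q := ⟨by omega⟩
  have : Fact (1 < q) := ⟨by omega⟩
  refine ⟨fun i => if i = 0 then 0 else (i.val : ZMod 2) + q, by simp, ?_⟩
  intro i h0 h1
  simp only [h0, if_false]
  by_cases h : i.val + 1 < q
  · have hv : (i + 1).val = i.val + 1 := by
      rw [ZMod.val_add_of_lt, ZMod.val_one]
      rwa [ZMod.val_one]
    have : i + 1 ≠ 0 := by
      intro hh
      rw [hh] at hv
      simp at hv
    rw [if_neg this, hv]
    push_cast
    ring
  · have hv : i.val + 1 = q := by have := i.val_lt; omega
    have h2 : i + 1 = 0 := by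
      have : ((i.val + 1 : ℕ) : ZMod q) = 0 := by rw [hv]; simp
      simpa using this
    rw [if_pos h2]
    have : ((i.val : ZMod 2)) + 1 = q := by exact_mod_cast congrArg (Nat.cast (R := ZMod 2)) hv
    rw [← this]
    generalize (i.val : ZMod 2) = z
    revert z; decide

theorem exists_zigzag (q : ℕ) (hq : 4 ≤ q) : ∃ e : ZMod q × Bool ≃ ZMod (2 * q),
    (∀ i, e (i, true) = e (i, false) + 1) ∧ (∀ i, e (i + 1, false) = e (i, true) + 1) := by
  have : NeZero q := ⟨by omega⟩
  have : NeZero (2 * q) := ⟨by omega⟩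
  have : Fact (1 < q) := ⟨by omega⟩
  let f : ZMod q × Bool → ZMod (2 * q) := fun p =>
    ((2 * p.1.val + (if p.2 then 1 else 0) : ℕ) : ZMod (2 * q))
  have hf : Injective f := by
    rintro ⟨i, b⟩ ⟨i', b'⟩ h
    have hi := i.val_lt
    have hi' := i'.val_lt
    have h' := congrArg ZMod.val h
    simp only [f] at h'
    rw [ZMod.val_natCast_of_lt (by split_ifs <;> omega),
      ZMod.val_natCast_of_lt (by split_ifs <;> omega)] at h'
    have hv : i.val = i'.val := by split_ifs at h' <;> omega
    have hb : b = b' := by cases b <;> cases b' <;> simp at h' ⊢ <;> omega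
    rw [ZMod.val_injective q hv, hb]
  have hbij : Bijective f := (Fintype.bijective_iff_injective_and_card f).2 ⟨hf, by
    simp [ZMod.card, mul_comm]⟩
  refine ⟨Equiv.ofBijective f hbij, ?_, ?_⟩
  · intro i
    simp [f]
  · intro i
    simp only [Equiv.ofBijective_apply, f]
    by_cases h : i.val + 1 < q
    · have hv : (i + 1).val = i.val + 1 := by
        rw [ZMod.val_add_of_lt, ZMod.val_one]
        rwa [ZMod.val_one]
      rw [hv]
      simp
      ring
    · have hv : i.val + 1 = q := by have := i.val_lt; omega
      have h2 : i + 1 = 0 := by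
        have : ((i.val + 1 : ℕ) : ZMod q) = 0 := by rw [hv]; simp
        simpa using this
      rw [h2]
      have : ((2 * (i.val + 1) : ℕ) : ZMod (2 * q)) = 0 := by rw [hv]; simp
      simp at this ⊢
      linear_combination -this

theorem exists_pos (n : ℕ) (hn : n % 2 = 1) (hn3 : 3 ≤ n) :
    ∃ pos : ZMod n → Prop, (∀ d, d ≠ 0 → (pos (-d) ↔ ¬ pos d)) ∧ pos 1 := by
  have : NeZero n := ⟨by omega⟩
  have : Fact (1 < n) := ⟨by omega⟩
  refine ⟨fun d => 2 * d.val < n, ?_, ?_⟩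
  · intro d hd
    have : NeZero d := ⟨hd⟩
    have := d.val_lt
    have h0 : d.val ≠ 0 := by simpa using hd
    simp only [ZMod.val_neg_of_ne_zero]
    omega
  · simp only [ZMod.val_one]
    omega

theorem exists_half (n : ℕ) (hn : n % 2 = 1) : ∃ h : ZMod n, 2 * h = 1 := by
  refine ⟨((n + 1) / 2 : ℕ), ?_⟩
  have : 2 * ((n + 1) / 2) = n + 1 := by omega
  have := congrArg (Nat.cast (R := ZMod n)) this
  push_cast at this
  rw [this]; simp

theorem zmod_two_cases (x : ZMod 2) : x = 0 ∨ x = 1 := by revert x; decide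

theorem evenFrame_odd {R : Type} [CommRing R] (h : R) (hh : 2 * h = 1) (pos : R → Prop)
    (hpos : ∀ d, d ≠ 0 → (pos (-d) ↔ ¬ pos d)) : EvenFrame R := by
  classical
  have hneg : ∀ j a : R, a ≠ j → (pos (2 * j - a - j) ↔ ¬ pos (a - j)) := by
    intro j a ha
    rw [← hpos _ (sub_ne_zero.2 ha)]
    ring_nf
  have hrefl : ∀ j a : R, a ≠ j → 2 * j - a ≠ j := by
    intro j a ha h1
    apply ha
    linear_combination -h1
  refine ⟨fun j a => if pos (a - j) then (a, 0) else (2 * j - a, 1),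
    fun j a => if pos (a - j) then (2 * j - a, 0) else (a, 1),
    fun j => Equiv.subLeft (2 * j), ?_, ?_, ?_, ?_, ?_, ?_⟩
  · intro j
    simp
    ring
  · intro j a ha
    have := hrefl j a ha
    dsimp only
    split_ifs <;> exact ⟨by assumption, by assumption⟩
  · intro j a b ha hb
    dsimp only
    split_ifs <;> simp
  · intro j a b ha hb
    dsimp only
    split_ifs <;> simp
  · intro j a b ha hb
    dsimp only
    split_ifs with h1 h2 h2 <;> simp
    · rintro rfl
      exact (hneg j b hb).1 h1 h2
    · rintro rfl
      exact h2 ((hneg j a ha).2 h1)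
  · have key : ∀ (p r : R) (φ ψ : ZMod 2), p ≠ r → pos (p - h * (p + r)) → ∃ j a, a ≠ j ∧
      (s((p, φ), (r, ψ)) = s((fun j a => if pos (a - j) then (a, (0 : ZMod 2)) else (2 * j - a, 1)) j a,
        (fun j a => if pos (a - j) then (2 * j - a, (0 : ZMod 2)) else (a, 1)) j a) ∨
       s((p, φ), (r, ψ)) = s((fun j a => if pos (a - j) then (a, (0 : ZMod 2)) else (2 * j - a, 1)) j a,
        (fun j a => if pos (a - j) then (2 * j - a, (0 : ZMod 2)) else (a, 1)) j
          (Equiv.subLeft (2 * j) a))) := by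
      intro p r φ ψ hpr hp
      have e1 : 2 * (h * (p + r)) - p = r := by linear_combination (p + r) * hh
      have e2 : 2 * (h * (p + r)) - r = p := by linear_combination (p + r) * hh
      have hpj : p ≠ h * (p + r) := by
        intro h1
        apply hpr
        linear_combination 2 * h1 + e1
      have hrj : r ≠ h * (p + r) := by
        intro h1
        apply hpr
        linear_combination -e2 - 2 * h1
      have hr : ¬ pos (r - h * (p + r)) := by
        rw [← e1]
        rw [e1]
        intro h1
        have := hneg (h * (p + r)) p hpj
        rw [e1] at this
        exact this.1 h1 hp
      refine ⟨h * (p + r), ?_⟩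
      rcases zmod_two_cases φ with rfl | rfl
      · refine ⟨p, hpj, ?_⟩
        rcases zmod_two_cases ψ with rfl | rfl
        · left; simp [hp, e1]
        · right; simp [hp, e1, hr]
      · refine ⟨r, hrj, ?_⟩
        rcases zmod_two_cases ψ with rfl | rfl
        · right; simp [hp, e2, e1, hr]
        · left; simp [hr, e2]
    rintro ⟨p, φ⟩ ⟨r, ψ⟩ hpr
    by_cases hp : pos (p - h * (p + r))
    · exact key p r φ ψ hpr hp
    · rw [Sym2.eq_swap]
      apply key r p ψ φ (Ne.symm hpr)
      have hpj : p ≠ h * (p + r) := by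
        intro h1
        apply hpr
        linear_combination 2 * h1 + (p + r) * hh
      have := hpos _ (sub_ne_zero.2 hpj)
      have e : -(p - h * (p + r)) = r - h * (r + p) := by
        linear_combination (p + r) * hh
      rw [e] at this
      exact this.2 hp

/-- colour class `α` of the frame on `Option R`. -/
noncomputable def alphaE {R : Type} [CommRing R] (pos : R → Prop) :
    Option R → Option R → Option R × ZMod 2
  | none, none => (none, 0)
  | none, some x => (some x, 0)
  | some _, none => (none, 0)
  | some j, some a => open Classical in
      if a = j - 1 then (some (j - 1), 1) else
      if pos (a - j) then (some a, 0) else (some (2 * j - a), 1)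

/-- colour class `β` of the frame on `Option R`. -/
noncomputable def betaE {R : Type} [CommRing R] (pos : R → Prop) :
    Option R → Option R → Option R × ZMod 2
  | none, none => (none, 0)
  | none, some x => (some (x - 2), 1)
  | some j, none => (some (j + 1), 1)
  | some j, some a => open Classical in
      if a = j - 1 then (none, 1) else
      if pos (a - j) then (some (2 * j - a), 0) else (some a, 1)

/-- the shifts of the frame on `Option R`. -/
noncomputable def tauE {R : Type} [CommRing R] : Option R → Equiv.Perm (Option R)
  | none => Equiv.optionCongr (Equiv.addRight 4)
  | some j => open Classical in
      (Equiv.optionCongr (Equiv.subLeft (2 * j))).trans (Equiv.swap (some (j + 1)) none)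

theorem evenFrame_even {R : Type} [CommRing R] [Nontrivial R] (h : R) (hh : 2 * h = 1)
    (pos : R → Prop) (hpos : ∀ d, d ≠ 0 → (pos (-d) ↔ ¬ pos d)) (h1 : pos 1) :
    EvenFrame (Option R) := by
  classical
  have hneg : ∀ j a : R, a ≠ j → (pos (2 * j - a - j) ↔ ¬ pos (a - j)) := by
    intro j a ha
    rw [← hpos _ (sub_ne_zero.2 ha)]
    ring_nf
  have hrefl : ∀ j a : R, a ≠ j → 2 * j - a ≠ j := by
    intro j a ha h1
    apply ha
    linear_combination -h1
  have hm1 : ¬ pos (-1) := by rw [hpos 1 one_ne_zero]; simpa using h1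
  have h2 : (2 : R) ≠ 0 := by
    intro h0
    rw [h0, zero_mul] at hh
    exact zero_ne_one hh
  have hx : ∀ j : R, j + 1 ≠ j - 1 := by
    intro j h0
    apply h2
    linear_combination h0
  have hx' : ∀ j : R, j - 1 ≠ j + 1 := fun j => (hx j).symm
  have hp1 : ∀ j : R, pos (j + 1 - j) := by intro j; simpa using h1
  have hpm1 : ∀ j : R, ¬ pos (j - 1 - j) := by intro j; simpa using hm1
  refine ⟨alphaE pos, betaE pos, tauE, ?_, ?_, ?_, ?_, ?_, ?_⟩
  · rintro (_ | j)
    · simp [tauE]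
    · simp only [tauE, Equiv.trans_apply, Equiv.optionCongr_apply, Option.map_some,
        Equiv.subLeft_apply]
      rw [show 2 * j - j = j by ring]
      rw [Equiv.swap_apply_of_ne_of_ne] <;> simp
  · rintro (_ | j) (_ | a) ha
    · simp at ha
    · simp [alphaE, betaE]
    · simp [alphaE, betaE]
    · have ha' : a ≠ j := by simpa using ha
      have := hrefl j a ha'
      simp only [alphaE, betaE]
      split_ifs <;> simp [*]
  · rintro (_ | j) (_ | a) (_ | b) ha hb
    · simp
    · simp at ha
    · simp at hb
    · simp [alphaE]
    · simp
    · simp only [alphaE]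
      split_ifs <;> simp
    · simp only [alphaE]
      split_ifs <;> simp
    · simp only [alphaE]
      have ha' : a ≠ j := by simpa using ha
      have hb' : b ≠ j := by simpa using hb
      split_ifs with c1 c2 c3 c4 c5 c6 c7 <;> simp
      · rw [c1, c2]
      · intro e
        have : b = j + 1 := by linear_combination e
        exact absurd (hp1 j) (this ▸ c3)
      · intro e
        have : a = j + 1 := by linear_combination -e
        exact absurd (hp1 j) (this ▸ c4)
  · rintro (_ | j) (_ | a) (_ | b) ha hb
    · simp
    · simp at ha
    · simp at hb
    · simp [betaE]
    · simp
    · simp only [betaE]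
      split_ifs with c1 c2 <;> simp
      rintro rfl
      exact c2 (hp1 j)
    · simp only [betaE]
      split_ifs with c1 c2 <;> simp
      rintro rfl
      exact c2 (hp1 j)
    · simp only [betaE]
      split_ifs with c1 c2 c3 c4 c5 c6 c7 <;> simp
      rw [c1, c2]
  · rintro (_ | j) (_ | a) (_ | b) ha hb
    · simp at ha
    · simp at ha
    · simp at hb
    · simp [alphaE, betaE]
    · simp [alphaE, betaE]
    · simp only [alphaE, betaE]
      split_ifs <;> simp
    · simp only [alphaE, betaE]
      split_ifs with c1 c2 <;> simp
      · exact hx' j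
      · intro e
        apply c1
        linear_combination -e
    · simp only [alphaE, betaE]
      have ha' : a ≠ j := by simpa using ha
      have hb' : b ≠ j := by simpa using hb
      split_ifs with c1 c2 c3 c4 c5 c6 c7 c8 <;> simp
      · exact fun e => c2 e.symm
      · rintro rfl
        exact (hneg j b hb').1 c4 c6
      · rintro rfl
        exact c8 ((hneg j a ha').2 c4)
  · have taux : ∀ j : R, tauE (some j) (some (j + 1)) = some (j - 1) := by
      intro j
      simp only [tauE, Equiv.trans_apply, Equiv.optionCongr_apply, Option.map_some,
        Equiv.subLeft_apply]
      rw [show 2 * j - (j + 1) = j - 1 by ring]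
      rw [Equiv.swap_apply_of_ne_of_ne] <;> simp [hx' j]
    have tauy : ∀ j : R, tauE (some j) (some (j - 1)) = none := by
      intro j
      simp only [tauE, Equiv.trans_apply, Equiv.optionCongr_apply, Option.map_some,
        Equiv.subLeft_apply]
      rw [show 2 * j - (j - 1) = j + 1 by ring]
      simp
    have taun : ∀ j : R, tauE (some j) none = some (j + 1) := by
      intro j
      simp [tauE]
    have taug : ∀ j a : R, 2 * j - a ≠ j + 1 → tauE (some j) (some a) = some (2 * j - a) := by
      intro j a hja
      simp only [tauE, Equiv.trans_apply, Equiv.optionCongr_apply, Option.map_some,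
        Equiv.subLeft_apply]
      rw [Equiv.swap_apply_of_ne_of_ne] <;> simp [hja]
    have keyN : ∀ (x : R) (φ ψ : ZMod 2), ∃ j a, a ≠ j ∧
        (s((none, φ), (some x, ψ)) = s(alphaE pos j a, betaE pos j a) ∨
         s((none, φ), (some x, ψ)) = s(alphaE pos j a, betaE pos j (tauE j a))) := by
      intro x φ ψ
      rcases zmod_two_cases φ with rfl | rfl <;> rcases zmod_two_cases ψ with rfl | rfl
      · refine ⟨some (x + 1), none, by simp, Or.inr ?_⟩
        have e3 : (x + 1 + 1 : R) ≠ x := by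
          intro e
          apply h2
          linear_combination e
        have e4 : 2 * (x + 1) - (x + 1 + 1) = x := by ring
        simp [alphaE, betaE, taun, h1, e3, e4]
      · refine ⟨some (x - 1), none, by simp, Or.inl ?_⟩
        simp [alphaE, betaE]
      · have e5 : ¬ x = x - 1 := by
          intro e
          apply one_ne_zero (α := R)
          linear_combination e
        refine ⟨some (x - 1), some (x - 1 + 1), by simp [e5], Or.inr ?_⟩
        rw [taux]
        have e3 : ¬ x = x - 1 - 1 := by
          intro e
          apply h2
          linear_combination e
        simp [alphaE, betaE, h1, e3]
      · refine ⟨some (x + 1), some (x + 1 - 1), by simp, Or.inl ?_⟩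
        simp [alphaE, betaE]
    have key2 : ∀ (r : R) (φ ψ : ZMod 2), ∃ j a, a ≠ j ∧
        (s((some (r + 1), φ), (some (r - 1), ψ)) = s(alphaE pos j a, betaE pos j a) ∨
         s((some (r + 1), φ), (some (r - 1), ψ)) = s(alphaE pos j a, betaE pos j (tauE j a))) := by
      intro r φ ψ
      rcases zmod_two_cases φ with rfl | rfl <;> rcases zmod_two_cases ψ with rfl | rfl
      · refine ⟨some r, some (r + 1), by simp, Or.inl ?_⟩
        simp [alphaE, betaE, hx, h1]
        left
        ring
      · refine ⟨none, some (r + 1), by simp, Or.inl ?_⟩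
        simp [alphaE, betaE]
        ring
      · refine ⟨none, some (r - 1), by simp, Or.inr ?_⟩
        simp [alphaE, betaE, tauE]
        ring
      · refine ⟨some r, some (r - 1), by simp, Or.inr ?_⟩
        rw [tauy]
        simp [alphaE, betaE]
    have keyG : ∀ (p r : R) (φ ψ : ZMod 2), p ≠ r → pos (p - h * (p + r)) → ∃ j a, a ≠ j ∧
        (s((some p, φ), (some r, ψ)) = s(alphaE pos j a, betaE pos j a) ∨
         s((some p, φ), (some r, ψ)) = s(alphaE pos j a, betaE pos j (tauE j a))) := by
      intro p r φ ψ hpr hp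
      have e1 : 2 * (h * (p + r)) - p = r := by linear_combination (p + r) * hh
      have e2 : 2 * (h * (p + r)) - r = p := by linear_combination (p + r) * hh
      have hpj : p ≠ h * (p + r) := by
        intro h1
        apply hpr
        linear_combination 2 * h1 + e1
      have hrj : r ≠ h * (p + r) := by
        intro h1
        apply hpr
        linear_combination -e2 - 2 * h1
      have hr : ¬ pos (r - h * (p + r)) := by
        intro h1
        have := hneg (h * (p + r)) p hpj
        rw [e1] at this
        exact this.1 h1 hp
      by_cases hs : p = h * (p + r) + 1
      · have hr' : r = h * (p + r) - 1 := by
          linear_combination -e1 - hs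
        have := key2 (h * (p + r)) φ ψ
        rwa [← hs, ← hr'] at this
      have hs' : r ≠ h * (p + r) - 1 := by
        intro e
        apply hs
        linear_combination -e2 - e
      have hpm : p ≠ h * (p + r) - 1 := by
        intro e
        apply hpm1 (h * (p + r))
        rwa [← e]
      have hrm : r ≠ h * (p + r) + 1 := by
        intro e
        apply hr
        have := hp1 (h * (p + r))
        rwa [← e] at this
      have t1 : tauE (some (h * (p + r))) (some p) = some r := by
        rw [taug, e1]
        rwa [e1]
      have t2 : tauE (some (h * (p + r))) (some r) = some p := by
        rw [taug, e2]
        rwa [e2]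
      refine ⟨some (h * (p + r)), ?_⟩
      rcases zmod_two_cases φ with rfl | rfl
      · refine ⟨some p, by simpa using hpj, ?_⟩
        rcases zmod_two_cases ψ with rfl | rfl
        · left; simp only [alphaE, betaE, if_neg hpm, if_pos hp, e1]
        · right; simp only [t1, alphaE, betaE, if_neg hpm, if_pos hp, if_neg hs', if_neg hr]
      · refine ⟨some r, by simpa using hrj, ?_⟩
        rcases zmod_two_cases ψ with rfl | rfl
        · right; simp only [t2, alphaE, betaE, if_neg hpm, if_pos hp, if_neg hs', if_neg hr, e1, e2]
        · left; simp only [alphaE, betaE, if_neg hs', if_neg hr, e2]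
    rintro ⟨_ | p, φ⟩ ⟨_ | r, ψ⟩ hpr
    · simp at hpr
    · exact keyN r φ ψ
    · rw [Sym2.eq_swap]
      exact keyN p ψ φ
    · have hpr' : p ≠ r := by simpa using hpr
      by_cases hp : pos (p - h * (p + r))
      · exact keyG p r φ ψ hpr' hp
      · rw [Sym2.eq_swap]
        apply keyG r p ψ φ hpr'.symm
        have hpj : p ≠ h * (p + r) := by
          intro h1
          apply hpr'
          linear_combination 2 * h1 + (p + r) * hh
        have := hpos _ (sub_ne_zero.2 hpj)
        have e : -(p - h * (p + r)) = r - h * (r + p) := by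
          linear_combination (p + r) * hh
        rw [e] at this
        exact this.2 hp

/-- vertices of the big system. -/
abbrev BigV (P : Type) (q : ℕ) : Type := Option ((P × ZMod 2) × (ZMod 2 × ZMod q))

/-- vertices of the small system. -/
abbrev SmallV (q : ℕ) : Type := Option (ZMod 2 × (ZMod 2 × ZMod q))

/-- embedding of the small system at the group `j`. -/
def embV {P : Type} {q : ℕ} (j : P) : SmallV q → BigV P q :=
  Option.map (fun h => ((j, h.1), h.2))

theorem embV_inj {P : Type} {q : ℕ} (j : P) : Injective (embV (q := q) j) := by
  apply Option.map_injective
  rintro ⟨a, b⟩ ⟨c, d⟩ h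
  simpa using h

open Classical in
/-- The vertex `(i, side)` of the frame cycle with parameters `ε x φ a` (in a fixed group). -/
noncomputable def fcyc {P : Type} {q : ℕ} (p : ZMod q → ZMod 2) (α β : P → P × ZMod 2)
    (τ : Equiv.Perm P) (c : ZMod 2 × ZMod q) (φ : ZMod 2) (a : P) :
    ZMod q × Bool → (P × ZMod 2) × (ZMod 2 × ZMod q)
  | (i, true) => if i = 0 ∨ i = 1 then (α a, (φ + c.1, i)) else
      (α (if c.1 = 0 then a else τ.symm a), (φ, i))
  | (i, false) => if i = 1 then (β (τ a), (φ, i + c.2)) else (β a, (φ + p i, i + c.2))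

theorem flexARC_main {P : Type} (hP : EvenFrame P) (q : ℕ) (hq : 4 ≤ q)
    (h : FlexARC (2 * q) (SmallV q) (ZMod 2 × ZMod q) (ZMod 2) Unit) :
    FlexARC (2 * q) (BigV P q) (P × (ZMod 2 × ZMod q)) (ZMod 2 × P) P := by
  classical
  have : NeZero q := ⟨by omega⟩
  have : NeZero (2 * q) := ⟨by omega⟩
  have : Fact (1 < q) := ⟨by omega⟩
  -- make the short class miss the point at infinity
  obtain ⟨apc, hpc, g1, g2, g3, g4⟩ : ∃ (apc : ZMod 2 × ZMod q → ZMod 2 → ZMod (2 * q) → SmallV q)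
      (hpc : Unit → ZMod (2 * q) → SmallV q),
      (∀ i, Injective (fun p : ZMod 2 × ZMod (2 * q) => apc i p.1 p.2)) ∧
      Injective (fun p : Unit × ZMod (2 * q) => hpc p.1 p.2) ∧
      (∀ u v, u ≠ v → (∃ i j, s(u, v) ∈ cycleEdgeSet (apc i j)) ∨
        ∃ l, s(u, v) ∈ cycleEdgeSet (hpc l)) ∧ ∀ x, hpc () x ≠ none := by
    obtain ⟨apc, hpc, h1, h2, h3⟩ := h
    have hns : ¬ Surjective (hpc ()) := by
      intro hs
      have := Fintype.card_le_of_surjective _ hs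
      simp [ZMod.card] at this
      omega
    simp only [Surjective, not_forall, not_exists] at hns
    obtain ⟨w, hw⟩ := hns
    refine ⟨fun i j x => Equiv.swap w none (apc i j x), fun l x => Equiv.swap w none (hpc l x),
      ?_, ?_, ?_, ?_⟩
    · intro i a b hab
      exact h1 i ((Equiv.injective _) hab)
    · intro a b hab
      exact h2 ((Equiv.injective _) hab)
    · intro u v huv
      rcases h3 (Equiv.swap w none u) (Equiv.swap w none v) (by simpa using huv) with
        ⟨i, j, h⟩ | ⟨l, h⟩
      · left
        refine ⟨i, j, ?_⟩
        have := cycleEdgeSet_comp _ (Equiv.swap w none) h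
        simpa using this
      · right
        refine ⟨l, ?_⟩
        have := cycleEdgeSet_comp _ (Equiv.swap w none) h
        simpa using this
    · intro x hx
      apply hw x
      apply (Equiv.swap w none).injective
      exact hx.trans (by simp)
  obtain ⟨e, he1, he2⟩ := exists_zigzag q hq
  obtain ⟨p, hp0, hp⟩ := exists_parity q hq
  obtain ⟨α, β, τ, f1, f2, f3, f4, f5, f6⟩ := hP
  have hτ : ∀ j a, a ≠ j → τ j a ≠ j := by
    intro j a ha h
    exact ha ((τ j).injective (h.trans (f1 j).symm))
  have hτ' : ∀ j a, a ≠ j → (τ j).symm a ≠ j := by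
    intro j a ha h
    apply ha
    have := congrArg (τ j) h
    simpa [f1] using this
  have hα' : ∀ j a (c : ZMod 2), a ≠ j → (if c = 0 then a else (τ j).symm a) ≠ j := by
    intro j a c ha
    split_ifs
    · exact ha
    · exact hτ' j a ha
  have h10 : (1 : ZMod q) ≠ 0 := one_ne_zero
  -- the frame cycles avoid the group
  have havoid : ∀ j c φ a y, a ≠ j → (fcyc p (α j) (β j) (τ j) c φ a y).1.1 ≠ j := by
    rintro j c φ a ⟨i, b⟩ ha
    cases b <;> simp only [fcyc] <;> split_ifs
    · exact (f2 j _ (hτ j a ha)).2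
    · exact (f2 j _ ha).2
    · exact (f2 j _ ha).1
    · exact (f2 j _ ha).1
    · exact (f2 j _ (hτ' j a ha)).1
  have hfinj : ∀ j c φ a y φ' a' y', a ≠ j → a' ≠ j →
      fcyc p (α j) (β j) (τ j) c φ a y = fcyc p (α j) (β j) (τ j) c φ' a' y' →
      φ = φ' ∧ a = a' ∧ y = y' := by
    rintro j c φ a ⟨i, b⟩ φ' a' ⟨i', b'⟩ ha ha' h
    have hab : ∀ a b, a ≠ j → b ≠ j → β j b ≠ α j a := fun a b ha hb h => f5 j a b ha hb h.symm
    have t1 := hτ j a ha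
    have t2 := hτ j a' ha'
    have t3 := hα' j a c.1 ha
    have t4 := hα' j a' c.1 ha'
    cases b <;> cases b'
    · have hi : i = i' := by
        have h := congrArg (fun z => z.2.2) h
        simp only [fcyc] at h
        split_ifs at h <;> exact add_right_cancel h
      subst hi
      simp only [fcyc] at h
      split_ifs at h
      · simp at h
        refine ⟨h.2, (τ j).injective (f4 j _ _ t1 t2 h.1), rfl⟩
      · simp at h
        refine ⟨h.2, (f4 j _ _ ha ha' h.1), rfl⟩
    · exfalso
      have h := congrArg Prod.fst h
      simp only [fcyc] at h
      by_cases c1 : i = 1 <;> by_cases c2 : i' = 0 ∨ i' = 1 <;>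
        simp only [c1, c2, if_true, if_false] at h
      · exact hab _ _ ha' t1 h
      · exact hab _ _ t4 t1 h
      · exact hab _ _ ha' ha h
      · exact hab _ _ t4 ha h
    · exfalso
      have h := (congrArg Prod.fst h).symm
      simp only [fcyc] at h
      by_cases c1 : i' = 1 <;> by_cases c2 : i = 0 ∨ i = 1 <;>
        simp only [c1, c2, if_true, if_false] at h
      · exact hab _ _ ha t2 h
      · exact hab _ _ t3 t2 h
      · exact hab _ _ ha ha' h
      · exact hab _ _ t3 ha' h
    · have hi : i = i' := by
        have h := congrArg (fun z => z.2.2) h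
        simp only [fcyc] at h
        split_ifs at h <;> exact h
      subst hi
      simp only [fcyc] at h
      by_cases c2 : i = 0 ∨ i = 1
      · rw [if_pos c2, if_pos c2] at h
        simp at h
        exact ⟨h.2, f3 j _ _ ha ha' h.1, rfl⟩
      · rw [if_neg c2, if_neg c2] at h
        simp only [Prod.mk.injEq] at h
        have := f3 j _ _ t3 t4 h.1
        refine ⟨h.2.1, ?_, rfl⟩
        split_ifs at this
        · exact this
        · exact (τ j).symm.injective this
  refine ⟨fun jc φa l => if φa.2 = jc.1 then embV jc.1 (apc jc.2 φa.1 l) else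
      some (fcyc p (α jc.1) (β jc.1) (τ jc.1) jc.2 φa.1 φa.2 (e.symm l)),
    fun j l => embV j (hpc () l), ?_, ?_, ?_⟩
  · have hsep : ∀ (j : P) (w : SmallV q) (z : (P × ZMod 2) × (ZMod 2 × ZMod q)), z.1.1 ≠ j →
        embV j w ≠ some z := by
      rintro j w z hz h
      cases w with
      | none => simp [embV] at h
      | some w =>
        simp [embV] at h
        rw [← h] at hz
        exact hz rfl
    rintro ⟨j, c⟩ ⟨⟨φ, a⟩, l⟩ ⟨⟨φ', a'⟩, l'⟩ h
    dsimp only at h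
    split_ifs at h with c1 c2 c2
    · have := @g1 c (φ, l) (φ', l') (embV_inj j h)
      simp at this
      simp [this, c1, c2]
    · exact absurd h (hsep _ _ _ (havoid _ _ _ _ _ c2))
    · exact absurd h.symm (hsep _ _ _ (havoid _ _ _ _ _ c1))
    · obtain ⟨r1, r2, r3⟩ := hfinj _ _ _ _ _ _ _ _ c1 c2 (Option.some_injective _ h)
      simp at r3
      simp [r1, r2, r3]
  · rintro ⟨j, l⟩ ⟨j', l'⟩ h
    dsimp only at h
    obtain ⟨w, hw⟩ := Option.ne_none_iff_exists'.1 (g4 l)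
    obtain ⟨w', hw'⟩ := Option.ne_none_iff_exists'.1 (g4 l')
    have hj : j = j' := by
      rw [hw, hw'] at h
      simp [embV] at h
      exact h.1.1
    subst hj
    have := @g2 ((), l) ((), l') (embV_inj j h)
    simp at this
    simp [this]
  · -- coverage
    have hsmall : ∀ j (u v : SmallV q), u ≠ v →
        (∃ (i : P × (ZMod 2 × ZMod q)) (φa : ZMod 2 × P), s(embV j u, embV j v) ∈
          cycleEdgeSet (fun l : ZMod (2 * q) => if φa.2 = i.1 then embV i.1 (apc i.2 φa.1 l) else
      some (fcyc p (α i.1) (β i.1) (τ i.1) i.2 φa.1 φa.2 (e.symm l)))) ∨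
        ∃ l, s(embV j u, embV j v) ∈ cycleEdgeSet (fun x => embV (P := P) l (hpc () x)) := by
      intro j u v huv
      rcases g3 u v huv with ⟨c, φ, h⟩ | ⟨l, h⟩
      · left
        refine ⟨(j, c), (φ, j), ?_⟩
        have := cycleEdgeSet_comp _ (embV j) h
        simpa using this
      · right
        exact ⟨j, cycleEdgeSet_comp _ (embV j) h⟩
    have hedge : ∀ (j : P) (c : ZMod 2 × ZMod q) (φ : ZMod 2) (a : P), a ≠ j → ∀ i u v,
        u = fcyc p (α j) (β j) (τ j) c φ a (i, true) →
        (v = fcyc p (α j) (β j) (τ j) c φ a (i, false) ∨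
          v = fcyc p (α j) (β j) (τ j) c φ a (i + 1, false)) →
        ∃ (i : P × (ZMod 2 × ZMod q)) (φa : ZMod 2 × P), s(some u, some v) ∈
          cycleEdgeSet (fun l : ZMod (2 * q) => if φa.2 = i.1 then embV i.1 (apc i.2 φa.1 l) else
      some (fcyc p (α i.1) (β i.1) (τ i.1) i.2 φa.1 φa.2 (e.symm l))) := by
      intro j c φ a ha i u v hu hv
      refine ⟨(j, c), (φ, a), ?_⟩
      simp only [if_neg ha]
      rcases hv with hv | hv
      · refine ⟨e (i, false), ?_⟩
        rw [← he1]
        simp only [Equiv.symm_apply_apply]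
        rw [hu, hv, Sym2.eq_swap]
      · refine ⟨e (i, true), ?_⟩
        rw [← he2]
        simp only [Equiv.symm_apply_apply]
        rw [hu, hv]
    have h2ne0 : (1 + 1 : ZMod q) ≠ 0 := by
      intro h
      have : ((2 : ℕ) : ZMod q) = 0 := by push_cast; rw [← h]; ring
      rw [ZMod.natCast_eq_zero_iff] at this
      have := Nat.le_of_dvd (by omega) this
      omega
    have h2ne1 : (1 + 1 : ZMod q) ≠ 1 := by simp
    have haux : ∀ x y z : ZMod 2, y ≠ x + z → y = x + (z + 1) := by decide
    have haux2 : ∀ x y : ZMod 2, y = x + (y - x) := by decide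
    have h01 : (0 : ZMod q) ≠ 1 := Ne.symm h10
    -- pairs of half-parts
    have hslot : ∀ j a (b : P × ZMod 2), a ≠ j → (b = β j a ∨ b = β j (τ j a)) →
        ∀ (ψ ψ' : ZMod 2) (i y : ZMod q),
        ∃ (i' : P × (ZMod 2 × ZMod q)) (φa : ZMod 2 × P),
          s((some (α j a, (ψ, i)) : BigV P q), some (b, (ψ', y))) ∈
          cycleEdgeSet (fun l : ZMod (2 * q) => if φa.2 = i'.1 then embV i'.1 (apc i'.2 φa.1 l) else
      some (fcyc p (α i'.1) (β i'.1) (τ i'.1) i'.2 φa.1 φa.2 (e.symm l))) := by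
      rintro j a b ha hb ψ ψ' i y
      by_cases i0 : i = 0
      · subst i0
        rcases hb with rfl | rfl
        · apply hedge j (ψ - ψ', y) ψ' a ha 0
          · simp [fcyc]
          · left; simp [fcyc, h01, hp0]
        · apply hedge j (ψ - ψ', y - 1) ψ' a ha 0
          · simp [fcyc]
          · right; simp [fcyc]
      by_cases i1 : i = 1
      · subst i1
        rcases hb with rfl | rfl
        · apply hedge j (ψ - (ψ' - p (1 + 1)), y - (1 + 1)) (ψ' - p (1 + 1)) a ha 1
          · simp [fcyc]
          · right
            simp only [fcyc]
            rw [if_neg h2ne1]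
            simp
        · apply hedge j (ψ - ψ', y - 1) ψ' a ha 1
          · simp [fcyc]
          · left; simp [fcyc]
      have i2 : i + 1 ≠ 1 := by simpa using i0
      have i3 : ¬ (i = 0 ∨ i = 1) := by tauto
      by_cases hψ : ψ' = ψ + p i
      · rcases hb with rfl | rfl
        · apply hedge j (0, y - i) ψ a ha i
          · simp [fcyc, i3]
          · left; simp [fcyc, i1, hψ]
        · apply hedge j (1, y - i) ψ (τ j a) (hτ j a ha) i
          · simp [fcyc, i3]
          · left; simp [fcyc, i1, hψ]
      · have hψ2 := haux _ _ _ hψ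
        rw [← hp i i0 i1] at hψ2
        rcases hb with rfl | rfl
        · apply hedge j (0, y - (i + 1)) ψ a ha i
          · simp [fcyc, i3]
          · right
            simp only [fcyc, if_neg i2]
            rw [← hψ2]
            simp
        · apply hedge j (1, y - (i + 1)) ψ (τ j a) (hτ j a ha) i
          · simp [fcyc, i3]
          · right
            simp only [fcyc, if_neg i2]
            rw [← hψ2]
            simp
    rintro (_ | ⟨⟨pu, lu⟩, hu⟩) (_ | ⟨⟨pv, lv⟩, hv⟩) huv
    · exact absurd rfl huv
    · exact hsmall pv none (some (lv, hv)) (by simp)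
    · exact hsmall pu (some (lu, hu)) none (by simp)
    · by_cases hpp : pu = pv
      · subst hpp
        refine hsmall pu (some (lu, hu)) (some (lv, hv)) ?_
        intro h
        apply huv
        simpa using h
      · left
        obtain ⟨j, a, ha, hs⟩ := f6 (pu, lu) (pv, lv) hpp
        have hs' : ∃ b, (b = β j a ∨ b = β j (τ j a)) ∧ s((pu, lu), (pv, lv)) = s(α j a, b) := by
          rcases hs with hs | hs
          · exact ⟨_, Or.inl rfl, hs⟩
          · exact ⟨_, Or.inr rfl, hs⟩
        obtain ⟨b, hb, hs⟩ := hs'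
        rw [Sym2.eq_iff] at hs
        rcases hs with ⟨r1, r2⟩ | ⟨r1, r2⟩
        · have := hslot j a b ha hb hu.1 hv.1 hu.2 hv.2
          rw [r1, r2]
          exact this
        · have := hslot j a b ha hb hv.1 hu.1 hv.2 hu.2
          rw [r1, r2, Sym2.eq_swap]
          exact this

theorem exists_evenFrame (t : ℕ) (ht : 3 ≤ t) :
    ∃ (P : Type) (_ : Fintype P), Fintype.card P = t ∧ EvenFrame P := by
  rcases Nat.mod_two_eq_zero_or_one t with h0 | h0
  · have h1 : (t - 1) % 2 = 1 := by omega
    have : NeZero (t - 1) := ⟨by omega⟩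
    have : Fact (1 < t - 1) := ⟨by omega⟩
    obtain ⟨h, hh⟩ := exists_half (t - 1) h1
    obtain ⟨pos, hpos, hp1⟩ := exists_pos (t - 1) h1 (by omega)
    refine ⟨Option (ZMod (t - 1)), inferInstance, ?_, evenFrame_even h hh pos hpos hp1⟩
    simp [ZMod.card]
    omega
  · have : NeZero t := ⟨by omega⟩
    obtain ⟨h, hh⟩ := exists_half t h0
    obtain ⟨pos, hpos, hp1⟩ := exists_pos t h0 (by omega)
    exact ⟨ZMod t, inferInstance, by simp [ZMod.card], evenFrame_odd h hh pos hpos⟩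

/-- Let `k` be even with `k ≥ 8`. If there exists an almost resolvable `k`-cycle
system of order `2k+1`, then for every `t ≥ 1` with `t ≠ 2` there exists an almost
resolvable `k`-cycle system of order `2kt+1`. -/
theorem arcs_recursive (k : ℕ) (hk2 : k % 2 = 0) (hk : 8 ≤ k)
    (h : HasARCS k (2 * k + 1)) :
    ∀ t : ℕ, 1 ≤ t → t ≠ 2 → HasARCS k (2 * k * t + 1) := by
  intro t ht1 ht2
  by_cases ht : t = 1
  · subst ht
    simpa using h
  obtain ⟨P, _, hPc, hP⟩ := exists_evenFrame t (by omega)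
  obtain ⟨q, rfl⟩ : ∃ q, k = 2 * q := ⟨k / 2, by omega⟩
  have : NeZero q := ⟨by omega⟩
  have hs : FlexARC (2 * q) (SmallV q) (ZMod 2 × ZMod q) (ZMod 2) Unit := by
    refine FlexARC.of_equiv (Fintype.equivOfCardEq ?_) (Fintype.equivOfCardEq ?_)
      (Fintype.equivOfCardEq ?_) (Fintype.equivOfCardEq ?_) (flexARC_of_hasARCS h)
    · simp [ZMod.card]
      try ring
    · simp [ZMod.card]
    · simp only [Fintype.card_fin, ZMod.card, Nat.add_sub_cancel]
      exact Nat.mul_div_cancel _ (by omega)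
    · simp only [Fintype.card_fin, Nat.add_sub_cancel, Fintype.card_unit]
      exact Nat.div_self (by omega)
  have hb := flexARC_main hP q (by omega) hs
  refine hasARCS_of_flexARC rfl hk (FlexARC.of_equiv (Fintype.equivOfCardEq ?_)
    (Fintype.equivOfCardEq ?_) (Fintype.equivOfCardEq ?_) (Fintype.equivOfCardEq ?_) hb)
  · simp [ZMod.card, hPc]
    ring
  · simp only [Fintype.card_fin, ZMod.card, Nat.add_sub_cancel, Fintype.card_prod, hPc]
    symm
    apply Nat.div_eq_of_eq_mul_left (by omega)
    ring
  · simp only [Fintype.card_fin, ZMod.card, Nat.add_sub_cancel, Fintype.card_prod, hPc]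
    symm
    apply Nat.div_eq_of_eq_mul_left (by omega)
    ring
  · simp only [Fintype.card_fin, Nat.add_sub_cancel, hPc]
    symm
    apply Nat.div_eq_of_eq_mul_left (by omega)
    ring
end

section
/- There exists an almost resolvable 18-cycle system of order 37. -/
/-- Base almost parallel class number `q`, as a base-64 number. -/
def arcBase (q : ℕ) : ℕ :=
  if q = 0 then 22303523398706940371687671537101397718496484734160752602438764491
  else 4036767852612044332209060357014728567579915755979361220782310174

/-- Vertex `i` of cycle `o`; cycle `36` is the half-parallel class. -/
def arcVert (o i : ℕ) : ℕ :=
  if o = 36 then (9 - i / 2) % 9 + 9 * (i % 2)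
  else
    let v := arcBase (o / 18) / 64 ^ (18 * (o % 2) + i) % 64
    if v = 36 then 36 else v / 9 * 9 + (v % 9 + o / 2 % 9) % 9

/-- Rows of the lookup table: entry `b` of row `a` is `32 * cycle + position` of edge `ab`. -/
def arcRows : List ℕ :=
  [114616221908901245035287848923409992115559873440831816585348095293466335873293304922444342396892671304704628765316395110400,
   125005966692512856147231756867612766649113982158644723840302689250670957489843887143834541075190315242393898652575475958306,
   135309115763994057863065649483059207057389492975883997569308068360428115477599949201716482885242847861047167531058882220427,
   145632534871847181654736680233057708045730416051841300659633487987682144118920170528168400205475390617411526043685144647843,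
   155991599824269915981101584291726852760293200212630831497430269988036480507335715526214068485739827988921672742769470675624,
   166243404760275257475561878757146015271907592759033857973401397864212198485343841345425339501229971776550811677932119344104,
   176640716967252341365425636374086915659868795042351246808767358615462584812065322819608888010233521851737156579717965496867,
   93987454200749547274141845183847843398627627180862253325053401281317121486788305704721523725122537346313130101190883875083,
   104337784911727512603512415554328869112095511519531689930836950686805314357006267642274002782457155792047275332338029582818,
   124806128019399793056064575699053181745550952655346564425723096879344959541819132031769879610476296696287145576228301776000,
   135164728287835424246102982262736718556865289336350400676456585016874154330684358378808997002198745241566971769508478616721,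
   145433204133358217483919487366688341723079370424688563663433701888612608638355963649347526832564801103664106594845633837956,
   155757728136602851313125822843381073181507548515123176153425918162523236625015340037299741142667208468288692003400100749793,
   166074759085551766836891222063246086644975272003671775036429900566620973320870666544140994012430722332108574353688213129581,
   176468905710287105447546421574194212074861968298347423312411096578939899203254828765196852359514474229828087602114993154161,
   93788155207907251011275427240606451385603514609836549327093259277435670859840555322794800590328727232822730596856206035040,
   104168928308441605059348995107977312495446862078378044079017269625864890680198092740068881439807147765682608795892425491215,
   114496578644618996556895012204633836451792447444680749271829923695743600595659624450438979456761186013769587245962600544420,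
   38007650984563571505487114168529857128440762622239780429664678685238116499602999032399722240055828955230702330431996056334,
   48266928453403238866023136699073032084907346968491831136392054851187202377545968587998492492353720878203795102845963497679,
   58635901406745077978368684999012155538793052699787721997706070568746235599971874942448348258609410313313893857717824026830,
   68960051788578400112716382090241851517005395843607564682100814647005315667656086016164854661229811867684708234731048170183,
   79248272942582385843332897647685242932294002643255764703141145583332848126656925952240090882403066928354561343225975028334,
   89618143259068333414159657795041150232855133246873815652088684604048616963281673188591343224716369713211576298870117069799,
   6973214726246866200173836339731203841614080162934618162394112518502721625497730060125332971733998637621532280004477533283,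
   17284650574261791050127200455120711848980842564526760387020090200836060433957312138312901626644785476903965805906679241603,
   27633373198234555898858278357895979207113467212811428794847477203713261811353225762431348767446920184161930939065589176586,
   6847299462505270513736779380115584587287055352392124371303408369442718062829397440730656037727623184748297774483263812656,
   17150984224394903360171422577881557942233872695807925908527611915231946459728333706696302937128320263374961822495565644641,
   27441785141502529807520878218692410563851327607636875191615620391770586097871098953684687177924261812882211717152927189615,
   37769119920685132060292438990967437087151778757070867962407156751053908166435048918955034688229833042959707561734096386444,
   48123339987169043090400075539984780005186489916576999601859794025180280574069866854623476977370086586000572169296068633440,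
   58459036808877823646722095803099166064197525991439707221797102826567447245775839031881089702887454745464759403069119988834,
   68785923414314304922457777533882339397130662155628845769549469469891782571500117268797063288298439725037970013962072429225,
   79145233780469150299237396965034075726307689942406270754700629534222871110703312102833560061413893009770727973455503248433,
   89410433204350960682692179459868116541187661995662238352592129406983306402660313237839369508341768922860554172988609759598,
   43676285348381848033213875595980906544013166999486932911357264068243274437028018225427469002852872812905867824611209926]

/-- Lookup of the edge `ab`. -/
def arcLook (a b : ℕ) : ℕ := arcRows.getD a 0 / 2048 ^ b % 2048

theorem arcVert_lt : ∀ o < 37, ∀ i < 18, arcVert o i < 37 := by decide +kernel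

theorem arcVert_inj : ∀ o < 37, ∀ i < 18, ∀ j < 18, arcVert o i = arcVert o j → i = j := by
  decide +kernel

theorem arcVert_disj : ∀ q < 18, ∀ i < 18, ∀ j < 18,
    arcVert (2 * q) i ≠ arcVert (2 * q + 1) j := by
  decide +kernel

theorem arcLook_vert : ∀ o < 37, ∀ i < 18,
    arcLook (arcVert o i) (arcVert o ((i + 1) % 18)) / 32 = o ∧
    arcLook (arcVert o ((i + 1) % 18)) (arcVert o i) / 32 = o := by
  decide +kernel

theorem arcLook_spec : ∀ a < 37, ∀ b < 37, a ≠ b →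
    arcLook a b / 32 < 37 ∧ arcLook a b % 32 < 18 ∧
    ((arcVert (arcLook a b / 32) (arcLook a b % 32) = a ∧
      arcVert (arcLook a b / 32) ((arcLook a b % 32 + 1) % 18) = b) ∨
     (arcVert (arcLook a b / 32) (arcLook a b % 32) = b ∧
      arcVert (arcLook a b / 32) ((arcLook a b % 32 + 1) % 18) = a)) := by
  decide +kernel

/-- Cycle `o` as a map to `Fin 37`. -/
def arcCyc (o : Fin 37) (i : ZMod 18) : Fin 37 :=
  ⟨arcVert o.val i.val, arcVert_lt _ o.isLt _ (ZMod.val_lt i)⟩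

theorem arcCyc_inj (o : Fin 37) : Function.Injective (arcCyc o) := by
  intro i j h
  exact ZMod.val_injective 18
    (arcVert_inj _ o.isLt _ (ZMod.val_lt i) _ (ZMod.val_lt j) (congrArg Fin.val h))

theorem zmod18_succ (i : ZMod 18) : (i + 1).val = (i.val + 1) % 18 := by
  rw [ZMod.val_add]; rfl

theorem arcCyc_mem_unique (o : Fin 37) (a b : Fin 37)
    (h : s(a, b) ∈ cycleEdgeSet (arcCyc o)) : arcLook a b / 32 = o := by
  obtain ⟨i, hi⟩ := h
  have key := arcLook_vert _ o.isLt _ (ZMod.val_lt i)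
  rw [← zmod18_succ] at key
  rw [Sym2.eq_iff] at hi
  rcases hi with ⟨rfl, rfl⟩ | ⟨rfl, rfl⟩
  · exact key.1
  · exact key.2

theorem arcCyc_mem_exists (a b : Fin 37) (hab : a ≠ b) :
    ∃ o : Fin 37, s(a, b) ∈ cycleEdgeSet (arcCyc o) := by
  obtain ⟨h1, h2, h3⟩ := arcLook_spec _ a.isLt _ b.isLt (fun h => hab (Fin.ext h))
  have hv : ((arcLook a b % 32 : ℕ) : ZMod 18).val = arcLook a b % 32 :=
    ZMod.val_cast_of_lt h2
  refine ⟨⟨_, h1⟩, ((arcLook a b % 32 : ℕ) : ZMod 18), ?_⟩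
  rw [Sym2.eq_iff]
  simp only [arcCyc, Fin.ext_iff, zmod18_succ, hv]
  rcases h3 with ⟨h, h'⟩ | ⟨h, h'⟩
  · exact Or.inl ⟨h.symm, h'.symm⟩
  · exact Or.inr ⟨h'.symm, h.symm⟩

/-- Index of a cycle of the system. -/
def arcIdx : (Fin 18 × Fin 2) ⊕ Fin 1 → Fin 37
  | Sum.inl q => ⟨2 * q.1.val + q.2.val, by omega⟩
  | Sum.inr _ => 36

theorem arcIdx_bij : Function.Bijective arcIdx := by
  decide +kernel

/-- There exists an almost resolvable 18-cycle system of order 37. -/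
theorem arcs_18_37 : HasARCS 18 37 := by
  refine ⟨fun (i : Fin 18) (j : Fin 2) => arcCyc (arcIdx (Sum.inl (i, j))),
    fun (j : Fin 1) => arcCyc (arcIdx (Sum.inr j)),
    fun _ _ => arcCyc_inj _, fun _ => arcCyc_inj _, ?_, ?_, ?_⟩
  · intro (i : Fin 18) (j₁ : Fin 2) (j₂ : Fin 2) hj
    rw [Set.disjoint_left]
    rintro x ⟨y, hy⟩ ⟨z, hz⟩
    have h := congrArg Fin.val (hy.trans hz.symm)
    have h1 := arcVert_disj _ i.isLt _ (ZMod.val_lt y) _ (ZMod.val_lt z)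
    have h2 := arcVert_disj _ i.isLt _ (ZMod.val_lt z) _ (ZMod.val_lt y)
    fin_cases j₁ <;> fin_cases j₂
    · exact hj rfl
    · exact h1 h
    · exact h2 h.symm
    · exact hj rfl
  · intro (j₁ : Fin 1) (j₂ : Fin 1) hj
    exact absurd (Subsingleton.elim j₁ j₂) hj
  · intro e he
    induction e using Sym2.ind with
    | _ a b =>
    have hab : a ≠ b := fun h => he (Sym2.mk_isDiag_iff.2 h)
    have conv : ∀ p : (Fin 18 × Fin 2) ⊕ Fin 1,
        Sum.elim (fun q : Fin 18 × Fin 2 => cycleEdgeSet (arcCyc (arcIdx (Sum.inl (q.1, q.2)))))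
          (fun j : Fin 1 => cycleEdgeSet (arcCyc (arcIdx (Sum.inr j)))) p
          = cycleEdgeSet (arcCyc (arcIdx p)) := by
      rintro (⟨_, _⟩ | _) <;> rfl
    obtain ⟨o, ho⟩ := arcCyc_mem_exists a b hab
    obtain ⟨p, rfl⟩ := arcIdx_bij.2 o
    refine ⟨p, ?_, ?_⟩
    · exact (Set.ext_iff.1 (conv p) s(a, b)).2 ho
    · intro p' hp'
      have hp2 : s(a, b) ∈ cycleEdgeSet (arcCyc (arcIdx p')) :=
        (Set.ext_iff.1 (conv p') s(a, b)).1 hp'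
      apply arcIdx_bij.1
      apply Fin.ext
      rw [← arcCyc_mem_unique _ a b hp2, ← arcCyc_mem_unique _ a b ho]
end
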